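/- For every real number x ≥ 10^100, π(2x) + π(x) ≤ 3.015·(π(2x) − π(x)), where π(t) denotes the number of primes p ≤ t. -/

import Mathlib

open Finset ArithmeticFunction
open scoped Chebyshev Nat


namespace PC

lemma log_fact (n : ℕ) : Real.log (n ! : ℝ) = ∑ m ∈ Ioc 0 n, Λ m * ((n / m : ℕ) : ℝ) := by
  rw [← ArithmeticFunction.sum_Ioc_mul_zeta_eq_sum, ArithmeticFunction.vonMangoldt_mul_zeta,
    ← Finset.prod_Ico_id_eq_factorial, Nat.cast_prod, Real.log_prod]
  · apply Finset.sum_congr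
    · ext; simp; omega
    · intros; rfl
  · intro i hi
    simp at hi
    have : i ≠ 0 := by omega
    exact_mod_cast this

lemma psi_div (x : ℝ) (k : ℕ) : ψ (x / k) = ψ ((⌊x⌋₊ / k : ℕ) : ℝ) := by
  rw [Chebyshev.psi_eq_psi_coe_floor, Nat.floor_div_natCast]

lemma psi_nat (n : ℕ) : ψ (n : ℝ) = ∑ m ∈ Ioc 0 n, Λ m := by
  simp [Chebyshev.psi]

lemma sum_fiber (g : ℕ → ℝ) (x : ℝ) :
    ∑ m ∈ Ioc 0 ⌊x⌋₊, Λ m * g (⌊x⌋₊ / m) =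
      ∑ k ∈ Icc 1 ⌊x⌋₊, g k * (ψ (x / k) - ψ (x / (k + 1 : ℕ))) := by
  set n := ⌊x⌋₊ with hn
  have hmaps : ∀ m ∈ Ioc 0 n, n / m ∈ Icc 1 n := by
    intro m hm
    simp only [mem_Ioc, mem_Icc] at *
    exact ⟨(Nat.one_le_div_iff hm.1).2 hm.2, Nat.div_le_self _ _⟩
  rw [← Finset.sum_fiberwise_of_maps_to hmaps]
  apply Finset.sum_congr rfl
  intro k hk
  simp only [mem_Icc] at hk
  rw [psi_div, psi_div, ← hn, psi_nat, psi_nat]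
  have hsub : Ioc 0 (n / (k+1)) ⊆ Ioc 0 (n / k) :=
    Ioc_subset_Ioc_right (Nat.div_le_div_left (by omega) (by omega))
  have heq : filter (fun m => n / m = k) (Ioc 0 n) = Ioc 0 (n / k) \ Ioc 0 (n / (k+1)) := by
    ext m
    simp only [mem_filter, mem_Ioc, mem_sdiff, not_and, not_le]
    constructor
    · rintro ⟨⟨h0, h1⟩, h2⟩
      refine ⟨⟨h0, ?_⟩, fun _ => ?_⟩
      · rw [Nat.le_div_iff_mul_le (by omega)]
        have := Nat.div_mul_le_self n m
        rw [h2] at this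
        linarith
      · rw [Nat.div_lt_iff_lt_mul (by omega)]
        have := Nat.lt_div_mul_add (a := n) h0
        rw [h2] at this
        nlinarith
    · rintro ⟨⟨h0, h1⟩, h2⟩
      have h2 := h2 h0
      rw [Nat.le_div_iff_mul_le (by omega)] at h1
      rw [Nat.div_lt_iff_lt_mul (by omega)] at h2
      refine ⟨⟨h0, ?_⟩, ?_⟩
      · nlinarith
      · apply Nat.div_eq_of_lt_le <;> nlinarith
  rw [← Finset.sum_sdiff hsub, add_sub_cancel_right, Finset.mul_sum, ← heq]
  apply Finset.sum_congr rfl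
  · intro m hm
    simp only [mem_filter] at hm
    rw [hm.2, mul_comm]

/-- crude Stirling -/
lemma stir_nat (n : ℕ) (hn : 1 ≤ n) : 
    (n:ℝ) * Real.log n - n ≤ Real.log (n ! : ℝ) ∧ Real.log (n ! : ℝ) ≤ n * Real.log n - n + Real.log n + 1 := by
  induction n, hn using Nat.le_induction with
  | base => simp
  | succ n hn ih =>
    have hn0 : (0:ℝ) < n := by exact_mod_cast hn
    rw [Nat.factorial_succ, Nat.cast_mul, Real.log_mul (by positivity) (by positivity)]
    push_cast
    have h1 : Real.log (n+1) - Real.log n ≤ 1 / n := by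
      rw [← Real.log_div (by positivity) (by positivity)]
      have := Real.log_le_sub_one_of_pos (x := (n+1:ℝ)/n) (by positivity)
      have e : ((n:ℝ)+1)/n - 1 = 1/n := by field_simp; ring
      linarith
    have h2 : 1 / ((n:ℝ)+1) ≤ Real.log (n+1) - Real.log n := by
      rw [← Real.log_div (by positivity) (by positivity)]
      have := Real.one_sub_inv_le_log_of_pos (x := (n+1:ℝ)/n) (by positivity)
      have e : 1 - (((n:ℝ)+1)/n)⁻¹ = 1/(n+1) := by field_simp; ring
      linarith
    have h1' : n * (Real.log (n+1) - Real.log n) ≤ 1 := by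
      calc _ ≤ n * (1/(n:ℝ)) := by gcongr
        _ = 1 := by field_simp
    have h2' : 1 ≤ ((n:ℝ)+1) * (Real.log (n+1) - Real.log n) := by
      calc (1:ℝ) = (n+1) * (1/((n:ℝ)+1)) := by field_simp
        _ ≤ _ := by gcongr
    constructor <;> nlinarith [ih.1, ih.2]

lemma stir (y : ℝ) (hy : 1 ≤ y) :
    |Real.log (⌊y⌋₊ ! : ℝ) - (y * Real.log y - y)| ≤ Real.log y + 1 := by
  have hn : 1 ≤ ⌊y⌋₊ := Nat.one_le_floor_iff y |>.2 hy
  have hn' : (1:ℝ) ≤ ⌊y⌋₊ := by exact_mod_cast hn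
  obtain ⟨h1, h2⟩ := stir_nat _ hn
  have h3 := Nat.floor_le (by linarith : 0 ≤ y)
  have h4 := Nat.lt_floor_add_one y
  set n : ℝ := (⌊y⌋₊ : ℝ) with hnn
  have hl : Real.log n ≤ Real.log y := Real.log_le_log (by linarith) h3
  have hl0 : 0 ≤ Real.log n := Real.log_nonneg hn'
  have h5 : Real.log y - Real.log n ≤ (y - n) / n := by
    rw [← Real.log_div (by positivity) (by positivity)]
    have := Real.log_le_sub_one_of_pos (x := y/n) (by positivity)
    have e : y/n - 1 = (y-n)/n := by field_simp
    linarith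
  have h6 : n * (Real.log y - Real.log n) ≤ y - n := by
    calc _ ≤ n * ((y-n)/n) := by gcongr
      _ = _ := by field_simp
  have h7 : (y - n) / y ≤ Real.log y - Real.log n := by
    rw [← Real.log_div (by positivity) (by positivity)]
    have := Real.one_sub_inv_le_log_of_pos (x := y/n) (by positivity)
    have e : 1 - (y/n)⁻¹ = (y-n)/y := by field_simp
    linarith
  have h8 : y - n ≤ y * (Real.log y - Real.log n) := by
    calc y - n = y * ((y-n)/y) := by field_simp
      _ ≤ _ := by gcongr
  rw [abs_le]
  constructor <;> nlinarith
end PC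

namespace PC

/-- the Chebyshev combination -/
def A (ν : ℕ → ℤ) (N k : ℕ) : ℤ := ∑ d ∈ Icc 1 N, ν d * ((k / d : ℕ) : ℤ)
noncomputable def kap (ν : ℕ → ℤ) (N : ℕ) : ℝ := ∑ d ∈ Icc 1 N, (ν d : ℝ) / d
noncomputable def alpha (ν : ℕ → ℤ) (N : ℕ) : ℝ := - ∑ d ∈ Icc 1 N, (ν d : ℝ) * Real.log d / d
noncomputable def S (ν : ℕ → ℤ) (N k : ℕ) : ℝ := 1 + kap ν N * k - A ν N k

lemma log_fact_div (n d : ℕ) :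
    Real.log ((n / d) ! : ℝ) = ∑ m ∈ Ioc 0 n, Λ m * ((n / m / d : ℕ) : ℝ) := by
  rw [log_fact]
  have hsub : Ioc 0 (n / d) ⊆ Ioc 0 n := Ioc_subset_Ioc_right (Nat.div_le_self _ _)
  rw [← Finset.sum_subset hsub]
  · apply Finset.sum_congr rfl
    intro m _
    rw [Nat.div_div_eq_div_mul, Nat.div_div_eq_div_mul, mul_comm d m]
  · intro m hm hm'
    simp only [mem_Ioc] at hm hm'
    have : n / d / m = 0 := Nat.div_eq_of_lt (by omega)
    rw [Nat.div_div_eq_div_mul, mul_comm m d, ← Nat.div_div_eq_div_mul, this]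
    simp

lemma cheb (ν : ℕ → ℤ) (N : ℕ) (hν : ∀ d, |(ν d : ℝ)| ≤ 1) (x : ℝ) (h1 : 1 ≤ x) (hx : N ≤ x) :
    |ψ x - alpha ν N * x - ∑ k ∈ Icc 1 ⌊x⌋₊, S ν N k * (ψ (x / k) - ψ (x / (k + 1 : ℕ)))|
      ≤ (N + |kap ν N|) * (Real.log x + 1) := by
  rw [← sum_fiber]
  have hS : ∀ m ∈ Ioc 0 ⌊x⌋₊, Λ m * S ν N (⌊x⌋₊ / m) = Λ m -
     (∑ d ∈ Icc 1 N, (ν d : ℝ) * (Λ m * ((⌊x⌋₊ / m / d : ℕ) : ℝ)) - kap ν N * (Λ m * ((⌊x⌋₊ / m : ℕ) : ℝ))) := by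
    intro m _
    simp only [S, A, Int.cast_sum, Int.cast_mul, Int.cast_natCast]
    have : ∑ d ∈ Icc 1 N, (ν d : ℝ) * (Λ m * ((⌊x⌋₊ / m / d : ℕ) : ℝ)) =
       Λ m * ∑ d ∈ Icc 1 N, (ν d : ℝ) * ((⌊x⌋₊ / m / d : ℕ) : ℝ) := by
      rw [Finset.mul_sum]; apply Finset.sum_congr rfl; intros; ring
    rw [this]; ring
  rw [Finset.sum_congr rfl hS, Finset.sum_sub_distrib, Finset.sum_sub_distrib, Finset.sum_comm]
  simp_rw [← Finset.mul_sum, ← log_fact_div, ← log_fact]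
  have e1 : ∑ m ∈ Ioc 0 ⌊x⌋₊, Λ m = ψ x := rfl
  rw [e1]
  have hlog : 0 ≤ Real.log x := Real.log_nonneg h1
  -- main terms
  have key : alpha ν N * x = ∑ d ∈ Icc 1 N, (ν d : ℝ) * ((x / d) * Real.log (x / d) - x / d)
      - kap ν N * (x * Real.log x - x) := by
    have : ∀ d ∈ Icc 1 N, (ν d : ℝ) * ((x / d) * Real.log (x / d) - x / d) =
      (ν d : ℝ) / d * (x * Real.log x - x) - (ν d : ℝ) * Real.log d / d * x := by
      intro d hd
      simp only [mem_Icc] at hd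
      have hd' : (0:ℝ) < d := by exact_mod_cast hd.1
      rw [Real.log_div (by positivity) (by positivity)]
      field_simp
      ring
    rw [Finset.sum_congr rfl this, Finset.sum_sub_distrib, ← Finset.sum_mul, ← Finset.sum_mul, alpha, kap]
    ring
  rw [key]
  have b1 : ∀ d ∈ Icc 1 N, |(ν d : ℝ) * (Real.log ((⌊x⌋₊ / d) ! : ℝ) - ((x / d) * Real.log (x / d) - x / d))|
      ≤ Real.log x + 1 := by
    intro d hd
    simp only [mem_Icc] at hd
    have hd' : (1:ℝ) ≤ d := by exact_mod_cast hd.1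
    have hdN : (d:ℝ) ≤ N := by exact_mod_cast hd.2
    have h := stir (x / d) (by rw [le_div_iff₀ (by linarith)]; linarith)
    rw [Nat.floor_div_natCast] at h
    rw [abs_mul]
    have h2 : Real.log (x/d) ≤ Real.log x := by
      apply Real.log_le_log (by positivity)
      exact div_le_self (by linarith) hd'
    calc _ ≤ 1 * (Real.log (x/d) + 1) := by
          apply mul_le_mul (hν d) h (abs_nonneg _) (by norm_num)
      _ ≤ _ := by linarith
  have b2 := stir x h1
  have e : ψ x - (∑ d ∈ Icc 1 N, (ν d : ℝ) * ((x / d) * Real.log (x / d) - x / d)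
      - kap ν N * (x * Real.log x - x)) - (ψ x - (∑ d ∈ Icc 1 N, (ν d : ℝ) * Real.log ((⌊x⌋₊ / d) ! : ℝ) -
       kap ν N * Real.log (⌊x⌋₊ ! : ℝ))) =
      ∑ d ∈ Icc 1 N, (ν d : ℝ) * (Real.log ((⌊x⌋₊ / d) ! : ℝ) - ((x / d) * Real.log (x / d) - x / d))
       - kap ν N * (Real.log (⌊x⌋₊ ! : ℝ) - (x * Real.log x - x)) := by
    simp only [mul_sub, Finset.sum_sub_distrib]
    ring
  rw [e]
  calc _ ≤ |∑ d ∈ Icc 1 N, (ν d : ℝ) * (Real.log ((⌊x⌋₊ / d) ! : ℝ) - ((x / d) * Real.log (x / d) - x / d))|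
       + |kap ν N * (Real.log (⌊x⌋₊ ! : ℝ) - (x * Real.log x - x))| := abs_sub _ _
    _ ≤ ∑ d ∈ Icc 1 N, (Real.log x + 1) + |kap ν N| * (Real.log x + 1) := by
        apply add_le_add
        · exact (Finset.abs_sum_le_sum_abs _ _).trans (Finset.sum_le_sum b1)
        · rw [abs_mul]; gcongr
    _ = _ := by simp; ring
end PC

namespace PC

lemma moeb_sum (n : ℕ) (hn : n ≠ 0) : ∑ e ∈ n.divisors, (moebius (n / e) : ℤ) = if n = 1 then 1 else 0 := by
  rw [Nat.sum_div_divisors n (fun e => (moebius e : ℤ))]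
  have := congrArg (fun f : ArithmeticFunction ℤ => f n) ArithmeticFunction.moebius_mul_coe_zeta
  simp only [ArithmeticFunction.mul_zeta_apply, ArithmeticFunction.coe_mul_zeta_apply, ArithmeticFunction.one_apply] at this
  exact this

lemma moeb_between (R g h : ℕ) (hg : g ∈ Icc 1 R) (hh : h ∈ Icc 1 R) :
    ∑ d ∈ Icc 1 R, (if g ∣ d ∧ d ∣ h then (moebius (h / d) : ℝ) else 0) = if h = g then 1 else 0 := by
  simp only [mem_Icc] at hg hh
  by_cases hgh : g ∣ h
  · obtain ⟨m, rfl⟩ := hgh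
    have hm : m ≠ 0 := by rintro rfl; simp at hh
    have e : ∑ d ∈ Icc 1 R, (if g ∣ d ∧ d ∣ g * m then (moebius (g * m / d) : ℝ) else 0)
       = ∑ e ∈ m.divisors, (moebius (m / e) : ℝ) := by
      rw [← Finset.sum_filter]
      symm
      apply Finset.sum_bij (fun e _ => g * e)
      · intro e he
        have := Nat.dvd_of_mem_divisors he
        have h3 : e ≤ m := Nat.divisor_le he
        have h4 : 0 < e := Nat.pos_of_mem_divisors he
        simp only [mem_filter, mem_Icc]
        refine ⟨⟨Nat.mul_pos (by omega) h4, ?_⟩, Dvd.intro _ rfl, Nat.mul_dvd_mul_left g this⟩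
        exact (Nat.mul_le_mul_left g h3).trans hh.2
      · intro a _ b _ hab
        exact Nat.eq_of_mul_eq_mul_left (by omega) hab
      · intro b hb
        simp only [mem_filter, mem_Icc] at hb
        obtain ⟨⟨_, _⟩, ⟨c, rfl⟩, h3⟩ := hb
        refine ⟨c, ?_, rfl⟩
        rw [Nat.mem_divisors]
        exact ⟨Nat.dvd_of_mul_dvd_mul_left (by omega) h3, hm⟩
      · intro e he
        rw [Nat.mul_div_mul_left _ _ (by omega : 0 < g)]
    rw [e]
    have := moeb_sum m hm
    have h2 : ((∑ e ∈ m.divisors, (moebius (m / e) : ℤ) : ℤ) : ℝ) = ((if m = 1 then 1 else 0 : ℤ) : ℝ) := by rw [this]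
    push_cast at h2
    rw [h2]
    have : g * m = g ↔ m = 1 := by
      constructor
      · intro h; exact Nat.eq_of_mul_eq_mul_left (by omega : 0 < g) (by omega)
      · rintro rfl; simp
    simp [this]
  · rw [Finset.sum_eq_zero, if_neg]
    · rintro rfl; exact hgh dvd_rfl
    · intro d _
      rw [if_neg]
      rintro ⟨h1, h2⟩; exact hgh (h1.trans h2)

noncomputable def LR (R : ℕ) : ℝ := ∑ g ∈ Icc 1 R, (moebius g : ℝ) ^ 2 / (Nat.totient g : ℝ)
noncomputable def yy (g : ℕ) : ℝ := (moebius g : ℝ) / (Nat.totient g : ℝ)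
noncomputable def lm (R d : ℕ) : ℝ := ∑ g ∈ Icc 1 R, if d ∣ g then (moebius (g / d) : ℝ) * yy g else 0

lemma lm_one (R : ℕ) : lm R 1 = LR R := by
  simp only [lm, LR, yy]
  apply Finset.sum_congr rfl
  intro g _
  simp; ring

lemma lm_inv (R g : ℕ) (hg : g ∈ Icc 1 R) : ∑ d ∈ Icc 1 R, (if g ∣ d then lm R d else 0) = yy g := by
  have : ∀ d ∈ Icc 1 R, (if g ∣ d then lm R d else 0) =
     ∑ h ∈ Icc 1 R, yy h * (if g ∣ d ∧ d ∣ h then (moebius (h / d) : ℝ) else 0) := by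
    intro d _
    by_cases h : g ∣ d
    · simp only [h, if_true, true_and, lm]
      apply Finset.sum_congr rfl
      intro k _
      split_ifs <;> ring
    · simp [h]
  rw [Finset.sum_congr rfl this, Finset.sum_comm]
  have : ∀ h ∈ Icc 1 R, ∑ d ∈ Icc 1 R, yy h * (if g ∣ d ∧ d ∣ h then (moebius (h / d) : ℝ) else 0) =
     if h = g then yy h else 0 := by
    intro h hh
    rw [← Finset.mul_sum, moeb_between R g h hg hh]
    split_ifs <;> simp
  rw [Finset.sum_congr rfl this, Finset.sum_ite_eq' ]
  simp [hg]

lemma gcd_tot (R d e : ℕ) (hd : d ∈ Icc 1 R) :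
    (Nat.gcd d e : ℝ) = ∑ g ∈ Icc 1 R, if g ∣ d ∧ g ∣ e then (Nat.totient g : ℝ) else 0 := by
  simp only [mem_Icc] at hd
  rw [← Finset.sum_filter]
  have := Nat.sum_totient (Nat.gcd d e)
  have hs : (Icc 1 R).filter (fun g => g ∣ d ∧ g ∣ e) = (Nat.gcd d e).divisors := by
    ext g
    simp only [mem_filter, mem_Icc, Nat.mem_divisors, Nat.dvd_gcd_iff]
    constructor
    · rintro ⟨_, h⟩; exact ⟨h, Nat.gcd_ne_zero_left (by omega)⟩
    · rintro ⟨h, _⟩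
      exact ⟨⟨Nat.pos_of_dvd_of_pos h.1 (by omega), (Nat.le_of_dvd (by omega) h.1).trans hd.2⟩, h⟩
  rw [hs]
  exact_mod_cast this.symm

lemma quad (R : ℕ) : ∑ d ∈ Icc 1 R, ∑ e ∈ Icc 1 R, lm R d * lm R e * (Nat.gcd d e : ℝ) = LR R := by
  have h1 : ∀ d ∈ Icc 1 R, ∑ e ∈ Icc 1 R, lm R d * lm R e * (Nat.gcd d e : ℝ) =
     ∑ g ∈ Icc 1 R, (Nat.totient g : ℝ) * ((if g ∣ d then lm R d else 0) * ∑ e ∈ Icc 1 R, (if g ∣ e then lm R e else 0)) := by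
    intro d hd
    simp_rw [gcd_tot R d _ hd, Finset.mul_sum]
    rw [Finset.sum_comm]
    apply Finset.sum_congr rfl; intro g _
    apply Finset.sum_congr rfl; intro e _
    by_cases a : g ∣ d <;> by_cases b : g ∣ e <;> simp [a, b]
    ring
  rw [Finset.sum_congr rfl h1, Finset.sum_comm, LR]
  apply Finset.sum_congr rfl
  intro g hg
  rw [← Finset.mul_sum, ← Finset.sum_mul, lm_inv R g hg, yy]
  have : (Nat.totient g : ℝ) ≠ 0 := by
    simp only [mem_Icc] at hg
    have := Nat.totient_pos.2 (by omega : 0 < g)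
    positivity
  field_simp

lemma LR_pos (R : ℕ) (hR : 1 ≤ R) : 0 < LR R := by
  apply Finset.sum_pos' 
  · intros; positivity
  · exact ⟨1, by simp [hR], by simp⟩
end PC

namespace PC

noncomputable def ff (g : ℕ) : ℝ := (moebius g : ℝ) ^ 2 / (Nat.totient g : ℝ)

lemma ff_nonneg (g : ℕ) : 0 ≤ ff g := by unfold ff; positivity

lemma ff_mul {m n : ℕ} (h : Nat.Coprime m n) : ff (m * n) = ff m * ff n := by
  unfold ff
  rw [ArithmeticFunction.isMultiplicative_moebius.map_mul_of_coprime h, Nat.totient_mul h]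
  push_cast
  rw [mul_pow, div_mul_div_comm]

lemma ff_div (d : ℕ) (hd : Squarefree d) : ∑ l ∈ d.divisors, ff l = d / (Nat.totient d : ℝ) := by
  have hd0 : d ≠ 0 := hd.ne_zero
  have ht : (0:ℝ) < (Nat.totient d : ℝ) := by
    have := Nat.totient_pos.2 (Nat.pos_of_ne_zero hd0); exact_mod_cast this
  have h : ∀ l ∈ d.divisors, ff l = (Nat.totient (d / l) : ℝ) / (Nat.totient d : ℝ) := by
    intro l hl
    obtain ⟨m, rfl⟩ := Nat.dvd_of_mem_divisors hl
    have hl0 : 0 < l := Nat.pos_of_mem_divisors hl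
    rw [Nat.mul_div_cancel_left _ hl0]
    have hsq := Nat.squarefree_mul_iff.1 hd
    rw [Nat.totient_mul hsq.1, ff]
    have h1 : (moebius l : ℝ)^2 = 1 := by
      have := ArithmeticFunction.moebius_sq_eq_one_of_squarefree hsq.2.1
      exact_mod_cast this
    have hm0 : 0 < m := Nat.pos_of_ne_zero (by rintro rfl; simp at hd0)
    have a1 : (0:ℝ) < (Nat.totient l : ℝ) := by exact_mod_cast Nat.totient_pos.2 hl0
    have a2 : (0:ℝ) < (Nat.totient m : ℝ) := by exact_mod_cast Nat.totient_pos.2 hm0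
    rw [h1]; push_cast; field_simp
  rw [Finset.sum_congr rfl h, ← Finset.sum_div]
  rw [Nat.sum_div_divisors d (fun e => (Nat.totient e : ℝ))]
  have := Nat.sum_totient d
  congr 1
  exact_mod_cast this

lemma lm_bound (R d : ℕ) (hd : d ∈ Icc 1 R) : |(d : ℝ) * lm R d| ≤ LR R := by
  simp only [mem_Icc] at hd
  have hLR : LR R = ∑ g ∈ Icc 1 R, ff g := rfl
  by_cases hsq : Squarefree d
  swap
  · have : lm R d = 0 := by
      apply Finset.sum_eq_zero
      intro g _
      split_ifs with h
      · have : ¬ Squarefree g := fun h' => hsq (h'.squarefree_of_dvd h)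
        simp [yy, ArithmeticFunction.moebius_eq_zero_of_not_squarefree this]
      · rfl
    rw [this]; simp
    rw [hLR]; exact Finset.sum_nonneg (fun _ _ => ff_nonneg _)
  set M := (Icc 1 (R / d)).filter (fun m => Nat.Coprime d m) with hM
  have ht : (0:ℝ) < (Nat.totient d : ℝ) := by
    have := Nat.totient_pos.2 (show 0 < d by omega); exact_mod_cast this
  have h1 : |lm R d| ≤ ∑ m ∈ M, ff m / (Nat.totient d : ℝ) := by
    have e : lm R d = ∑ m ∈ Icc 1 (R / d), (moebius m : ℝ) * yy (d * m) := by
      rw [lm, ← Finset.sum_filter]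
      symm
      apply Finset.sum_bij (fun m _ => d * m)
      · intro m hm
        simp only [mem_Icc] at hm
        simp only [mem_filter, mem_Icc]
        refine ⟨⟨Nat.mul_pos (by omega) (by omega), ?_⟩, Dvd.intro _ rfl⟩
        exact (Nat.mul_le_mul_left d hm.2).trans (Nat.mul_div_le R d)
      · intro a _ b _ hab
        exact Nat.eq_of_mul_eq_mul_left (by omega) hab
      · intro b hb
        simp only [mem_filter, mem_Icc] at hb
        obtain ⟨⟨h1, h2⟩, ⟨c, rfl⟩⟩ := hb
        refine ⟨c, ?_, rfl⟩
        simp only [mem_Icc]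
        refine ⟨Nat.pos_of_ne_zero (by rintro rfl; simp at h1), ?_⟩
        rw [Nat.le_div_iff_mul_le (by omega), mul_comm]; exact h2
      · intro m hm
        rw [Nat.mul_div_cancel_left _ (by omega : 0 < d)]
    rw [e, hM, Finset.sum_filter]
    refine (Finset.abs_sum_le_sum_abs _ _).trans (Finset.sum_le_sum ?_)
    intro m _
    split_ifs with hc
    · rw [yy, ArithmeticFunction.isMultiplicative_moebius.map_mul_of_coprime hc, Nat.totient_mul hc, ff]
      have hm1 : |(moebius d : ℝ)| ≤ 1 := by
        have := ArithmeticFunction.abs_moebius_le_one (n := d); exact_mod_cast this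
      push_cast
      have : (moebius m : ℝ) * ((moebius d : ℝ) * (moebius m : ℝ) / ((Nat.totient d : ℝ) * (Nat.totient m : ℝ)))
        = (moebius d : ℝ) * ((moebius m : ℝ)^2 / (Nat.totient m : ℝ) / (Nat.totient d : ℝ)) := by
        rw [div_div, mul_comm (Nat.totient m : ℝ)]; ring
      rw [this, abs_mul]
      rw [abs_of_nonneg (show 0 ≤ (moebius m : ℝ)^2 / (Nat.totient m : ℝ) / (Nat.totient d : ℝ) by positivity)]
      exact mul_le_of_le_one_left (by positivity) hm1
    · have : ¬ Squarefree (d * m) := fun h => hc (Nat.squarefree_mul_iff.1 h).1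
      simp [yy, ArithmeticFunction.moebius_eq_zero_of_not_squarefree this]
  have h2 : (∑ l ∈ d.divisors, ff l) * ∑ m ∈ M, ff m ≤ LR R := by
    rw [Finset.sum_mul_sum, ← Finset.sum_product', hLR]
    have : ∀ p ∈ d.divisors ×ˢ M, ff p.1 * ff p.2 = ff (p.1 * p.2) := by
      rintro ⟨l, m⟩ hp
      simp only [mem_product, hM, mem_filter] at hp
      rw [ff_mul (Nat.Coprime.of_dvd_left (Nat.dvd_of_mem_divisors hp.1) hp.2.2)]
    rw [Finset.sum_congr rfl this, ← Finset.sum_image (f := ff) (g := fun p : ℕ × ℕ => p.1 * p.2)]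
    · apply Finset.sum_le_sum_of_subset_of_nonneg
      · intro g hg
        simp only [mem_image, mem_product, hM, mem_filter, mem_Icc] at hg
        obtain ⟨⟨l, m⟩, ⟨hl, hm, _⟩, rfl⟩ := hg
        have h3 : l ≤ d := Nat.divisor_le hl
        have h4 : 0 < l := Nat.pos_of_mem_divisors hl
        simp only [mem_Icc]
        refine ⟨Nat.mul_pos h4 (by omega), ?_⟩
        exact (Nat.mul_le_mul h3 hm.2).trans (Nat.mul_div_le R d)
      · intros; exact ff_nonneg _
    · rintro ⟨l, m⟩ hp ⟨l', m'⟩ hp' heq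
      simp only [coe_product, Set.mem_prod, mem_coe, hM, mem_filter] at hp hp'
      simp only at heq
      have g1 : ∀ l m, l ∈ d.divisors → Nat.Coprime d m → Nat.gcd d (l * m) = l := by
        intro l m hl hm
        rw [Nat.Coprime.gcd_mul_right_cancel_right _ hm.symm, Nat.gcd_eq_right (Nat.dvd_of_mem_divisors hl)]
      have e1 : l = l' := by
        rw [← g1 l m hp.1 hp.2.2, heq, g1 l' m' hp'.1 hp'.2.2]
      subst e1
      have h4 : 0 < l := Nat.pos_of_mem_divisors hp.1
      rw [Nat.eq_of_mul_eq_mul_left h4 heq]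
  rw [ff_div d hsq] at h2
  rw [abs_mul, abs_of_nonneg (by positivity : (0:ℝ) ≤ d)]
  calc (d:ℝ) * |lm R d| ≤ d * ∑ m ∈ M, ff m / (Nat.totient d : ℝ) := by gcongr
    _ = d / (Nat.totient d : ℝ) * ∑ m ∈ M, ff m := by rw [← Finset.sum_div]; ring
    _ ≤ _ := h2

lemma rad_sum (g : ℕ) (hg : Squarefree g) (s : Finset ℕ) (hs : ∀ n ∈ s, n ≠ 0 ∧ ∏ p ∈ n.primeFactors, p = g) :
    ∑ n ∈ s, (1 : ℝ) / n ≤ 1 / (Nat.totient g : ℝ) := by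
  have hg0 : g ≠ 0 := hg.ne_zero
  let f : ℕ →* ℝ := { toFun := fun n => ((n:ℝ))⁻¹, map_one' := by simp, map_mul' := by intros; push_cast; rw [mul_inv] }
  have hf : ∀ {p : ℕ}, p.Prime → ‖f p‖ < 1 := by
    intro p hp
    have : (1:ℝ) < p := by exact_mod_cast hp.one_lt
    simp only [f, MonoidHom.coe_mk, OneHom.coe_mk, norm_inv, RCLike.norm_natCast]
    exact inv_lt_one_of_one_lt₀ this
  have E := EulerProduct.summable_and_hasSum_factoredNumbers_prod_filter_prime_geometric hf g.primeFactors
  have hprod : ∏ p ∈ g.primeFactors.filter Nat.Prime, (1 - f p)⁻¹ = g / (Nat.totient g : ℝ) := by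
    have h1 : g.primeFactors.filter Nat.Prime = g.primeFactors := by
      apply Finset.filter_true_of_mem; intro p hp; exact Nat.prime_of_mem_primeFactors hp
    rw [h1, Finset.prod_inv_distrib]
    have := Nat.totient_eq_mul_prod_factors g
    have h2 : (Nat.totient g : ℝ) = g * ∏ p ∈ g.primeFactors, (1 - (p:ℝ)⁻¹) := by
      have h3 := congrArg (fun q : ℚ => (q : ℝ)) this
      push_cast at h3
      exact h3
    have hg' : (g:ℝ) ≠ 0 := by exact_mod_cast hg0
    rw [h2, div_mul_eq_div_div, div_self hg', one_div]
    rfl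
  rw [hprod] at E
  have hs2 : ∀ n ∈ s, ∃ m : Nat.factoredNumbers g.primeFactors, n = g * m := by
    intro n hn
    obtain ⟨h0, h1⟩ := hs n hn
    have : g ∣ n := by rw [← h1]; exact Nat.prod_primeFactors_dvd n
    obtain ⟨m, rfl⟩ := this
    refine ⟨⟨m, ?_⟩, rfl⟩
    rw [Nat.mem_factoredNumbers_iff_primeFactors_subset]
    have hm : m ≠ 0 := by rintro rfl; simp at h0
    refine ⟨hm, ?_⟩
    have h3 : (g * m).primeFactors = g.primeFactors := by
      rw [← h1, Nat.primeFactors_prod (fun p hp => Nat.prime_of_mem_primeFactors hp), h1]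
    rw [← h3]
    exact Nat.primeFactors_mono (Dvd.intro_left _ rfl) h0
  have : Nonempty (Nat.factoredNumbers g.primeFactors) := ⟨⟨1, by simp [Nat.mem_factoredNumbers]⟩⟩
  choose! r hr using hs2
  have hinj : Set.InjOn r (s : Set ℕ) := by
    intro a ha b hb hab
    rw [hr a ha, hr b hb, hab]
  have ht : (0:ℝ) < (Nat.totient g : ℝ) := by
    have := Nat.totient_pos.2 (Nat.pos_of_ne_zero hg0); exact_mod_cast this
  have hgp : (0:ℝ) < g := by exact_mod_cast Nat.pos_of_ne_zero hg0
  calc ∑ n ∈ s, (1 : ℝ) / n = ∑ n ∈ s, (1/g:ℝ) * f (r n) := by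
        apply Finset.sum_congr rfl
        intro n hn
        conv_lhs => rw [hr n hn]
        push_cast
        simp only [f, MonoidHom.coe_mk, OneHom.coe_mk]
        rw [one_div, mul_inv, one_div]
    _ = (1/g:ℝ) * ∑ m ∈ s.image r, f m := by
        rw [Finset.sum_image hinj, Finset.mul_sum]
    _ ≤ (1/g:ℝ) * (g / (Nat.totient g : ℝ)) := by
        gcongr
        apply sum_le_hasSum _ _ E.2
        intro m _
        simp only [f, MonoidHom.coe_mk, OneHom.coe_mk]; positivity
    _ = _ := by field_simp

lemma LR_log (R : ℕ) : Real.log R ≤ LR R := by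
  by_cases hR : R = 0
  · subst hR; simp [LR]
  have h1 : Real.log R ≤ ∑ n ∈ Icc 1 R, (1:ℝ) / n := by
    have := log_add_one_le_harmonic R
    have h2 : ((harmonic R : ℚ) : ℝ) = ∑ n ∈ Icc 1 R, (1:ℝ) / n := by
      rw [harmonic_eq_sum_Icc]; push_cast; simp
    rw [← h2]
    refine le_trans (Real.log_le_log (by positivity) (by push_cast; linarith)) this
  refine h1.trans ?_
  have hmap : ∀ n ∈ Icc 1 R, (∏ p ∈ n.primeFactors, p) ∈ Icc 1 R := by
    intro n hn
    simp only [mem_Icc] at hn ⊢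
    have hd := Nat.prod_primeFactors_dvd n
    exact ⟨Nat.pos_of_dvd_of_pos hd (by omega), (Nat.le_of_dvd (by omega) hd).trans hn.2⟩
  rw [← Finset.sum_fiberwise_of_maps_to hmap, LR]
  apply Finset.sum_le_sum
  intro g hg
  by_cases hsq : Squarefree g
  · have h1 : (moebius g : ℝ)^2 = 1 := by
      have := ArithmeticFunction.moebius_sq_eq_one_of_squarefree hsq
      exact_mod_cast this
    rw [h1]
    apply rad_sum g hsq
    intro n hn
    simp only [mem_filter, mem_Icc] at hn
    exact ⟨by omega, hn.2⟩
  · rw [Finset.sum_eq_zero]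
    · positivity
    · intro n hn
      exfalso
      simp only [mem_filter, mem_Icc] at hn
      apply hsq
      rw [← hn.2]
      rw [← Nat.radical_eq_prod_primeFactors]
      exact UniqueFactorizationMonoid.squarefree_radical
end PC

namespace PC

lemma count_mult (a b m : ℕ) (hab : a ≤ b) (hm : 0 < m) :
    |((((Ioc a b).filter (fun n => m ∣ n)).card : ℕ) : ℝ) - ((b:ℝ) - a) / m| ≤ 1 := by
  have h : ((Ioc a b).filter (fun n => m ∣ n)).card + a / m = b / m := by
    rw [← Nat.Ioc_filter_dvd_card_eq_div b m, ← Nat.Ioc_filter_dvd_card_eq_div a m,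
      ← Finset.Ioc_union_Ioc_eq_Ioc (Nat.zero_le a) hab, Finset.filter_union, Finset.card_union_of_disjoint]
    · ring
    · apply Finset.disjoint_filter_filter
      rw [Finset.disjoint_left]; intro x; simp; omega
  have h' : ((((Ioc a b).filter (fun n => m ∣ n)).card : ℕ) : ℝ) = ((b / m : ℕ) : ℝ) - ((a / m : ℕ) : ℝ) := by
    rw [← h]; push_cast; ring
  rw [h', sub_div]
  have hm' : (0:ℝ) < m := by exact_mod_cast hm
  have f : ∀ c : ℕ, ((c / m : ℕ) : ℝ) ≤ (c:ℝ) / m ∧ (c:ℝ) / m ≤ ((c / m : ℕ) : ℝ) + 1 := by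
    intro c
    refine ⟨Nat.cast_div_le, ?_⟩
    rw [div_le_iff₀ hm']
    have := Nat.lt_succ_iff.1 (Nat.lt_succ_of_lt (Nat.lt_mul_div_succ c hm))
    have h2 : (c:ℝ) ≤ ((m * (c / m + 1) : ℕ) : ℝ) := by exact_mod_cast this
    push_cast at h2
    have : ((c / m : ℕ) : ℝ) = ((c / m : ℕ) : ℝ) := rfl
    push_cast
    linarith
  rw [abs_le]
  have := f a; have := f b
  constructor <;> linarith

lemma sieve (R a b : ℕ) (hR : 2 ≤ R) (hab : a ≤ b) :
    ((((Ioc a b).filter (fun p => p.Prime ∧ R < p)).card : ℕ) : ℝ) ≤ ((b:ℝ) - a) / Real.log R + R ^ 2 := by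
  have hL : 0 < LR R := LR_pos R (by omega)
  have hlog : 0 < Real.log R := Real.log_pos (by exact_mod_cast (by omega : 1 < R))
  set lam : ℕ → ℝ := fun d => d * lm R d / LR R with hlam
  have hl1 : lam 1 = 1 := by simp only [hlam]; rw [lm_one]; field_simp; simp
  have hle : ∀ d ∈ Icc 1 R, |lam d| ≤ 1 := by
    intro d hd
    simp only [hlam]
    rw [abs_div, abs_of_pos hL, div_le_one hL]
    exact lm_bound R d hd
  have h1 : ((((Ioc a b).filter (fun p => p.Prime ∧ R < p)).card : ℕ) : ℝ) ≤
      ∑ n ∈ Ioc a b, (∑ d ∈ Icc 1 R, if d ∣ n then lam d else 0)^2 := by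
    rw [Finset.card_filter]
    push_cast
    apply Finset.sum_le_sum
    intro n _
    split_ifs with hp
    · have : ∑ d ∈ Icc 1 R, (if d ∣ n then lam d else 0) = 1 := by
        rw [Finset.sum_eq_single 1]
        · simp [hl1]
        · intro d hd hd1
          rw [if_neg]
          intro hdn
          simp only [mem_Icc] at hd
          rcases (Nat.dvd_prime hp.1).1 hdn with h | h <;> omega
        · intro h; simp at h; omega
      rw [this]; norm_num
    · positivity
  have h2 : ∑ n ∈ Ioc a b, (∑ d ∈ Icc 1 R, if d ∣ n then lam d else 0)^2 =
     ∑ d ∈ Icc 1 R, ∑ e ∈ Icc 1 R, lam d * lam e * ((((Ioc a b).filter (fun n => Nat.lcm d e ∣ n)).card : ℕ) : ℝ) := by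
    simp_rw [sq, Finset.sum_mul_sum]
    rw [Finset.sum_comm]
    apply Finset.sum_congr rfl; intro d _
    rw [Finset.sum_comm]
    apply Finset.sum_congr rfl; intro e _
    rw [Finset.card_filter]
    push_cast
    rw [Finset.mul_sum]
    apply Finset.sum_congr rfl; intro n _
    by_cases h1 : d ∣ n <;> by_cases h2 : e ∣ n <;> simp [h1, h2, Nat.lcm_dvd_iff]
  have h3 : ∑ d ∈ Icc 1 R, ∑ e ∈ Icc 1 R, lam d * lam e * (((b:ℝ) - a) / (Nat.lcm d e : ℝ)) = ((b:ℝ) - a) / LR R := by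
    have : ∀ d ∈ Icc 1 R, ∀ e ∈ Icc 1 R, lam d * lam e * (((b:ℝ) - a) / (Nat.lcm d e : ℝ)) =
       (((b:ℝ) - a) / LR R ^ 2) * (lm R d * lm R e * (Nat.gcd d e : ℝ)) := by
      intro d hd e he
      simp only [mem_Icc] at hd he
      have hd0 : (0:ℝ) < d := by exact_mod_cast hd.1
      have he0 : (0:ℝ) < e := by exact_mod_cast he.1
      have hg : (0:ℝ) < Nat.gcd d e := by exact_mod_cast Nat.gcd_pos_of_pos_left _ hd.1
      have : (Nat.gcd d e : ℝ) * (Nat.lcm d e : ℝ) = d * e := by exact_mod_cast Nat.gcd_mul_lcm d e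
      have h5 : (Nat.lcm d e : ℝ) = d * e / Nat.gcd d e := by rw [← this]; field_simp
      rw [h5]
      simp only [hlam]
      field_simp
    rw [Finset.sum_congr rfl (fun d hd => Finset.sum_congr rfl (this d hd))]
    simp_rw [← Finset.mul_sum]
    rw [quad]
    field_simp
  rw [h2] at h1
  have h4 : ∑ d ∈ Icc 1 R, ∑ e ∈ Icc 1 R, lam d * lam e * ((((Ioc a b).filter (fun n => Nat.lcm d e ∣ n)).card : ℕ) : ℝ)
     ≤ ∑ d ∈ Icc 1 R, ∑ e ∈ Icc 1 R, (lam d * lam e * (((b:ℝ) - a) / (Nat.lcm d e : ℝ)) + 1) := by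
    apply Finset.sum_le_sum; intro d hd
    apply Finset.sum_le_sum; intro e he
    have q1 := hle d hd
    have q2 := hle e he
    simp only [mem_Icc] at hd he
    have q3 := count_mult a b (Nat.lcm d e) hab (Nat.lcm_pos hd.1 he.1)
    have q4 : |lam d * lam e * (((((Ioc a b).filter (fun n => Nat.lcm d e ∣ n)).card : ℕ) : ℝ) - ((b:ℝ) - a) / (Nat.lcm d e : ℝ))| ≤ 1 := by
      rw [abs_mul, abs_mul]
      have : |lam d| * |lam e| ≤ 1 := mul_le_one₀ q1 (abs_nonneg _) q2
      exact mul_le_one₀ this (abs_nonneg _) q3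
    have := (abs_le.1 q4).2
    linarith
  simp_rw [Finset.sum_add_distrib] at h4
  rw [h3] at h4
  have h5 : ((b:ℝ) - a) / LR R ≤ ((b:ℝ) - a) / Real.log R := by
    have : (a:ℝ) ≤ b := by exact_mod_cast hab
    apply div_le_div_of_nonneg_left (by linarith) hlog (LR_log R)
  simp at h4
  nlinarith

open Chebyshev in
lemma BT (R : ℕ) (u v : ℝ) (hR : 2 ≤ R) (hRu : (R:ℝ) ≤ u) (huv : u ≤ v) :
    ψ v - ψ u ≤ Real.log v * ((v - u + 1) / Real.log R + R ^ 2) + 2 * √v * Real.log v := by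
  have hR' : (2:ℝ) ≤ R := by exact_mod_cast hR
  have h1 := Chebyshev.psi_sub_theta_le (x := v) (by linarith)
  have h2 := Chebyshev.theta_le_psi u
  have hlogR : 0 < Real.log R := Real.log_pos (by linarith)
  have hlogv : 0 ≤ Real.log v := Real.log_nonneg (by linarith)
  have h3 : θ v - θ u ≤ Real.log v * ((v - u + 1) / Real.log R + R ^ 2) := by
    have hf : ⌊u⌋₊ ≤ ⌊v⌋₊ := Nat.floor_le_floor huv
    have hs := sieve R ⌊u⌋₊ ⌊v⌋₊ hR hf
    have e : θ v - θ u = ∑ p ∈ (Ioc ⌊u⌋₊ ⌊v⌋₊).filter Nat.Prime, Real.log p := by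
      simp only [Chebyshev.theta]
      have : Ioc 0 ⌊v⌋₊ = Ioc 0 ⌊u⌋₊ ∪ Ioc ⌊u⌋₊ ⌊v⌋₊ := by
        rw [Finset.Ioc_union_Ioc_eq_Ioc (by omega) hf]
      rw [this, Finset.filter_union, Finset.sum_union]
      · ring
      · apply Finset.disjoint_filter_filter
        rw [Finset.disjoint_left]; intro x; simp; omega
    have e2 : (Ioc ⌊u⌋₊ ⌊v⌋₊).filter Nat.Prime = (Ioc ⌊u⌋₊ ⌊v⌋₊).filter (fun p => p.Prime ∧ R < p) := by
      apply Finset.filter_congr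
      intro p hp
      simp only [mem_Ioc] at hp
      have : R ≤ ⌊u⌋₊ := Nat.le_floor hRu
      constructor
      · intro h; exact ⟨h, by omega⟩
      · exact fun h => h.1
    rw [e, e2]
    have h5 : ((⌊v⌋₊:ℝ) - ⌊u⌋₊) ≤ v - u + 1 := by
      have := Nat.floor_le (show 0 ≤ v by linarith)
      have := Nat.lt_floor_add_one u
      linarith
    calc _ ≤ ∑ p ∈ (Ioc ⌊u⌋₊ ⌊v⌋₊).filter (fun p => p.Prime ∧ R < p), Real.log v := by
          apply Finset.sum_le_sum
          intro p hp
          simp only [mem_filter, mem_Ioc] at hp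
          apply Real.log_le_log
          · exact_mod_cast hp.2.1.pos
          · exact (Nat.le_floor_iff (by linarith)).1 hp.1.2
      _ = Real.log v * ((((Ioc ⌊u⌋₊ ⌊v⌋₊).filter (fun p => p.Prime ∧ R < p)).card : ℕ) : ℝ) := by
          rw [Finset.sum_const, nsmul_eq_mul]; ring
      _ ≤ Real.log v * (((⌊v⌋₊:ℝ) - ⌊u⌋₊) / Real.log R + R ^ 2) := by gcongr
      _ ≤ _ := by gcongr
  linarith
end PC

namespace PC

/-- the additive character `e(x) = exp(2πix)` -/
noncomputable def ee (x : ℝ) : ℂ := Complex.exp (2 * Real.pi * x * Complex.I)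

lemma ee_add (x y : ℝ) : ee (x + y) = ee x * ee y := by
  unfold ee; rw [← Complex.exp_add]; congr 1; push_cast; ring
lemma ee_zero : ee 0 = 1 := by simp [ee]
lemma ee_int (n : ℤ) : ee n = 1 := by
  unfold ee
  rw [Complex.exp_eq_one_iff]
  exact ⟨n, by push_cast; ring⟩
lemma ee_eq_one {x : ℝ} : ee x = 1 ↔ ∃ n : ℤ, x = n := by
  constructor
  · intro h
    unfold ee at h
    rw [Complex.exp_eq_one_iff] at h
    obtain ⟨n, hn⟩ := h
    refine ⟨n, ?_⟩
    have hpi : (Real.pi : ℂ) ≠ 0 := by exact_mod_cast Real.pi_ne_zero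
    have : (x : ℂ) = n := by
      have h2 : (2 * Real.pi * Complex.I : ℂ) * x = (2 * Real.pi * Complex.I) * n := by linear_combination hn
      exact mul_left_cancel₀ (by simp [hpi]) h2
    exact_mod_cast this
  · rintro ⟨n, rfl⟩; exact ee_int n
lemma ee_norm (x : ℝ) : ‖ee x‖ = 1 := by
  unfold ee
  have : (2 * Real.pi * x * Complex.I : ℂ) = ((2 * Real.pi * x : ℝ) : ℂ) * Complex.I := by push_cast; ring
  rw [this, Complex.norm_exp_ofReal_mul_I]
lemma ee_conj (x : ℝ) : (starRingEnd ℂ) (ee x) = ee (-x) := by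
  unfold ee
  rw [← Complex.exp_conj]; congr 1
  have : (2 * Real.pi * x * Complex.I : ℂ) = ((2 * Real.pi * x : ℝ) : ℂ) * Complex.I := by push_cast; ring
  rw [this, map_mul, Complex.conj_ofReal, Complex.conj_I]
  push_cast; ring
lemma ee_pow (x : ℝ) (n : ℕ) : ee (x * n) = ee x ^ n := by
  unfold ee; rw [← Complex.exp_nat_mul]; congr 1; push_cast; ring
lemma ee_neg_mul (x : ℝ) : ee (-x) * ee x = 1 := by rw [← ee_add]; simp [ee_zero]

lemma ee_sum (W : ℕ) (hW : 0 < W) (t : ℤ) :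
    ∑ k ∈ range W, ee ((t:ℝ) * k / W) = if (W:ℤ) ∣ t then (W:ℂ) else 0 := by
  have hW' : (W:ℝ) ≠ 0 := by positivity
  have h : ∀ k : ℕ, ee ((t:ℝ) * k / W) = ee ((t:ℝ)/W) ^ k := by
    intro k; rw [← ee_pow]; congr 1; ring
  simp_rw [h]
  split_ifs with hd
  · obtain ⟨c, rfl⟩ := hd
    have : ee (((W * c : ℤ) : ℝ) / W) = 1 := by
      rw [← ee_int c]; congr 1; push_cast; field_simp
    rw [this]; simp
  · have h1 : ee ((t:ℝ)/W) ≠ 1 := by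
      rw [Ne, ee_eq_one]
      rintro ⟨n, hn⟩
      apply hd
      refine ⟨n, ?_⟩
      rw [div_eq_iff hW'] at hn
      have : t = n * W := by exact_mod_cast hn
      rw [this]; ring
    rw [geom_sum_eq h1, ← ee_pow]
    have : (t:ℝ)/W * W = t := by field_simp
    rw [this, ee_int]; simp

lemma parseval {ι : Type*} (s : Finset ι) (W : ℕ) (hW : 0 < W) (m : ι → ℤ) (c : ι → ℂ)
    (hm : ∀ i ∈ s, ∀ j ∈ s, (W:ℤ) ∣ m i - m j → i = j) :
    ∑ k ∈ range W, ‖∑ i ∈ s, c i * ee ((m i : ℝ) * k / W)‖ ^ 2 = W * ∑ i ∈ s, ‖c i‖ ^ 2 := by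
  classical
  have key : ∀ z : ℂ, ((‖z‖ ^ 2 : ℝ) : ℂ) = z * (starRingEnd ℂ) z := by
    intro z; rw [Complex.mul_conj, Complex.normSq_eq_norm_sq]
  have : ((∑ k ∈ range W, ‖∑ i ∈ s, c i * ee ((m i : ℝ) * k / W)‖ ^ 2 : ℝ) : ℂ) = ((W * ∑ i ∈ s, ‖c i‖ ^ 2 : ℝ) : ℂ) := by
    rw [Complex.ofReal_sum]
    simp_rw [key, map_sum, Finset.sum_mul_sum]
    rw [Finset.sum_comm]
    rw [Complex.ofReal_mul, Complex.ofReal_sum, Finset.mul_sum]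
    apply Finset.sum_congr rfl
    intro i hi
    rw [Finset.sum_comm]
    rw [Finset.sum_eq_single i]
    · have : ∀ k ∈ range W, c i * ee ((m i : ℝ) * k / W) * (starRingEnd ℂ) (c i * ee ((m i : ℝ) * k / W)) = c i * (starRingEnd ℂ) (c i) := by
        intro k _
        rw [map_mul, ee_conj]
        have := ee_neg_mul ((m i : ℝ) * k / W)
        linear_combination (c i * (starRingEnd ℂ) (c i)) * this
      rw [Finset.sum_congr rfl this, key]; simp
    · intro j hj hji
      have : ∀ k ∈ range W, c i * ee ((m i : ℝ) * k / W) * (starRingEnd ℂ) (c j * ee ((m j : ℝ) * k / W)) =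
          c i * (starRingEnd ℂ) (c j) * ee (((m i - m j : ℤ) : ℝ) * k / W) := by
        intro k _
        rw [map_mul, ee_conj]
        have : ((m i - m j : ℤ) : ℝ) * k / W = (m i : ℝ) * k / W + -((m j : ℝ) * k / W) := by push_cast; ring
        rw [this, ee_add]; ring
      rw [Finset.sum_congr rfl this, ← Finset.mul_sum, ee_sum W hW, if_neg, mul_zero]
      intro h; exact hji (hm i hi j hj h).symm
    · intro h; exact absurd hi h
  exact_mod_cast this

lemma ee_sub_norm (x : ℝ) : ‖ee x - 1‖ = 2 * |Real.sin (Real.pi * x)| := by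
  unfold ee
  have : (2 * Real.pi * x * Complex.I : ℂ) = Complex.I * ((2 * Real.pi * x : ℝ) : ℂ) := by push_cast; ring
  rw [this, Complex.norm_exp_I_mul_ofReal_sub_one]
  rw [Real.norm_eq_abs, abs_mul, abs_two]
  congr 3; ring

lemma fejer_lower (W J : ℕ) (hJ : 0 < J) (hW : 0 < W) (m : ℤ) (hm : 2 * J * |m| ≤ W) :
    2 * J / Real.pi ≤ ‖∑ j ∈ range J, ee ((j:ℝ) * m / W)‖ := by
  have hpi := Real.pi_pos
  have hW' : (0:ℝ) < W := by positivity
  have hJ' : (0:ℝ) < J := by positivity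
  have h : ∀ j : ℕ, ee ((j:ℝ) * m / W) = ee ((m:ℝ)/W) ^ j := by
    intro k; rw [← ee_pow]; congr 1; ring
  simp_rw [h]
  by_cases hm0 : m = 0
  · subst hm0
    simp [ee_zero]
    rw [div_le_iff₀ hpi]
    nlinarith [Real.pi_gt_three]
  have hmpos : (0:ℝ) < |(m:ℝ)| := by simpa using hm0
  have hm' : 2 * J * |(m:ℝ)| ≤ W := by exact_mod_cast hm
  have hJ1 : (1:ℝ) ≤ J := by exact_mod_cast hJ
  have hs1 : |Real.sin (Real.pi * ((m:ℝ)/W))| ≤ Real.pi * (|(m:ℝ)|/W) := by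
    refine (Real.abs_sin_le_abs).trans ?_
    rw [abs_mul, abs_div, abs_of_pos hpi, abs_of_pos hW']
  have hs2 : 2 * (J * |(m:ℝ)|/W) ≤ |Real.sin (Real.pi * ((m:ℝ)/W * J))| := by
    have := Real.mul_abs_le_abs_sin (x := Real.pi * ((m:ℝ)/W * J)) ?_
    · refine le_trans (le_of_eq ?_) this
      rw [abs_mul, abs_mul, abs_div, abs_of_pos hpi, abs_of_pos hW', abs_of_pos hJ']
      field_simp
    · rw [abs_mul, abs_mul, abs_div, abs_of_pos hpi, abs_of_pos hW', abs_of_pos hJ']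
      have : |(m:ℝ)| / W * J ≤ 1/2 := by
        rw [div_mul_eq_mul_div, div_le_iff₀ hW']; linarith
      nlinarith
  have h1 : ee ((m:ℝ)/W) ≠ 1 := by
    intro h1
    have := ee_sub_norm ((m:ℝ)/W * J)
    rw [ee_pow, h1] at this
    simp at this
    rw [this] at hs2
    have : 0 < 2 * (J * |(m:ℝ)|/W) := by positivity
    rw [abs_zero] at hs2
    linarith
  rw [geom_sum_eq h1, ← ee_pow, norm_div, ee_sub_norm, ee_sub_norm]
  have hden : 0 < |Real.sin (Real.pi * ((m:ℝ)/W))| := by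
    have : 0 < ‖ee ((m:ℝ)/W) - 1‖ := norm_pos_iff.2 (sub_ne_zero.2 h1)
    rw [ee_sub_norm] at this
    linarith
  rw [mul_div_mul_left _ _ (by norm_num : (2:ℝ) ≠ 0), le_div_iff₀ hden]
  calc 2 * J / Real.pi * |Real.sin (Real.pi * ((m:ℝ)/W))| ≤ 2 * J / Real.pi * (Real.pi * (|(m:ℝ)|/W)) := by gcongr
    _ = 2 * (J * |(m:ℝ)|/W) := by field_simp
    _ ≤ _ := hs2

/-- large sieve type bound -/
lemma large_sieve {ι : Type*} (s : Finset ι) (W J c : ℕ) (hJ : 0 < J) (hW : 0 < W) (hc : 0 < c) (hWJ : W = 2 * c * J)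
    (m : ι → ℤ) (C : ι → ℂ)
    (hm : ∀ i ∈ s, ∀ j ∈ s, ∀ t : ℤ, |t| < J → (W:ℤ) ∣ t + (m i - m j) → t = 0 ∧ i = j) (k0 : ℕ) :
    ∑ k ∈ Ico k0 (k0 + 2 * c), ‖∑ i ∈ s, C i * ee ((m i : ℝ) * k / W)‖ ^ 2
      ≤ Real.pi ^ 2 / 4 * (2 * c) * ∑ i ∈ s, ‖C i‖ ^ 2 := by
  have hpi := Real.pi_pos
  have hW' : (0:ℝ) < W := by positivity
  have hJ' : (0:ℝ) < J := by positivity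
  have P := parseval ((range J) ×ˢ s) W hW (fun p => (p.1 : ℤ) + m p.2)
    (fun p => C p.2 * ee ((m p.2 : ℝ) * k0 / W) * ee (-((p.1:ℝ) * c / W))) (by
      rintro ⟨j, i⟩ h ⟨j', i'⟩ h' hd
      simp only [mem_product, mem_range] at h h'
      have := hm i h.2 i' h'.2 ((j:ℤ) - j') (by rw [abs_lt]; constructor <;> omega)
        (by simpa [add_sub_add_comm] using hd)
      ext
      · simp; omega
      · exact this.2)
  have e1 : ∑ p ∈ range J ×ˢ s, ‖C p.2 * ee ((m p.2 : ℝ) * k0 / W) * ee (-((p.1:ℝ) * c / W))‖ ^ 2 = J * ∑ i ∈ s, ‖C i‖ ^ 2 := by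
    rw [Finset.sum_product]
    simp [ee_norm]
  rw [e1] at P
  have e2 : ∀ k : ℕ, ∑ p ∈ range J ×ˢ s, C p.2 * ee ((m p.2 : ℝ) * k0 / W) * ee (-((p.1:ℝ) * c / W)) * ee ((((p.1 : ℤ) + m p.2 : ℤ) : ℝ) * k / W)
      = (∑ j ∈ range J, ee ((j:ℝ) * ((k - c : ℤ):ℝ) / W)) * ∑ i ∈ s, C i * ee ((m i : ℝ) * (k0 + k : ℕ) / W) := by
    intro k
    rw [Finset.sum_mul_sum, Finset.sum_product]
    apply Finset.sum_congr rfl; intro j _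
    apply Finset.sum_congr rfl; intro i _
    have a1 : (((j : ℤ) + m i : ℤ) : ℝ) * k / W = (j:ℝ) * k / W + (m i : ℝ) * k / W := by push_cast; ring
    have a2 : (j:ℝ) * ((k - c : ℤ):ℝ) / W = -((j:ℝ) * c / W) + (j:ℝ) * k / W := by push_cast; ring
    have a3 : (m i : ℝ) * (k0 + k : ℕ) / W = (m i : ℝ) * k0 / W + (m i : ℝ) * k / W := by push_cast; ring
    rw [a1, a2, a3, ee_add, ee_add, ee_add]; ring
  simp_rw [e2, norm_mul, mul_pow] at P
  have hsub : range (2 * c) ⊆ range W := by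
    apply Finset.range_subset_range.2; rw [hWJ]; exact Nat.le_mul_of_pos_right _ hJ
  have low : ∑ k ∈ range (2*c), (2 * J / Real.pi)^2 * ‖∑ i ∈ s, C i * ee ((m i : ℝ) * (k0 + k : ℕ) / W)‖ ^ 2
      ≤ W * (J * ∑ i ∈ s, ‖C i‖ ^ 2) := by
    rw [← P]
    refine le_trans ?_ (Finset.sum_le_sum_of_subset_of_nonneg hsub (fun _ _ _ => by positivity))
    apply Finset.sum_le_sum
    intro k hk
    simp only [mem_range] at hk
    gcongr
    apply fejer_lower W J hJ hW
    have h3 : |(k:ℤ) - c| ≤ c := by rw [abs_le]; constructor <;> omega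
    rw [hWJ]; push_cast
    nlinarith
  rw [Finset.sum_Ico_eq_sum_range, Nat.add_sub_cancel_left]
  rw [← Finset.mul_sum] at low
  set X := ∑ k ∈ range (2*c), ‖∑ i ∈ s, C i * ee ((m i : ℝ) * (k0 + k : ℕ) / W)‖ ^ 2
  set Q := ∑ i ∈ s, ‖C i‖ ^ 2
  have hWr : (W:ℝ) = 2 * c * J := by rw [hWJ]; push_cast; ring
  rw [hWr] at low
  have : X * (4 * J^2 / Real.pi^2) ≤ (Real.pi ^ 2 / 4 * (2 * c) * Q) * (4 * J^2 / Real.pi^2) := by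
    calc _ = (2 * J / Real.pi)^2 * X := by ring
      _ ≤ _ := low
      _ = _ := by field_simp
  exact le_of_mul_le_mul_right this (by positivity)
end PC

namespace PC

lemma ee_frac_ne {d a : ℕ} (ha : a ∈ Ico 1 d) : ee (-((a:ℝ)/d)) - 1 ≠ 0 := by
  simp only [mem_Ico] at ha
  have hd : (0:ℝ) < d := by exact_mod_cast (by omega : 0 < d)
  rw [sub_ne_zero, Ne, ee_eq_one]
  rintro ⟨n, hn⟩
  have h1 : (a:ℝ) / d < 1 := by rw [div_lt_one hd]; exact_mod_cast ha.2
  have h2 : 0 < (a:ℝ) / d := div_pos (by exact_mod_cast ha.1) hd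
  have h3 : (n:ℝ) < 0 := by linarith
  have h4 : (-1:ℝ) < n := by linarith
  have h5 : n < 0 := by exact_mod_cast h3
  have h6 : -1 < n := by exact_mod_cast h4
  omega

lemma base_sum (d : ℕ) (hd : 1 ≤ d) : ∑ a ∈ Ico 1 d, 1 / (ee (-((a:ℝ)/d)) - 1) = -((d:ℂ) - 1) / 2 := by
  have hd' : (d:ℝ) ≠ 0 := by positivity
  have h1 : ∑ a ∈ Ico 1 d, 1 / (ee (-((a:ℝ)/d)) - 1) = ∑ a ∈ Ico 1 d, 1 / (ee (((a:ℝ)/d)) - 1) := by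
    have := Finset.sum_Ico_reflect (fun a : ℕ => 1 / (ee (-((a:ℝ)/d)) - 1)) 1 (m := d) (n := d) (by omega)
    simp only [Nat.add_sub_cancel_left] at this
    rw [Nat.add_sub_cancel] at this
    rw [← this]
    apply Finset.sum_congr rfl
    intro a ha
    simp only [mem_Ico] at ha
    congr 2
    rw [Nat.cast_sub (by omega)]
    have : -(((d:ℝ) - a)/d) = (a:ℝ)/d + ((-1:ℤ):ℝ) := by field_simp; push_cast; ring
    rw [this, ee_add, ee_int, mul_one]
  have h2 : ∑ a ∈ Ico 1 d, (1 / (ee (-((a:ℝ)/d)) - 1) + 1 / (ee (((a:ℝ)/d)) - 1)) = ∑ a ∈ Ico 1 d, (-1 : ℂ) := by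
    apply Finset.sum_congr rfl
    intro a ha
    have n1 := ee_frac_ne ha
    have hm := ee_neg_mul ((a:ℝ)/d)
    have n2 : ee ((a:ℝ)/d) - 1 ≠ 0 := by
      intro h
      rw [sub_eq_zero] at h
      rw [h, mul_one] at hm
      exact n1 (by rw [hm]; ring)
    rw [div_add_div _ _ n1 n2, div_eq_iff (mul_ne_zero n1 n2)]
    linear_combination (2:ℂ) * hm - hm
  rw [Finset.sum_add_distrib, ← h1] at h2
  simp at h2
  rw [Nat.cast_sub hd] at h2
  push_cast at h2
  rw [eq_div_iff (by norm_num)]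
  simp only [one_div]
  linear_combination h2

lemma fourier_mod (d : ℕ) (hd : 1 ≤ d) (k : ℕ) :
    ((k % d : ℕ) : ℂ) = ((d:ℂ) - 1) / 2 + ∑ a ∈ Ico 1 d, 1 / (ee (-((a:ℝ)/d)) - 1) * ee ((a:ℝ) * k / d) := by
  have hd' : (d:ℝ) ≠ 0 := by positivity
  induction k with
  | zero =>
    simp only [Nat.zero_mod, Nat.cast_zero, mul_zero, zero_div, ee_zero, mul_one]
    rw [base_sum d hd]; ring
  | succ k ih =>
    have step : ∑ a ∈ Ico 1 d, 1 / (ee (-((a:ℝ)/d)) - 1) * ee ((a:ℝ) * (k+1 : ℕ) / d)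
       - ∑ a ∈ Ico 1 d, 1 / (ee (-((a:ℝ)/d)) - 1) * ee ((a:ℝ) * k / d) = - ∑ a ∈ Ico 1 d, ee (((k + 1 : ℕ):ℤ) * (a:ℝ) / d) := by
      rw [← Finset.sum_sub_distrib, ← Finset.sum_neg_distrib]
      apply Finset.sum_congr rfl
      intro a ha
      have n1 := ee_frac_ne ha
      have hm := ee_neg_mul ((a:ℝ)/d)
      have e1 : (a:ℝ) * (k+1 : ℕ) / d = (a:ℝ) * k / d + (a:ℝ)/d := by push_cast; ring
      have e2 : ((((k + 1 : ℕ):ℤ)):ℝ) * (a:ℝ) / d = (a:ℝ) * k / d + (a:ℝ)/d := by push_cast; ring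
      rw [e1, e2, ee_add]
      rw [← mul_sub, div_mul_eq_mul_div, div_eq_iff n1]
      linear_combination (-(ee ((a:ℝ) * k / d))) * (-hm)
    have hs := ee_sum d (by omega) ((k + 1 : ℕ):ℤ)
    rw [Finset.range_eq_Ico, Finset.sum_eq_sum_Ico_succ_bot (by omega)] at hs
    simp only [Nat.cast_zero, mul_zero, zero_div, ee_zero, zero_add] at hs
    have hs' : ∑ a ∈ Ico 1 d, ee (((k + 1 : ℕ):ℤ) * (a:ℝ) / d) = (if (d:ℤ) ∣ ((k + 1 : ℕ):ℤ) then (d:ℂ) else 0) - 1 := by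
      rw [← hs]; ring
    rw [hs'] at step
    have hmod : (((k + 1) % d : ℕ) : ℂ) = ((k % d : ℕ) : ℂ) + 1 - (if (d:ℤ) ∣ ((k + 1 : ℕ):ℤ) then (d:ℂ) else 0) := by
      have hk : k % d < d := Nat.mod_lt _ (by omega)
      split_ifs with h
      · have h' : d ∣ k + 1 := by exact_mod_cast h
        have h1 : (k % d + 1) % d = 0 := by rw [Nat.mod_add_mod]; exact Nat.mod_eq_zero_of_dvd h'
        have h2 : k % d + 1 = d := by
          by_contra hne
          rw [Nat.mod_eq_of_lt (by omega)] at h1; omega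
        rw [Nat.mod_eq_zero_of_dvd h']
        have h3 : ((k % d : ℕ) : ℂ) + 1 = d := by exact_mod_cast h2
        rw [h3]; simp
      · have h' : ¬ d ∣ k + 1 := by intro h2; exact h (by exact_mod_cast h2)
        have h2 : k % d + 1 ≠ d := by
          intro h2
          apply h'
          apply Nat.dvd_of_mod_eq_zero
          rw [← Nat.mod_add_mod, h2, Nat.mod_self]
        rw [← Nat.mod_add_mod, Nat.mod_eq_of_lt (by omega)]; push_cast; ring
    rw [hmod, ih]
    linear_combination -step

lemma csc_sum (q : ℕ) (hq : 1 ≤ q) : ∑ a ∈ Ico 1 q, ‖1 / (ee (-((a:ℝ)/q)) - 1)‖ ^ 2 = ((q:ℝ)^2 - 1) / 12 := by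
  have hq' : (q:ℝ) ≠ 0 := by positivity
  have P := parseval (Ico 1 q) q (by omega) (fun a => (a:ℤ)) (fun a => 1 / (ee (-((a:ℝ)/q)) - 1)) (by
    intro i hi j hj hd
    simp only [mem_Ico] at hi hj
    have : ((i:ℤ) - j) = 0 := Int.eq_zero_of_abs_lt_dvd hd (by rw [abs_lt]; constructor <;> omega)
    omega)
  have e : ∀ k ∈ range q, ‖∑ a ∈ Ico 1 q, 1 / (ee (-((a:ℝ)/q)) - 1) * ee (((a:ℤ):ℝ) * k / q)‖ ^ 2 = ((k:ℝ) - (q - 1)/2) ^ 2 := by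
    intro k hk
    simp only [mem_range] at hk
    have := fourier_mod q hq k
    rw [Nat.mod_eq_of_lt hk] at this
    have h2 : ∑ a ∈ Ico 1 q, 1 / (ee (-((a:ℝ)/q)) - 1) * ee (((a:ℤ):ℝ) * k / q) = (((k:ℝ) - (q - 1)/2 : ℝ) : ℂ) := by
      push_cast
      linear_combination -this
    rw [h2, Complex.norm_real, Real.norm_eq_abs, sq_abs]
  rw [Finset.sum_congr rfl e] at P
  have f : ∀ (c : ℝ) (n : ℕ), ∑ k ∈ range n, ((k:ℝ) - c)^2 = n * (n - 1) * (2 * n - 1)/6 - c * n * (n-1) + n * c^2 := by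
    intro c n
    induction n with
    | zero => simp
    | succ n ih => rw [Finset.sum_range_succ, ih]; push_cast; ring
  rw [f] at P
  have h3 : (q:ℝ) * ∑ a ∈ Ico 1 q, ‖1 / (ee (-((a:ℝ)/q)) - 1)‖ ^ 2 = q * (((q:ℝ)^2 - 1) / 12) := by
    rw [← P]; ring
  exact mul_left_cancel₀ hq' h3
end PC

namespace PC

noncomputable def vq (ν : ℕ → ℤ) (N q : ℕ) : ℝ := ∑ d ∈ Icc 1 N, if q ∣ d then (ν d : ℝ) / d else 0
noncomputable def c00 (ν : ℕ → ℤ) (N : ℕ) : ℝ := 1 + ∑ d ∈ Icc 1 N, (ν d : ℝ) / d * (((d:ℝ) - 1) / 2)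
noncomputable def QQ (ν : ℕ → ℤ) (N : ℕ) : ℝ :=
  c00 ν N ^ 2 + ∑ q ∈ Icc 2 N, vq ν N q ^ 2 * (((q:ℝ)^2 - 1) / 12)

lemma S_mod (ν : ℕ → ℤ) (N k : ℕ) : S ν N k = 1 + ∑ d ∈ Icc 1 N, (ν d : ℝ) / d * ((k % d : ℕ) : ℝ) := by
  unfold S kap A
  rw [Finset.sum_mul]
  push_cast [-Int.natCast_ediv]
  rw [add_sub_assoc, ← Finset.sum_sub_distrib]
  congr 1
  apply Finset.sum_congr rfl
  intro d hd
  simp only [mem_Icc] at hd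
  have hd' : (0:ℝ) < d := by exact_mod_cast hd.1
  have h : (k:ℝ) = d * ((k / d : ℕ) : ℝ) + ((k % d : ℕ) : ℝ) := by exact_mod_cast (Nat.div_add_mod k d).symm
  field_simp
  linear_combination (ν d : ℝ) * h

def PS (N : ℕ) : Finset (Σ _ : ℕ, ℕ) := (Icc 1 N).sigma (fun d => Ico 1 d)
def FS (N : ℕ) : Finset ℚ := (PS N).image (fun p => (p.2 : ℚ) / p.1)

lemma FS_mem {N : ℕ} {r : ℚ} (hr : r ∈ FS N) : 0 < r ∧ r < 1 ∧ r.den ≤ N := by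
  simp only [FS, PS, mem_image, mem_sigma, mem_Icc, mem_Ico] at hr
  obtain ⟨⟨d, a⟩, ⟨h1, h2⟩, rfl⟩ := hr
  simp only at h1 h2 ⊢
  have hd : (0:ℚ) < d := by exact_mod_cast h1.1
  refine ⟨div_pos (by exact_mod_cast h2.1) hd, (div_lt_one hd).2 (by exact_mod_cast h2.2), ?_⟩
  have : ((a:ℚ)/d).den ∣ d := by
    have := Rat.den_dvd a d
    simpa using (by exact_mod_cast this : (((a:ℤ):ℚ)/((d:ℤ):ℚ)).den ∣ d)
  exact (Nat.le_of_dvd (by omega) this).trans h1.2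

lemma FS_den {N : ℕ} {r : ℚ} (hr : r ∈ FS N) : 2 ≤ r.den := by
  have h := FS_mem hr
  by_contra hlt
  have h1 : r.den = 1 := by have := r.den_pos; omega
  have h2 : (r.num : ℚ) = r := by rw [← Rat.den_eq_one_iff]; exact h1
  have h3 : 0 < r.num := by
    have : (0:ℚ) < r.num := by rw [h2]; exact h.1
    exact_mod_cast this
  have h4 : r.num < 1 := by
    have : (r.num:ℚ) < 1 := by rw [h2]; exact h.2.1
    exact_mod_cast this
  omega

lemma S_fourier (ν : ℕ → ℤ) (N k : ℕ) : (S ν N k : ℂ) = (c00 ν N : ℂ) +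
    ∑ r ∈ FS N, (vq ν N r.den : ℂ) / (ee (-(r:ℝ)) - 1) * ee ((r:ℝ) * k) := by
  rw [S_mod]
  push_cast
  have h1 : ∀ d ∈ Icc 1 N, (ν d : ℂ) / d * ((k % d : ℕ) : ℂ) = (ν d : ℂ) / d * (((d:ℂ) - 1)/2) +
      ∑ a ∈ Ico 1 d, (ν d : ℂ) / d * (1 / (ee (-(((a:ℚ)/d : ℚ):ℝ)) - 1) * ee ((((a:ℚ)/d : ℚ):ℝ) * k)) := by
    intro d hd
    simp only [mem_Icc] at hd
    rw [fourier_mod d hd.1 k, mul_add, Finset.mul_sum]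
    congr 1
    apply Finset.sum_congr rfl
    intro a _
    push_cast
    congr 4
    ring
  rw [Finset.sum_congr rfl h1, Finset.sum_add_distrib]
  have hc00 : (c00 ν N : ℂ) = 1 + ∑ d ∈ Icc 1 N, (ν d : ℂ) / d * (((d:ℂ) - 1)/2) := by
    rw [c00]; push_cast; rfl
  rw [hc00, add_assoc]
  congr 2
  rw [Finset.sum_sigma' (Icc 1 N) (fun d => Ico 1 d) (fun d a => (ν d : ℂ) / d * (1 / (ee (-(((a:ℚ)/d : ℚ):ℝ)) - 1) * ee ((((a:ℚ)/d : ℚ):ℝ) * k)))]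
  have hmap : ∀ p ∈ PS N, ((p.2 : ℚ) / p.1) ∈ FS N := fun p hp => Finset.mem_image_of_mem _ hp
  change ∑ p ∈ PS N, _ = _
  rw [← Finset.sum_fiberwise_of_maps_to hmap]
  apply Finset.sum_congr rfl
  intro r hr
  have hr' := FS_mem hr
  have h2 : ∀ p ∈ (PS N).filter (fun p => (p.2 : ℚ) / p.1 = r),
      (ν p.1 : ℂ) / p.1 * (1 / (ee (-(((p.2:ℚ)/p.1 : ℚ):ℝ)) - 1) * ee ((((p.2:ℚ)/p.1 : ℚ):ℝ) * k)) =
      (ν p.1 : ℂ) / p.1 * (1 / (ee (-(r:ℝ)) - 1) * ee ((r:ℝ) * k)) := by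
    intro p hp
    simp only [mem_filter] at hp
    rw [hp.2]
  rw [Finset.sum_congr rfl h2, ← Finset.sum_mul]
  have h3 : ∑ p ∈ (PS N).filter (fun p => (p.2 : ℚ) / p.1 = r), (ν p.1 : ℂ) / p.1 = (vq ν N r.den : ℂ) := by
    unfold vq
    rw [← Finset.sum_filter]
    push_cast
    apply Finset.sum_bij (fun p _ => p.1)
    · rintro ⟨d, a⟩ hp
      simp only [mem_filter, PS, mem_sigma, mem_Icc, mem_Ico] at hp ⊢
      refine ⟨hp.1.1, ?_⟩
      rw [← hp.2]
      have := Rat.den_dvd a d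
      simpa using (by exact_mod_cast this : (((a:ℤ):ℚ)/((d:ℤ):ℚ)).den ∣ d)
    · rintro ⟨d, a⟩ hp ⟨d', a'⟩ hp' h
      simp only [mem_filter, PS, mem_sigma, mem_Icc, mem_Ico] at hp hp' h
      subst h
      have hd : (0:ℚ) < d := by exact_mod_cast hp.1.1.1
      have : (a:ℚ)/d = a'/d := by rw [hp.2, hp'.2]
      rw [div_left_inj' hd.ne'] at this
      have : a = a' := by exact_mod_cast this
      rw [this]
    · intro d hd
      simp only [mem_filter, mem_Icc] at hd
      obtain ⟨c, hc⟩ := hd.2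
      have hc0 : 0 < c := Nat.pos_of_ne_zero (by rintro rfl; simp at hc; omega)
      have hnum : 0 < r.num := Rat.num_pos.2 hr'.1
      have hden : (0:ℚ) < r.den := by exact_mod_cast r.den_pos
      have hn2 : ((r.num.toNat : ℕ) : ℚ) = r.num := by
        have : ((r.num.toNat : ℕ) : ℤ) = r.num := Int.toNat_of_nonneg hnum.le
        exact_mod_cast this
      have hlt : r.num.toNat < r.den := by
        have : (r.num:ℚ) < r.den := by
          have h := hr'.2.1
          rw [← Rat.num_div_den r, div_lt_one hden] at h
          exact h
        have : r.num < r.den := by exact_mod_cast this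
        omega
      refine ⟨⟨d, r.num.toNat * c⟩, ?_, rfl⟩
      simp only [mem_filter, PS, mem_sigma, mem_Icc, mem_Ico]
      refine ⟨⟨hd.1, Nat.mul_pos (by omega) hc0, ?_⟩, ?_⟩
      · rw [hc]; exact Nat.mul_lt_mul_of_pos_right hlt hc0
      · rw [hc]; push_cast; rw [hn2]
        have : (c:ℚ) ≠ 0 := by exact_mod_cast hc0.ne'
        rw [mul_div_mul_right _ _ this, Rat.num_div_den]
    · rintro ⟨d, a⟩ hp; rfl
  rw [h3]; ring

lemma Q_bound (ν : ℕ → ℤ) (N : ℕ) :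
    ∑ r ∈ FS N, ‖(vq ν N r.den : ℂ) / (ee (-(r:ℝ)) - 1)‖ ^ 2 ≤ ∑ q ∈ Icc 2 N, vq ν N q ^ 2 * (((q:ℝ)^2 - 1) / 12) := by
  have h1 : ∀ q ∈ Icc 2 N, vq ν N q ^ 2 * (((q:ℝ)^2 - 1) / 12) =
      ∑ a ∈ Ico 1 q, ‖(vq ν N q : ℂ) / (ee (-((a:ℝ)/q)) - 1)‖ ^ 2 := by
    intro q hq
    simp only [mem_Icc] at hq
    rw [← csc_sum q (by omega), Finset.mul_sum]
    apply Finset.sum_congr rfl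
    intro a _
    rw [norm_div, norm_div, div_pow, div_pow, Complex.norm_real, Real.norm_eq_abs, sq_abs]
    simp; ring
  rw [Finset.sum_congr rfl h1, Finset.sum_sigma']
  have hinj : Set.InjOn (fun r : ℚ => (⟨r.den, r.num.toNat⟩ : Σ _ : ℕ, ℕ)) (FS N) := by
    intro r hr s hs h
    simp only [Sigma.mk.injEq, heq_eq_eq] at h
    have p1 := Rat.num_pos.2 (FS_mem hr).1
    have p2 := Rat.num_pos.2 (FS_mem hs).1
    apply Rat.ext
    · omega
    · exact h.1
  have h2 : ∑ r ∈ FS N, ‖(vq ν N r.den : ℂ) / (ee (-(r:ℝ)) - 1)‖ ^ 2 =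
     ∑ p ∈ (FS N).image (fun r : ℚ => (⟨r.den, r.num.toNat⟩ : Σ _ : ℕ, ℕ)), ‖(vq ν N p.1 : ℂ) / (ee (-((p.2:ℝ)/p.1)) - 1)‖ ^ 2 := by
    rw [Finset.sum_image hinj]
    apply Finset.sum_congr rfl
    intro r hr
    have p1 := Rat.num_pos.2 (FS_mem hr).1
    have : ((r.num.toNat : ℕ) : ℝ) / r.den = r := by
      have h3 : ((r.num.toNat : ℕ) : ℤ) = r.num := Int.toNat_of_nonneg p1.le
      have h4 : ((r.num.toNat : ℕ) : ℝ) = r.num := by exact_mod_cast h3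
      rw [h4]
      exact_mod_cast Rat.num_div_den r
    simp only [this]
  rw [h2]
  apply Finset.sum_le_sum_of_subset_of_nonneg
  · intro p hp
    simp only [mem_image] at hp
    obtain ⟨r, hr, rfl⟩ := hp
    have hr' := FS_mem hr
    have p1 := Rat.num_pos.2 hr'.1
    have hden : (0:ℚ) < r.den := by exact_mod_cast r.den_pos
    have hlt : r.num.toNat < r.den := by
      have : (r.num:ℚ) < r.den := by
        have h := hr'.2.1
        rw [← Rat.num_div_den r, div_lt_one hden] at h
        exact h
      have : r.num < r.den := by exact_mod_cast this
      omega
    simp only [mem_sigma, mem_Icc, mem_Ico]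
    exact ⟨⟨FS_den hr, hr'.2.2⟩, by omega, hlt⟩
  · intros; positivity

lemma mean_sq (ν : ℕ → ℤ) (N c : ℕ) (hc : 0 < c) (hN : N ^ 2 ≤ 2 * c) (k0 : ℕ) :
    ∑ k ∈ Ico k0 (k0 + 2 * c), (S ν N k) ^ 2 ≤ Real.pi ^ 2 / 4 * (2 * c) * QQ ν N := by
  set J := N ! with hJ
  have hJ0 : 0 < J := Nat.factorial_pos _
  set W := 2 * c * J with hW
  have hW0 : 0 < W := by positivity
  have hWr : (0:ℝ) < W := by positivity
  set m : ℚ → ℤ := fun r => r.num * ((W / r.den : ℕ) : ℤ) with hm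
  have hmr : ∀ r : ℚ, r.den ≤ N → (m r : ℚ) = r * W := by
    intro r hr
    have : r.den ∣ W := (Nat.dvd_factorial r.den_pos hr).trans (Dvd.intro_left _ rfl)
    simp only [hm]
    rw [Int.cast_mul, Int.cast_natCast, Nat.cast_div this (by exact_mod_cast r.den_pos.ne')]
    nth_rewrite 3 [← Rat.num_div_den r]
    ring
  set C : ℚ → ℂ := fun r => if r = 0 then (c00 ν N : ℂ) else (vq ν N r.den : ℂ) / (ee (-(r:ℝ)) - 1) with hC
  have h0 : (0:ℚ) ∉ FS N := by intro h; exact absurd (FS_mem h).1 (lt_irrefl _)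
  by_cases hN0 : N = 0
  · subst hN0
    have : ∀ k ∈ Ico k0 (k0 + 2 * c), (S ν 0 k)^2 = 1 := by
      intro k _; rw [S_mod]; simp
    rw [Finset.sum_congr rfl this]
    simp [QQ, c00]
    have : (3:ℝ)^2 ≤ Real.pi^2 := by gcongr; exact Real.pi_gt_three.le
    have hc' : (0:ℝ) < c := by positivity
    nlinarith
  have hmem : ∀ r ∈ insert 0 (FS N), 0 ≤ r ∧ r < 1 ∧ r.den ≤ N := by
    intro r hr
    rw [mem_insert] at hr
    rcases hr with rfl | hr
    · simp; omega
    · have := FS_mem hr; exact ⟨this.1.le, this.2⟩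
  have L := large_sieve (insert 0 (FS N)) W J c hJ0 hW0 hc hW m C (by
    intro r hr s hs t ht hd
    obtain ⟨z, hz⟩ := hd
    have hr' := hmem r hr
    have hs' := hmem s hs
    have hWq : (0:ℚ) < W := by exact_mod_cast hW0
    have e1 : (t:ℚ) + (r * W - s * W) = W * z := by
      rw [← hmr r hr'.2.2, ← hmr s hs'.2.2]; exact_mod_cast hz
    have e2 : (z:ℚ) - (r - s) = t / W := by field_simp; linarith
    -- integrality
    set w : ℤ := z * r.den * s.den - (r.num * s.den - s.num * r.den) with hw
    have hrd : (0:ℚ) < r.den := by exact_mod_cast r.den_pos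
    have hsd : (0:ℚ) < s.den := by exact_mod_cast s.den_pos
    have e3 : (w:ℚ) = ((z:ℚ) - (r - s)) * (r.den * s.den) := by
      have n1 : (r.num : ℚ) = r * r.den := (Rat.mul_den_eq_num r).symm
      have n2 : (s.num : ℚ) = s * s.den := (Rat.mul_den_eq_num s).symm
      rw [hw]; push_cast; rw [n1, n2]; ring
    have hlt : |(w:ℚ)| < 1 := by
      rw [e3, e2, abs_mul, abs_div, abs_of_pos hWq, abs_of_pos (mul_pos hrd hsd)]
      have h1 : (|t| : ℚ) < J := by exact_mod_cast ht
      have h2 : ((r.den:ℚ) * s.den) ≤ 2 * c := by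
        have : r.den * s.den ≤ 2 * c := (Nat.mul_le_mul hr'.2.2 hs'.2.2).trans (by rw [← sq]; exact hN)
        exact_mod_cast this
      rw [div_mul_eq_mul_div, div_lt_one hWq]
      have : (W:ℚ) = 2 * c * J := by rw [hW]; push_cast; ring
      rw [this]
      have h3 := abs_nonneg (t:ℚ)
      have h4 : (0:ℚ) < r.den * s.den := mul_pos hrd hsd
      nlinarith
    have hw0 : w = 0 := by
      have : |w| < 1 := by exact_mod_cast hlt
      exact Int.abs_lt_one_iff.1 this
    have e4 : (z:ℚ) - (r - s) = 0 := by
      rw [hw0] at e3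
      have := mul_pos hrd hsd
      rcases mul_eq_zero.1 (by rw [← e3]; simp : ((z:ℚ) - (r - s)) * (r.den * s.den) = 0) with h | h
      · exact h
      · linarith
    have ht0 : t = 0 := by
      rw [e4] at e2
      have : (t:ℚ) = 0 := by
        rcases div_eq_zero_iff.1 e2.symm with h | h
        · exact h
        · linarith
      exact_mod_cast this
    have hz0 : z = 0 := by
      have a1 : (z:ℚ) < 1 := by linarith [hr'.1, hr'.2.1, hs'.1, hs'.2.1]
      have a2 : (-1:ℚ) < z := by linarith [hr'.1, hr'.2.1, hs'.1, hs'.2.1]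
      have a3 : z < 1 := by exact_mod_cast a1
      have a4 : -1 < z := by exact_mod_cast a2
      omega
    refine ⟨ht0, ?_⟩
    rw [hz0] at e4
    simp at e4
    linarith) k0
  have eS : ∀ k : ℕ, ∑ r ∈ insert 0 (FS N), C r * ee ((m r : ℝ) * k / W) = (S ν N k : ℂ) := by
    intro k
    rw [Finset.sum_insert h0, S_fourier]
    congr 1
    · simp [hC, hm, ee_zero]
    · apply Finset.sum_congr rfl
      intro r hr
      have hr' := FS_mem hr
      simp only [hC, if_neg hr'.1.ne']
      congr 2
      have : (m r : ℝ) = (r:ℝ) * W := by exact_mod_cast hmr r hr'.2.2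
      rw [this]; field_simp
  simp_rw [eS, Complex.norm_real, Real.norm_eq_abs, sq_abs] at L
  refine L.trans ?_
  gcongr
  rw [Finset.sum_insert h0, QQ]
  apply add_le_add
  · simp [hC]
  · refine le_trans (le_of_eq ?_) (Q_bound ν N)
    apply Finset.sum_congr rfl
    intro r hr
    simp only [hC, if_neg (FS_mem hr).1.ne']
end PC

namespace PC

noncomputable def mk (k : ℕ) : ℝ := 1 / ((k:ℝ) * (k + 1))

lemma mk_pos {k : ℕ} (hk : 1 ≤ k) : 0 < mk k := by
  unfold mk
  have : (0:ℝ) < k := by exact_mod_cast hk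
  positivity

lemma mk_nonneg (k : ℕ) : 0 ≤ mk k := by unfold mk; positivity

lemma mk_eq {k : ℕ} (hk : 1 ≤ k) : mk k = 1 / (k:ℝ) - 1 / ((k + 1 : ℕ) : ℝ) := by
  have : (0:ℝ) < k := by exact_mod_cast hk
  unfold mk; push_cast; field_simp; ring

lemma mk_sq_sum (K M : ℕ) (hK : 1 ≤ K) : ∑ k ∈ Ico K (K + M), mk k ^ 2 ≤ 1 / (3 * (K:ℝ)^3) - 1 / (3 * ((K + M : ℕ):ℝ)^3) := by
  induction M with
  | zero => simp
  | succ M ih =>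
    rw [← add_assoc, Finset.sum_Ico_succ_top (by omega)]
    have : mk (K + M) ^ 2 ≤ 1 / (3 * ((K + M : ℕ):ℝ)^3) - 1 / (3 * ((K + M + 1 : ℕ):ℝ)^3) := by
      set x : ℝ := ((K + M : ℕ):ℝ) with hx
      have hx0 : 0 < x := by rw [hx]; exact_mod_cast (by omega : 0 < K + M)
      unfold mk
      rw [← hx]
      push_cast [← hx]
      rw [div_sub_div _ _ (by positivity) (by positivity), div_pow, div_le_div_iff₀ (by positivity) (by positivity)]
      have : 0 ≤ x^3 := by positivity
      have h4 : 0 ≤ x^2 := by positivity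
      ring_nf
      nlinarith [pow_pos hx0 4, pow_pos hx0 5, pow_pos hx0 6, pow_pos hx0 7]
    linarith

lemma inv_sq_sum (M : ℕ) : ∑ j ∈ range M, (1:ℝ) / ((j:ℝ) + 1)^2 ≤ 2 := by
  have h : ∀ M : ℕ, ∑ j ∈ range (M + 1), (1:ℝ) / ((j:ℝ) + 1)^2 ≤ 2 - 1 / ((M:ℝ) + 1) := by
    intro M
    induction M with
    | zero => simp; norm_num
    | succ M ih =>
      rw [Finset.sum_range_succ]
      have : (1:ℝ) / (((M + 1 : ℕ):ℝ) + 1)^2 ≤ 1 / ((M:ℝ) + 1) - 1 / (((M + 1 : ℕ):ℝ) + 1) := by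
        push_cast
        rw [div_sub_div _ _ (by positivity) (by positivity), div_le_div_iff₀ (by positivity) (by positivity)]
        have : (0:ℝ) ≤ M := by positivity
        nlinarith
      linarith
  rcases M with _ | M
  · simp
  · have := h M
    have h4 : (0:ℝ) ≤ 1 / ((M:ℝ) + 1) := by positivity
    linarith

lemma block_l1 (ν : ℕ → ℤ) (N c : ℕ) (hc : 0 < c) (hN : N ^ 2 ≤ 2 * c) (q : ℝ) (hq : 0 ≤ q) (hQ : QQ ν N ≤ q^2) (k0 : ℕ) (f : ℕ → ℝ)
    (F : ℝ) (hF0 : 0 ≤ F) (hF : ∑ k ∈ Ico k0 (k0 + 2 * c), f k ^ 2 ≤ F ^ 2 / (2 * c)) :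
    ∑ k ∈ Ico k0 (k0 + 2 * c), |S ν N k| * f k ≤ Real.pi / 2 * q * F := by
  have hc' : (0:ℝ) < c := by positivity
  have h := Finset.sum_mul_sq_le_sq_mul_sq (Ico k0 (k0 + 2 * c)) (fun k => |S ν N k|) f
  simp only [sq_abs] at h
  have h2 := mean_sq ν N c hc hN k0
  apply abs_le_of_sq_le_sq' _ (by positivity) |>.2
  calc _ ≤ _ := h
    _ ≤ (Real.pi ^ 2 / 4 * (2 * c) * q^2) * (F ^ 2 / (2 * c)) := by
        apply mul_le_mul _ hF (Finset.sum_nonneg (fun _ _ => by positivity)) (by positivity)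
        exact h2.trans (by gcongr)
    _ = _ := by field_simp; norm_num

lemma tail (ν : ℕ → ℤ) (N c K : ℕ) (hK : 1 ≤ K) (hc : 0 < c) (hN : N ^ 2 ≤ 2 * c) (q : ℝ) (hq : 0 ≤ q) (hQ : QQ ν N ≤ q^2)
    (F : ℝ) (hF0 : 0 ≤ F) (hF : 2 * c ≤ 3 * (K:ℝ)^3 * F^2) (M : ℕ) :
    ∑ k ∈ Ico K (K + (M + 1) * (2 * c)), |S ν N k| * mk k ≤ Real.pi / 2 * q * (F + 1 / c) := by
  have hc' : (0:ℝ) < c := by positivity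
  have hK' : (0:ℝ) < K := by positivity
  have main : ∑ k ∈ Ico K (K + (M + 1) * (2 * c)), |S ν N k| * mk k ≤
     Real.pi / 2 * q * (F + (1 / (2 * c)) * ∑ j ∈ range M, (1:ℝ) / ((j:ℝ) + 1)^2) := by
    induction M with
    | zero =>
      simp only [zero_add, one_mul, range_zero, sum_empty, mul_zero, add_zero]
      apply block_l1 ν N c hc hN q hq hQ K mk F hF0
      refine (mk_sq_sum K (2 * c) hK).trans ?_
      have : 0 ≤ 1 / (3 * ((K + 2 * c : ℕ):ℝ)^3) := by positivity
      have h2 : 1 / (3 * (K:ℝ)^3) ≤ F^2 / (2 * c) := by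
        rw [div_le_div_iff₀ (by positivity) (by positivity)]; linarith
      linarith
    | succ M ih =>
      rw [show K + (M + 1 + 1) * (2 * c) = (K + (M + 1) * (2 * c)) + 2 * c by ring,
        ← Finset.sum_Ico_consecutive _ (by omega : K ≤ K + (M + 1) * (2 * c)) (by omega), Finset.sum_range_succ]
      have := block_l1 ν N c hc hN q hq hQ (K + (M + 1) * (2 * c)) mk (1 / (2 * c) * (1 / ((M:ℝ) + 1)^2)) (by positivity) (by
        have hb : ∀ k ∈ Ico (K + (M + 1) * (2 * c)) (K + (M + 1) * (2 * c) + 2 * c), mk k ^ 2 ≤ (1 / ((((M:ℝ) + 1) * (2 * c))^2))^2 := by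
          intro k hk
          simp only [mem_Ico] at hk
          have h1 : ((M:ℝ) + 1) * (2 * c) ≤ k := by
            have : (M + 1) * (2 * c) ≤ k := by omega
            exact_mod_cast this
          have h2 : (0:ℝ) < ((M:ℝ) + 1) * (2 * c) := by positivity
          apply pow_le_pow_left₀ (mk_nonneg k)
          unfold mk
          apply one_div_le_one_div_of_le (by positivity)
          rw [sq]
          apply mul_le_mul h1 (by linarith) h2.le (by linarith)
        refine (Finset.sum_le_sum hb).trans (le_of_eq ?_)
        simp
        field_simp)
      nlinarith [this, ih]
  refine main.trans ?_
  have h3 := inv_sq_sum M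
  have h5 : (1 / (2 * (c:ℝ))) * ∑ j ∈ range M, (1:ℝ) / ((j:ℝ) + 1)^2 ≤ 1 / (c:ℝ) := by
    calc _ ≤ (1 / (2 * (c:ℝ))) * 2 := by gcongr
      _ = _ := by field_simp
  gcongr
end PC

namespace PC

lemma S_abs_le (ν : ℕ → ℤ) (N : ℕ) (hν : ∀ d, |(ν d : ℝ)| ≤ 1) (k : ℕ) : |S ν N k| ≤ N + 1 := by
  rw [S_mod]
  have h1 : |∑ d ∈ Icc 1 N, (ν d : ℝ) / d * ((k % d : ℕ) : ℝ)| ≤ ∑ d ∈ Icc 1 N, (1:ℝ) := by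
    refine (Finset.abs_sum_le_sum_abs _ _).trans (Finset.sum_le_sum ?_)
    intro d hd
    have hd1 : 1 ≤ d := (Finset.mem_Icc.1 hd).1
    have hd0 : (0:ℝ) < d := by exact_mod_cast hd1
    have hm : ((k % d : ℕ) : ℝ) ≤ d := by exact_mod_cast (Nat.mod_lt k hd1).le
    rw [abs_mul, abs_div, Nat.abs_cast, Nat.abs_cast, div_mul_eq_mul_div, div_le_one hd0]
    calc |(ν d : ℝ)| * ((k % d : ℕ) : ℝ) ≤ 1 * d := by
          apply mul_le_mul (hν d) hm (by positivity) (by norm_num)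
      _ = d := one_mul _
  have h2 : ∑ d ∈ Icc 1 N, (1:ℝ) = N := by simp
  rw [h2] at h1
  calc _ ≤ |(1:ℝ)| + _ := abs_add_le _ _
    _ ≤ N + 1 := by rw [abs_one]; linarith

lemma sum_half (s : Finset ℕ) (f a b : ℕ → ℝ) (ha : ∀ k ∈ s, 0 ≤ a k) (hb : ∀ k ∈ s, a k ≤ b k) :
    |∑ k ∈ s, f k * a k - 1/2 * ∑ k ∈ s, f k * b k| ≤ 1/2 * ∑ k ∈ s, |f k| * b k := by
  rw [Finset.mul_sum, Finset.mul_sum, ← Finset.sum_sub_distrib]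
  refine (Finset.abs_sum_le_sum_abs _ _).trans (Finset.sum_le_sum ?_)
  intro k hk
  have : f k * a k - 1/2 * (f k * b k) = f k * (a k - b k / 2) := by ring
  rw [this, abs_mul]
  have h2 : |a k - b k / 2| ≤ b k / 2 := by
    rw [abs_le]; constructor <;> linarith [ha k hk, hb k hk]
  calc _ ≤ |f k| * (b k / 2) := mul_le_mul_of_nonneg_left h2 (abs_nonneg _)
    _ = _ := by ring

lemma abel (σ g : ℕ → ℝ) (h0 : σ 0 = 0) (n : ℕ) :
    ∑ k ∈ Ico 1 (n+1), σ k * (g k - g (k+1)) =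
      ∑ k ∈ Ico 1 (n+1), (σ k - σ (k-1)) * g k - σ n * g (n+1) := by
  induction n with
  | zero => simp [h0]
  | succ n ih =>
    rw [Finset.sum_Ico_succ_top (a := 1) (b := n+1) (by omega), ih,
      Finset.sum_Ico_succ_top (a := 1) (b := n+1) (by omega), Nat.add_sub_cancel]
    ring

lemma step_x (ν : ℕ → ℤ) (N : ℕ) (hν : ∀ d, |(ν d : ℝ)| ≤ 1) (σ : ℕ → ℝ) (hσ0 : σ 0 = 0)
    (K' Y : ℕ) (hKY : K' + 1 ≤ Y) (ρ I2 T c1 c2 : ℝ) (hc10 : 0 ≤ c1) (hc20 : 0 ≤ c2)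
    (hρ : ∑ k ∈ Ico 1 (K'+1), |σ k - σ (k-1)| / k + |σ K'| / (K' + 1 : ℕ) ≤ ρ)
    (hI : ∑ k ∈ Ico 1 (K'+1), |S ν N k - σ k| * mk k ≤ I2)
    (hT : ∑ k ∈ Ico (K'+1) Y, |S ν N k| * mk k ≤ T)
    (X β h x : ℝ) (hh : 0 ≤ h) (hX : 1 ≤ X) (hψ : ∀ u, X ≤ u → |ψ u - β * u| ≤ h * u)
    (hx : (K'+1 : ℕ) * X ≤ x) (hNx : N ≤ x) (hYx : Y ≤ x)
    (hc1 : ∀ k ∈ Ico 1 (K'+1), ψ (x / k) - ψ (x / (k + 1 : ℕ)) ≤ c1 * mk k * x)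
    (hc2 : ∀ k ∈ Ico (K'+1) Y, ψ (x / k) - ψ (x / (k + 1 : ℕ)) ≤ c2 * mk k * x)
    (hY : ψ (x / Y) ≤ 3/2 * (x / Y)) :
    |ψ x - (alpha ν N + β * (∑ k ∈ Ico 1 (K'+1), (σ k - σ (k-1)) / k - σ K' / (K' + 1 : ℕ))
        + c1/2 * ∑ k ∈ Ico 1 (K'+1), (S ν N k - σ k) * mk k
        + c2/2 * ∑ k ∈ Ico (K'+1) Y, S ν N k * mk k) * x| ≤
      (ρ * h + c1/2 * I2 + c2/2*T + 3/2 * (N+1)/Y) * x + (N + |kap ν N|) * (Real.log x + 1) := by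
  have hK1 : (1:ℝ) ≤ (K'+1:ℕ) := by exact_mod_cast (by omega : 1 ≤ K' + 1)
  have hXx : X ≤ x := le_trans (by nlinarith) hx
  have hx1 : 1 ≤ x := hX.trans hXx
  have hx0 : 0 < x := by linarith
  have hY1 : 1 ≤ Y := by omega
  have hYf : Y ≤ ⌊x⌋₊ := Nat.le_floor hYx
  have hch := cheb ν N hν x hx1 hNx
  set a : ℕ → ℝ := fun k => ψ (x / k) - ψ (x / (k + 1 : ℕ)) with ha
  have ha0 : ∀ k, 1 ≤ k → 0 ≤ a k := by
    intro k hk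
    have hk0 : (0:ℝ) < k := by exact_mod_cast hk
    have : x / (k + 1 : ℕ) ≤ x / k := by
      apply div_le_div_of_nonneg_left hx0.le hk0; push_cast; linarith
    have := Chebyshev.psi_mono this
    simp only [ha]; linarith
  -- split
  have hsplit : ∑ k ∈ Icc 1 ⌊x⌋₊, S ν N k * a k =
      ∑ k ∈ Ico 1 (K'+1), σ k * a k + ∑ k ∈ Ico 1 (K'+1), (S ν N k - σ k) * a k
       + ∑ k ∈ Ico (K'+1) Y, S ν N k * a k + ∑ k ∈ Ico Y (⌊x⌋₊+1), S ν N k * a k := by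
    rw [← Finset.sum_add_distrib]
    have : Icc 1 ⌊x⌋₊ = Ico 1 (⌊x⌋₊+1) := by ext; simp
    rw [this, ← Finset.sum_Ico_consecutive _ (by omega : 1 ≤ Y) (by omega : Y ≤ ⌊x⌋₊+1),
      ← Finset.sum_Ico_consecutive _ (by omega : 1 ≤ K'+1) hKY]
    congr 2
    apply Finset.sum_congr rfl; intros; ring
  -- part 4
  have h4 : |∑ k ∈ Ico Y (⌊x⌋₊+1), S ν N k * a k| ≤ 3/2 * (N+1)/Y * x := by
    have hsum : ∑ k ∈ Ico Y (⌊x⌋₊+1), a k ≤ ψ (x / Y) := by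
      have : ∑ k ∈ Ico Y (⌊x⌋₊+1), a k = ψ (x/Y) - ψ (x / (⌊x⌋₊+1 : ℕ)) := by
        have := Finset.sum_Ico_sub (fun k : ℕ => - ψ (x / k)) (by omega : Y ≤ ⌊x⌋₊+1)
        rw [← (by ring : - ψ (x / (⌊x⌋₊+1 : ℕ)) - - ψ (x/Y) = ψ (x/Y) - ψ (x / (⌊x⌋₊+1 : ℕ))), ← this]
        apply Finset.sum_congr rfl; intros; simp only [ha]; ring
      rw [this]; linarith [Chebyshev.psi_nonneg (x / (⌊x⌋₊+1 : ℕ))]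
    calc _ ≤ ∑ k ∈ Ico Y (⌊x⌋₊+1), (N+1:ℝ) * a k := by
          refine (Finset.abs_sum_le_sum_abs _ _).trans (Finset.sum_le_sum ?_)
          intro k hk
          have := ha0 k (by have := (Finset.mem_Ico.1 hk).1; omega)
          rw [abs_mul, abs_of_nonneg this]
          exact mul_le_mul_of_nonneg_right (S_abs_le ν N hν k) this
      _ = (N+1) * ∑ k ∈ Ico Y (⌊x⌋₊+1), a k := by rw [Finset.mul_sum]
      _ ≤ (N+1) * (3/2 * (x / Y)) := by
          apply mul_le_mul_of_nonneg_left (hsum.trans hY) (by positivity)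
      _ = _ := by ring
  have h3 := sum_half (Ico (K'+1) Y) (S ν N) a (fun k => c2 * mk k * x)
    (fun k hk => ha0 k (by have := (Finset.mem_Ico.1 hk).1; omega)) hc2
  have h2 := sum_half (Ico 1 (K'+1)) (fun k => S ν N k - σ k) a (fun k => c1 * mk k * x)
    (fun k hk => ha0 k (Finset.mem_Ico.1 hk).1) hc1
  have e (s : Finset ℕ) (f : ℕ → ℝ) (c : ℝ) : ∑ k ∈ s, f k * (c * mk k * x) = c * x * ∑ k ∈ s, f k * mk k := by
    rw [Finset.mul_sum]; apply Finset.sum_congr rfl; intros; ring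
  rw [e, e] at h3
  rw [e (f := fun k => S ν N k - σ k), e (f := fun k => |S ν N k - σ k|)] at h2
  have h3' := mul_le_mul_of_nonneg_left hT (mul_nonneg hc20 hx0.le)
  have h2' := mul_le_mul_of_nonneg_left hI (mul_nonneg hc10 hx0.le)
  have h1 : |∑ k ∈ Ico 1 (K'+1), σ k * a k - β * (∑ k ∈ Ico 1 (K'+1), (σ k - σ (k-1)) / k - σ K' / (K' + 1 : ℕ)) * x|
      ≤ ρ * h * x := by
    have hab := abel σ (fun k => ψ (x / k)) hσ0 K'
    have : ∑ k ∈ Ico 1 (K'+1), σ k * a k = ∑ k ∈ Ico 1 (K'+1), σ k * (ψ (x / k) - ψ (x / (k + 1 : ℕ))) := rfl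
    rw [this, hab]
    have hg : ∀ k : ℕ, 1 ≤ k → k ≤ K'+1 → |ψ (x / k) - β * (x / k)| ≤ h * (x / k) := by
      intro k hk hk'
      apply hψ
      have hk0 : (0:ℝ) < k := by exact_mod_cast hk
      rw [le_div_iff₀ hk0]
      have : (k:ℝ) ≤ (K'+1:ℕ) := by exact_mod_cast hk'
      nlinarith
    have e2 : ∑ k ∈ Ico 1 (K'+1), (σ k - σ (k-1)) * ψ (x / k) - σ K' * ψ (x / (K'+1:ℕ))
       - β * (∑ k ∈ Ico 1 (K'+1), (σ k - σ (k-1)) / k - σ K' / (K' + 1 : ℕ)) * x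
       = ∑ k ∈ Ico 1 (K'+1), (σ k - σ (k-1)) * (ψ (x / k) - β * (x / k)) - σ K' * (ψ (x / (K'+1:ℕ)) - β * (x / (K'+1:ℕ))) := by
      have : ∑ k ∈ Ico 1 (K'+1), (σ k - σ (k-1)) * (ψ (x / k) - β * (x / k)) =
         ∑ k ∈ Ico 1 (K'+1), (σ k - σ (k-1)) * ψ (x / k) - β * x * ∑ k ∈ Ico 1 (K'+1), (σ k - σ (k-1)) / k := by
        rw [Finset.mul_sum, ← Finset.sum_sub_distrib]; apply Finset.sum_congr rfl; intros; ring
      rw [this]; ring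
    rw [e2]
    calc _ ≤ |∑ k ∈ Ico 1 (K'+1), (σ k - σ (k-1)) * (ψ (x / k) - β * (x / k))| + |σ K' * (ψ (x / (K'+1:ℕ)) - β * (x / (K'+1:ℕ)))| := abs_sub _ _
      _ ≤ ∑ k ∈ Ico 1 (K'+1), |σ k - σ (k-1)| * (h * (x / k)) + |σ K'| * (h * (x / (K'+1:ℕ))) := by
        apply add_le_add
        · refine (Finset.abs_sum_le_sum_abs _ _).trans (Finset.sum_le_sum ?_)
          intro k hk
          rw [Finset.mem_Ico] at hk
          rw [abs_mul]
          exact mul_le_mul_of_nonneg_left (hg k hk.1 (by omega)) (abs_nonneg _)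
        · rw [abs_mul]
          exact mul_le_mul_of_nonneg_left (hg _ (by omega) le_rfl) (abs_nonneg _)
      _ = (∑ k ∈ Ico 1 (K'+1), |σ k - σ (k-1)| / k + |σ K'| / (K' + 1 : ℕ)) * (h * x) := by
        rw [add_mul, Finset.sum_mul]
        congr 1
        · apply Finset.sum_congr rfl; intros; ring
        · ring
      _ ≤ ρ * (h * x) := mul_le_mul_of_nonneg_right hρ (by positivity)
      _ = _ := by ring
  rw [hsplit] at hch
  rw [abs_le] at hch h1 h2 h3 h4 ⊢
  constructor
  · linarith [hch.1, h1.1, h2.1, h3.1, h4.1]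
  · linarith [hch.2, h1.2, h2.2, h3.2, h4.2]

end PC

namespace PC

lemma log_sq_le (x : ℝ) (hx : (2:ℝ)^143 ≤ x) : Real.log x ^ 2 ≤ 9841 * (x / 2^143) := by
  set t := x / 2^143 with ht
  have ht1 : 1 ≤ t := by rw [ht, le_div_iff₀ (by positivity)]; linarith
  have hxt : x = 2^143 * t := by rw [ht]; field_simp
  have h2 := Real.log_two_lt_d9
  have hs : 1 ≤ √t := by rw [Real.one_le_sqrt]; exact ht1
  have hss : √t ^ 2 = t := Real.sq_sqrt (by linarith)
  have hlt : Real.log t ≤ 2 * (√t - 1) := by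
    rw [← hss, Real.log_pow]
    have := Real.log_le_sub_one_of_pos (by linarith : 0 < √t)
    push_cast; rw [hss]; linarith
  have hl : Real.log x = 143 * Real.log 2 + Real.log t := by
    rw [hxt, Real.log_mul (by positivity) (by positivity), Real.log_pow]; norm_num
  have h0 : 0 ≤ Real.log x := by
    rw [hl]; have := Real.log_nonneg ht1; have := Real.log_two_gt_d9; linarith
  have h3 : Real.log x ≤ 99.2 * √t := by rw [hl]; nlinarith
  calc Real.log x ^ 2 ≤ (99.2 * √t)^2 := by gcongr
    _ = 99.2^2 * t := by rw [mul_pow, hss]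
    _ ≤ _ := by nlinarith

set_option maxHeartbeats 1000000 in
lemma BTnum (b l0 g c : ℝ) (k : ℕ) (x : ℝ) (hk : 1 ≤ k) (hk2 : (k+1)^2 ≤ 2^67) (hkb : Real.log ((k+1:ℕ):ℝ) ≤ b)
    (hx : (2:ℝ)^143 ≤ x) (hl0 : 50 ≤ l0) (hl : l0 ≤ Real.log x) (hg : Real.log l0 ≤ g)
    (hc2 : 2 ≤ c) (hc4 : c ≤ 4) (hsl : 2 * c / l0 ≤ c - 2) (hbase : c * (b + 2 * g + 0.01) ≤ (c - 2) * (l0 - b)) :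
    ψ (x / k) - ψ (x / (k+1:ℕ)) ≤ (c + 1 / l0 + 0.001) * mk k * x := by
  have hx0 : 0 < x := lt_of_lt_of_le (by positivity) hx
  set l := Real.log x with hldef
  have hlpos : 0 < l := by linarith
  have hk0 : (0:ℝ) < k := by exact_mod_cast hk
  set m := mk k with hm
  have hm0 : 0 < m := mk_pos hk
  have hlsq : l^2 ≤ 9841 * (x / 2^143) := log_sq_le x hx
  have hkR : ((k:ℝ)+1)^2 ≤ 2^67 := by exact_mod_cast hk2
  have hmlow : (1:ℝ)/2^67 ≤ m := by
    rw [hm]; unfold mk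
    apply one_div_le_one_div_of_le (by positivity)
    nlinarith
  have hmx : x / 2^67 ≤ m * x := by
    calc x / 2^67 = 1/2^67 * x := by ring
      _ ≤ m * x := by gcongr
  -- s
  set s := √(m * x) / l with hs
  have hmx0 : 0 < m * x := by positivity
  have hs0 : 0 < s := by positivity
  have hssq : s^2 = m * x / l^2 := by rw [hs, div_pow, Real.sq_sqrt hmx0.le]
  have hs1000 : 1000 ≤ s := by
    have : (1000:ℝ)^2 ≤ s^2 := by
      rw [hssq, le_div_iff₀ (by positivity)]
      nlinarith
    exact le_of_sq_le_sq this hs0.le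
  set R := ⌊s⌋₊ with hR
  have hRs : (R:ℝ) ≤ s := Nat.floor_le hs0.le
  have hRs' : s - 1 < R := by have := Nat.lt_floor_add_one s; rw [← hR] at this; linarith
  have hR2 : 2 ≤ R := by
    have : (2:ℝ) ≤ R := by linarith
    exact_mod_cast this
  have hR0 : (0:ℝ) < R := by exact_mod_cast (by omega : 0 < R)
  -- log of R
  have hlogR : Real.log s - 0.005 ≤ Real.log R := by
    have h1 : Real.log (s * (1 - 1/s)) ≤ Real.log R := by
      apply Real.log_le_log
      · rw [mul_sub, mul_one_div_cancel hs0.ne']; linarith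
      · rw [mul_sub, mul_one_div_cancel hs0.ne']; linarith
    have h1s : 1 / s ≤ 0.001 := by
      rw [div_le_iff₀ hs0]; linarith
    have hpos : 0 < 1 - 1/s := by linarith
    rw [Real.log_mul hs0.ne' hpos.ne'] at h1
    have h2 := Real.one_sub_inv_le_log_of_pos hpos
    have h3 : (1 - 1/s)⁻¹ ≤ 1.005 := by
      rw [inv_le_comm₀ hpos (by norm_num)]
      norm_num; norm_num at h1s; linarith
    linarith
  have hlogs : Real.log s = (Real.log m + l) / 2 - Real.log l := by
    rw [hs, Real.log_div (by positivity) hlpos.ne', Real.log_sqrt hmx0.le, Real.log_mul hm0.ne' hx0.ne']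
  set B := Real.log ((k+1:ℕ):ℝ) with hB
  have hlogm : Real.log m = - Real.log k - B := by
    rw [hm]; unfold mk
    rw [one_div, Real.log_inv, Real.log_mul hk0.ne' (by positivity), hB]; push_cast; ring
  have hkB : Real.log k ≤ B := by
    apply Real.log_le_log hk0; push_cast; linarith
  have hlogk0 : 0 ≤ Real.log k := Real.log_nonneg (by exact_mod_cast hk)
  have hlogv : Real.log (x / k) = l - Real.log k := Real.log_div hx0.ne' hk0.ne'
  have hlogl : Real.log l ≤ g + (l - l0) / l0 := by
    have h1 : l = l0 * (l / l0) := by field_simp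
    rw [h1, Real.log_mul (by positivity) (by positivity)]
    have := Real.log_le_sub_one_of_pos (by positivity : 0 < l / l0)
    have h2 : l0 * (l / l0) = l := by field_simp
    rw [h2]
    have h3 : (l - l0) / l0 = l / l0 - 1 := by field_simp
    linarith
  have hkey : c * (B + 2 * Real.log l + 0.01) ≤ (c - 2) * (l - B) := by
    have h1 : c * (2 * ((l - l0) / l0)) ≤ (c - 2) * (l - l0) := by
      have : c * (2 * ((l - l0) / l0)) = 2 * c / l0 * (l - l0) := by ring
      rw [this]; apply mul_le_mul_of_nonneg_right hsl; linarith
    have h2 : c * Real.log l ≤ c * (g + (l - l0) / l0) := by gcongr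
    have h3 : c * B ≤ c * b := by gcongr
    have h4 : (c - 2) * B ≤ (c - 2) * b := by apply mul_le_mul_of_nonneg_left hkb; linarith
    linarith
  have hratio : Real.log (x / k) ≤ c * Real.log R := by
    have h1 : c * ((Real.log m + l) / 2 - Real.log l - 0.005) ≤ c * Real.log R := by
      apply mul_le_mul_of_nonneg_left _ (by linarith); rw [← hlogs]; exact hlogR
    rw [hlogm] at h1
    rw [hlogv]
    have h5 : 0 ≤ (c - 2) * (B - Real.log k) := mul_nonneg (by linarith) (by linarith)
    linarith
  have hmx1 : 1 ≤ m * x := by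
    refine le_trans ?_ hmx
    rw [le_div_iff₀ (by positivity)]; refine le_trans ?_ hx; norm_num
  have hRu : (R:ℝ) ≤ x / (k+1:ℕ) := by
    calc (R:ℝ) ≤ s := hRs
      _ ≤ √(m * x) := by rw [hs]; apply div_le_self (Real.sqrt_nonneg _); linarith
      _ ≤ m * x := by rw [Real.sqrt_le_left (by linarith)]; nlinarith
      _ ≤ x / (k+1:ℕ) := by
        rw [hm]; unfold mk; push_cast
        rw [one_div_mul_eq_div]
        apply div_le_div_of_nonneg_left hx0.le (by positivity)
        have : (1:ℝ) ≤ k := by exact_mod_cast hk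
        nlinarith
  have huv : x / (k+1:ℕ) ≤ x / k := by
    apply div_le_div_of_nonneg_left hx0.le hk0; push_cast; linarith
  have hbt := BT R _ _ hR2 hRu huv
  have hdiff : x / k - x / (k+1:ℕ) = m * x := by rw [hm, mk_eq hk]; ring
  rw [hdiff] at hbt
  have hRlog : 0 < Real.log R := Real.log_pos (by exact_mod_cast (by omega : 1 < R))
  have hlv : Real.log (x/k) ≤ l := by rw [hlogv]; linarith
  have hlv0 : 0 ≤ Real.log (x/k) := by
    apply Real.log_nonneg
    have : (R:ℝ) ≤ x / k := hRu.trans huv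
    linarith
  have t1 : Real.log (x/k) * ((m*x+1) / Real.log R) ≤ c * (m*x+1) := by
    rw [← mul_div_assoc, div_le_iff₀ hRlog]
    have := mul_le_mul_of_nonneg_right hratio (by positivity : 0 ≤ m*x+1)
    linarith
  have t2 : Real.log (x/k) * (R:ℝ)^2 ≤ 1/l0 * (m * x) := by
    calc Real.log (x/k) * (R:ℝ)^2 ≤ l * s^2 := by gcongr
      _ = 1/l * (m*x) := by rw [hssq]; field_simp
      _ ≤ _ := by gcongr
  have t3 : 2 * √(x/k) * Real.log (x/k) ≤ 0.0009 * (m * x) := by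
    have h1 : 2 * √(x/k) * Real.log (x/k) ≤ 2 * √(x/k) * l := by gcongr
    refine h1.trans ?_
    apply abs_le_of_sq_le_sq' _ (by positivity) |>.2
    have e1 : (2 * √(x/k) * l)^2 = 4 * (x/k) * l^2 := by
      rw [mul_pow, mul_pow, Real.sq_sqrt (by positivity)]; norm_num
    rw [e1]
    have hmk : m * (k * (k+1)) = 1 := by rw [hm]; unfold mk; field_simp
    -- (m x)^2 * 0.00000081 >= 4 x l^2 / k
    have hcub : (k:ℝ) * (k+1)^2 ≤ 2^101 := by
      have hk3 : k + 1 ≤ 2^34 := by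
        by_contra hcon
        have : (2^34)^2 ≤ (k+1)^2 := Nat.pow_le_pow_left (by omega) 2
        have h5 : (2^34)^2 ≤ 2^67 := this.trans hk2
        norm_num at h5
      have : (k:ℝ) ≤ 2^34 := by exact_mod_cast (by omega : k ≤ 2^34)
      calc (k:ℝ) * (k+1)^2 ≤ 2^34 * 2^67 := by gcongr
        _ = 2^101 := by norm_num
    have e2 : m^2 = (1/k) * (1/(k * (k+1)^2)) := by rw [hm]; unfold mk; field_simp
    have e3 : (0.0009 * (m*x))^2 = (x/k) * (0.0009^2 * x * (1/(k * (k+1)^2))) := by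
      rw [mul_pow, mul_pow, e2]; ring
    rw [e3]
    have h6 : (1:ℝ)/2^101 ≤ 1/(k * (k+1)^2) := one_div_le_one_div_of_le (by positivity) hcub
    have h7 : 4 * l^2 ≤ 0.0009^2 * x * (1/(k * (k+1)^2)) := by
      calc 4 * l^2 ≤ 4 * (9841 * (x / 2^143)) := by gcongr
        _ ≤ 0.0009^2 * x * (1/2^101) := by
          have : (0.0009^2 * x * (1/2^101) : ℝ) - 4 * (9841 * (x / 2^143)) = x * (0.0009^2 * (1/2^101) - 4 * 9841 / 2^143) := by ring
          have h8 : (0:ℝ) ≤ 0.0009^2 * (1/2^101) - 4 * 9841 / 2^143 := by norm_num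
          nlinarith [mul_nonneg hx0.le h8]
        _ ≤ _ := by gcongr
    have := mul_le_mul_of_nonneg_left h7 (by positivity : 0 ≤ x / k)
    linarith
  have t4 : c ≤ 0.0001 * (m*x) := by
    have : (2:ℝ)^76 ≤ m*x := by
      refine le_trans ?_ hmx
      rw [le_div_iff₀ (by positivity)]; refine le_trans ?_ hx; norm_num
    norm_num at this ⊢; linarith
  rw [mul_add] at hbt
  linarith

end PC

namespace PC

lemma psi_le15 (u : ℝ) (hu : (2:ℝ)^100 ≤ u) : ψ u ≤ 3/2 * u := by
  have hu0 : 0 < u := lt_of_lt_of_le (by positivity) hu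
  have hu1 : 1 ≤ u := le_trans (by norm_num) hu
  have h1 := Chebyshev.psi_sub_theta_le hu1
  have h2 := Chebyshev.theta_le_log4_mul_x hu0.le
  have h4 : Real.log 4 ≤ 1.3863 := by
    have : Real.log 4 = 2 * Real.log 2 := by
      rw [show (4:ℝ) = 2^2 by norm_num, Real.log_pow]; norm_num
    rw [this]; have := Real.log_two_lt_d9; linarith
  set y := √(√u) with hy
  have hy0 : 0 < y := by positivity
  have hy2 : y^2 = √u := Real.sq_sqrt (Real.sqrt_nonneg _)
  have hu2 : √u^2 = u := Real.sq_sqrt hu0.le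
  have hy4 : y^4 = u := by rw [← hu2, ← hy2]; ring
  have hlog : Real.log u ≤ 4 * y := by
    rw [← hy4, Real.log_pow]
    have := Real.log_le_sub_one_of_pos hy0
    push_cast; linarith
  have hy80 : 80 ≤ y := by
    by_contra hcon
    push Not at hcon
    have : y^4 < 80^4 := pow_lt_pow_left₀ hcon hy0.le (by norm_num)
    rw [hy4] at this
    have : (2:ℝ)^100 < 80^4 := lt_of_le_of_lt hu this
    norm_num at this
  have h5 : 2 * √u * Real.log u ≤ 0.1 * u := by
    calc 2 * √u * Real.log u ≤ 2 * √u * (4 * y) := by gcongr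
      _ = 8 * y^3 := by rw [← hy2]; ring
      _ ≤ 0.1 * y^4 := by nlinarith [pow_pos hy0 3]
      _ = 0.1 * u := by rw [hy4]
  nlinarith

lemma step (ν : ℕ → ℤ) (N : ℕ) (hN : N ≤ 5306) (hν : ∀ d, |(ν d : ℝ)| ≤ 1) (hkap : |kap ν N| ≤ 1)
    (σ : ℕ → ℝ) (hσ0 : σ 0 = 0) (ρ I2 T : ℝ)
    (hρ : ∑ k ∈ Ico 1 (1048575+1), |σ k - σ (k-1)| / k + |σ 1048575| / (1048575 + 1 : ℕ) ≤ ρ)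
    (hI : ∑ k ∈ Ico 1 (1048575+1), |S ν N k - σ k| * mk k ≤ I2)
    (hT : ∑ k ∈ Ico (1048575+1) 12135265692, |S ν N k| * mk k ≤ T)
    (n : ℕ) (hn : 143 ≤ n) (h h' : ℝ) (hh : 0 ≤ h)
    (hψ : ∃ β : ℝ, ∀ u, (2:ℝ)^(n-20) ≤ u → |ψ u - β * u| ≤ h * u)
    (p : ℕ) (l0 c1 c2 : ℝ) (hl50 : 50 ≤ l0) (hl : l0 ≤ n * 0.6931471803) (hp : l0^16 ≤ 2^p)
    (hc1 : 2 ≤ c1 ∧ c1 ≤ 4 ∧ 2 * c1 / l0 ≤ c1 - 2 ∧ c1 * (13.863 + 2 * (p/16*0.6931471808) + 0.01) ≤ (c1 - 2) * (l0 - 13.863))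
    (hc2 : 2 ≤ c2 ∧ c2 ≤ 4 ∧ 2 * c2 / l0 ≤ c2 - 2 ∧ c2 * (23.2205 + 2 * (p/16*0.6931471808) + 0.01) ≤ (c2 - 2) * (l0 - 23.2205))
    (hh' : ρ * h + (c1 + 1/l0+0.001)/2*I2 + (c2 + 1/l0+0.001)/2*T + 0.000000657 ≤ h') :
    ∃ β : ℝ, ∀ u, (2:ℝ)^n ≤ u → |ψ u - β * u| ≤ h' * u := by
  obtain ⟨β, hβ⟩ := hψ
  refine ⟨_, fun x hx => le_trans (step_x ν N hν σ hσ0 1048575 12135265692 (by norm_num) ρ I2 T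
    (c1 + 1/l0+0.001) (c2 + 1/l0+0.001) ?_ ?_ hρ hI hT (2^(n-20)) β h x hh ?_ hβ ?_ ?_ ?_ ?_ ?_ ?_) ?_⟩
  all_goals have hl2 := Real.log_two_gt_d9
  all_goals have hl2' := Real.log_two_lt_d9
  all_goals have hx143 : (2:ℝ)^143 ≤ x := le_trans (pow_le_pow_right₀ (by norm_num) hn) hx
  all_goals have hx0 : 0 < x := lt_of_lt_of_le (by positivity) hx143
  · have := hc1.1; positivity
  · have := hc2.1; positivity
  · exact one_le_pow₀ (by norm_num)
  · refine le_trans (le_of_eq ?_) hx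
    have : (2:ℝ)^n = 2^(n-20) * 2^20 := by rw [← pow_add]; congr 1; omega
    rw [this]; norm_num; ring
  · refine le_trans ?_ hx143
    have : (N:ℝ) ≤ 5306 := by exact_mod_cast hN
    refine this.trans ?_
    norm_num
  · refine le_trans ?_ hx143
    norm_num
  all_goals have hlx : l0 ≤ Real.log x := by
              refine hl.trans (le_trans ?_ (Real.log_le_log (by positivity) hx))
              rw [Real.log_pow]; gcongr
  all_goals have hlg : Real.log l0 ≤ p/16*0.6931471808 := by
              have h1 := Real.log_le_log (by positivity) hp
              rw [Real.log_pow, Real.log_pow] at h1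
              have : (p:ℝ) * Real.log 2 ≤ p * 0.6931471808 := by gcongr
              push_cast at h1
              linarith
  · intro k hk
    rw [Finset.mem_Ico] at hk
    refine BTnum 13.863 l0 _ c1 k x hk.1 ?_ ?_ hx143 hl50 hlx hlg hc1.1 hc1.2.1 hc1.2.2.1 hc1.2.2.2
    · calc (k+1)^2 ≤ (2^20)^2 := Nat.pow_le_pow_left (by omega) 2
        _ ≤ 2^67 := by norm_num
    · have h1 : ((k+1:ℕ):ℝ) ≤ 2^20 := by exact_mod_cast (by omega : k + 1 ≤ 2^20)
      have h2 := Real.log_le_log (by positivity) h1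
      rw [Real.log_pow] at h2
      norm_num at h2 ⊢; linarith
  · intro k hk
    rw [Finset.mem_Ico] at hk
    have hk2 : (k+1)^2 ≤ 2^67 := by
      calc (k+1)^2 ≤ (12135265692)^2 := Nat.pow_le_pow_left (by omega) 2
        _ ≤ 2^67 := by norm_num
    refine BTnum 23.2205 l0 _ c2 k x (by omega) hk2 ?_ hx143 hl50 hlx hlg hc2.1 hc2.2.1 hc2.2.2.1 hc2.2.2.2
    have h1 : ((k+1:ℕ):ℝ)^2 ≤ 2^67 := by exact_mod_cast hk2
    have h2 := Real.log_le_log (by positivity) h1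
    rw [Real.log_pow, Real.log_pow] at h2
    norm_num at h2 ⊢; linarith
  · apply psi_le15
    rw [le_div_iff₀ (by norm_num)]
    refine le_trans ?_ hx143
    norm_num
  · have hls := log_sq_le x hx143
    have hN' : (N:ℝ) ≤ 5306 := by exact_mod_cast hN
    have hlog2 : 2 ≤ Real.log x := by linarith
    have e1 : (N + |kap ν N|) * (Real.log x + 1) ≤ 5307 * (9841 * (x / 2^143)) := by
      apply mul_le_mul (by linarith) _ (by linarith) (by norm_num)
      nlinarith
    have e2 : (5307:ℝ) * (9841 * (x / 2^143)) ≤ 0.0000000001 * x := by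
      have : (5307:ℝ) * (9841 * (x / 2^143)) = (5307 * 9841 / 2^143) * x := by ring
      rw [this]; apply mul_le_mul_of_nonneg_right _ hx0.le; norm_num
    have e3 : 3/2 * ((N:ℝ)+1)/(12135265692:ℕ) ≤ 0.00000065605 := by
      rw [div_le_iff₀ (by norm_num)]; push_cast; norm_num; linarith
    have e4 := mul_le_mul_of_nonneg_right hh' hx0.le
    have e5 := mul_le_mul_of_nonneg_right e3 hx0.le
    norm_num at e2 e4 e5 e1 ⊢
    linarith

lemma iter (ν : ℕ → ℤ) (N : ℕ) (hN : N ≤ 5306) (hν : ∀ d, |(ν d : ℝ)| ≤ 1) (hkap : |kap ν N| ≤ 1)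
    (σ : ℕ → ℝ) (hσ0 : σ 0 = 0)
    (hρ : ∑ k ∈ Ico 1 (1048575+1), |σ k - σ (k-1)| / k + |σ 1048575| / (1048575 + 1 : ℕ) ≤ 0.3113)
    (hI : ∑ k ∈ Ico 1 (1048575+1), |S ν N k - σ k| * mk k ≤ 0.00012185)
    (hT : ∑ k ∈ Ico (1048575+1) 12135265692, |S ν N k| * mk k ≤ 0.0000586) :
    ∃ β : ℝ, ∀ u, (2:ℝ)^303 ≤ u → |ψ u - β * u| ≤ 0.000331 * u := by
  have h0 : ∃ β : ℝ, ∀ u, (2:ℝ)^(143-20) ≤ u → |ψ u - β * u| ≤ 0.75 * u := by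
    refine ⟨0.75, fun u hu => ?_⟩
    have h1 := psi_le15 u (le_trans (by norm_num) hu)
    have h2 := Chebyshev.psi_nonneg u
    rw [abs_le]; norm_num at *; constructor <;> linarith
  have st := step ν N hN hν hkap σ hσ0 _ _ _ hρ hI hT
  have h1 := st 143 (by norm_num) 0.75 0.23374700 (by norm_num) h0 107 99.1200 2.746 3.498 (by norm_num) (by norm_num) (by norm_num) (by norm_num) (by norm_num) (by norm_num)
  have h2 := st 163 (by norm_num) 0.23374700 0.07301900 (by norm_num) h1 110 112.9829 2.619 3.150 (by norm_num) (by norm_num) (by norm_num) (by norm_num) (by norm_num) (by norm_num)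
  have h3 := st 183 (by norm_num) 0.07301900 0.02297240 (by norm_num) h2 112 126.8459 2.528 2.932 (by norm_num) (by norm_num) (by norm_num) (by norm_num) (by norm_num) (by norm_num)
  have h4 := st 203 (by norm_num) 0.02297240 0.00738460 (by norm_num) h3 115 140.7088 2.463 2.788 (by norm_num) (by norm_num) (by norm_num) (by norm_num) (by norm_num) (by norm_num)
  have h5 := st 223 (by norm_num) 0.00738460 0.00252580 (by norm_num) h4 117 154.5718 2.412 2.682 (by norm_num) (by norm_num) (by norm_num) (by norm_num) (by norm_num) (by norm_num)
  have h6 := st 243 (by norm_num) 0.00252580 0.00100840 (by norm_num) h5 119 168.4347 2.371 2.601 (by norm_num) (by norm_num) (by norm_num) (by norm_num) (by norm_num) (by norm_num)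
  have h7 := st 263 (by norm_num) 0.00100840 0.00053220 (by norm_num) h6 121 182.2977 2.339 2.538 (by norm_num) (by norm_num) (by norm_num) (by norm_num) (by norm_num) (by norm_num)
  have h8 := st 283 (by norm_num) 0.00053220 0.00038060 (by norm_num) h7 122 196.1606 2.310 2.486 (by norm_num) (by norm_num) (by norm_num) (by norm_num) (by norm_num) (by norm_num)
  have h9 := st 303 (by norm_num) 0.00038060 0.000331 (by norm_num) h8 124 210.0235 2.288 2.445 (by norm_num) (by norm_num) (by norm_num) (by norm_num) (by norm_num) (by norm_num)
  exact h9

end PC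

namespace PC

lemma fact_psi (n : ℕ) : Real.log (n ! : ℝ) = ∑ k ∈ Icc 1 n, ψ ((n:ℝ) / k) := by
  rw [log_fact]
  have h1 : ∀ k ∈ Icc 1 n, ψ ((n:ℝ) / k) = ∑ m ∈ Ioc 0 n, if m * k ≤ n then Λ m else 0 := by
    intro k hk
    have hk1 := (Finset.mem_Icc.1 hk).1
    rw [psi_div, Nat.floor_natCast, psi_nat, ← Finset.sum_filter]
    apply Finset.sum_congr _ (fun _ _ => rfl)
    ext m
    simp only [Finset.mem_Ioc, Finset.mem_filter]
    rw [Nat.le_div_iff_mul_le hk1]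
    constructor
    · rintro ⟨h, h'⟩
      refine ⟨⟨h, le_trans (Nat.le_mul_of_pos_right m hk1) h'⟩, h'⟩
    · rintro ⟨⟨h, _⟩, h'⟩; exact ⟨h, h'⟩
  rw [Finset.sum_congr rfl h1, Finset.sum_comm]
  apply Finset.sum_congr rfl
  intro m hm
  have hm1 := (Finset.mem_Ioc.1 hm).1
  rw [← Finset.sum_filter, Finset.sum_const, nsmul_eq_mul, mul_comm]
  congr 2
  have : Finset.filter (fun k => m * k ≤ n) (Icc 1 n) = Icc 1 (n / m) := by
    ext k
    simp only [Finset.mem_Icc, Finset.mem_filter]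
    rw [Nat.le_div_iff_mul_le hm1, mul_comm k m]
    constructor
    · rintro ⟨⟨h, _⟩, h'⟩; exact ⟨h, h'⟩
    · rintro ⟨h, h'⟩
      refine ⟨⟨h, le_trans (Nat.le_mul_of_pos_left k hm1) h'⟩, h'⟩
  rw [this]; simp

lemma hi_ge_one (X hi : ℝ) (hX : 1 ≤ X) (h : ∀ u, X ≤ u → ψ u ≤ hi * u) : 1 ≤ hi := by
  have hhi : 0 ≤ hi := by
    have h1 := h X le_rfl
    have h2 := Chebyshev.psi_nonneg X
    by_contra hc; push Not at hc; nlinarith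
  by_contra hc
  push Not at hc
  have key : ∀ n : ℕ, 1 ≤ n → Real.log n - 1 ≤ hi * (1 + Real.log n) + ψ X := by
    intro n hn
    have hn0 : (0:ℝ) < n := by exact_mod_cast hn
    have h1 := (stir_nat n hn).1
    have h2 : Real.log (n ! : ℝ) ≤ n * (hi * (1 + Real.log n) + ψ X) := by
      rw [fact_psi]
      calc ∑ k ∈ Icc 1 n, ψ ((n:ℝ) / k) ≤ ∑ k ∈ Icc 1 n, (hi * n * ((k:ℝ))⁻¹ + ψ X) := by
            apply Finset.sum_le_sum
            intro k hk
            have hk1 := (Finset.mem_Icc.1 hk).1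
            have hk0 : (0:ℝ) < k := by exact_mod_cast hk1
            rcases le_total X ((n:ℝ)/k) with hh | hh
            · have := h _ hh
              have h3 := Chebyshev.psi_nonneg X
              have e : hi * ((n:ℝ)/k) = hi * n * ((k:ℝ))⁻¹ := by ring
              linarith
            · have := Chebyshev.psi_mono hh
              have : 0 ≤ hi * n * ((k:ℝ))⁻¹ := by positivity
              linarith
        _ = hi * n * (harmonic n : ℝ) + n * ψ X := by
            rw [Finset.sum_add_distrib, ← Finset.mul_sum, Finset.sum_const, harmonic_eq_sum_Icc]
            simp
        _ ≤ hi * n * (1 + Real.log n) + n * ψ X := by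
            have := harmonic_le_one_add_log n
            gcongr
        _ = _ := by ring
    have h3 : (n:ℝ) * (Real.log n - 1) ≤ n * (hi * (1 + Real.log n) + ψ X) := by linarith
    exact le_of_mul_le_mul_left h3 hn0
  have hd : 0 < 1 - hi := by linarith
  obtain ⟨n, hn⟩ := exists_nat_gt (Real.exp ((3 + ψ X) / (1 - hi)))
  have hn0 : (0:ℝ) < n := (Real.exp_pos _).trans hn
  have hn1 : 1 ≤ n := by exact_mod_cast hn0
  have hl : (3 + ψ X) / (1 - hi) < Real.log n := by
    rw [Real.lt_log_iff_exp_lt hn0]; exact hn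
  rw [div_lt_iff₀ hd] at hl
  have := key n hn1
  nlinarith

lemma int_log_sq (X x : ℝ) (hX : 64 ≤ Real.log X) (hX1 : 1 < X) (hx : X ≤ x) :
    ∫ t in X..x, 1 / Real.log t ^ 2 ≤ x / Real.log x ^ 2 * (1 + 2.1 / Real.log x) := by
  have hder : ∀ t, X ≤ t → HasDerivAt (fun t => t / Real.log t ^ 2 * (1 + 2.1 / Real.log t))
      (1 / Real.log t^2 + 0.1 / Real.log t^3 - 6.3 / Real.log t ^4) t := by
    intro t ht
    have ht0 : 0 < t := by linarith
    have hl : 0 < Real.log t := by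
      have := Real.log_le_log (by linarith) ht; linarith
    have h1 := Real.hasDerivAt_log ht0.ne'
    have h2 : HasDerivAt (fun t => t / Real.log t ^ 2 * (1 + 2.1 / Real.log t)) _ t :=
      (HasDerivAt.fun_div (hasDerivAt_id' t) (HasDerivAt.fun_pow h1 2) (by positivity)).mul
      ((HasDerivAt.fun_div (hasDerivAt_const t (2.1:ℝ)) h1 hl.ne').const_add 1)
    convert h2 using 1
    field_simp
    ring
  have h3 : MeasureTheory.IntegrableOn (fun t => 1 / Real.log t ^ 2) (Set.Icc X x) := by
    have := Chebyshev.intervalIntegrable_one_div_log_sq hX1 (lt_of_lt_of_le hX1 hx)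
    rw [intervalIntegrable_iff_integrableOn_Icc_of_le hx] at this
    exact this
  have h4 : ∀ t ∈ Set.Ioo X x, 1 / Real.log t ^ 2 ≤ 1 / Real.log t^2 + 0.1 / Real.log t^3 - 6.3 / Real.log t ^4 := by
    intro t ht
    have hl : 64 ≤ Real.log t := by
      have := Real.log_le_log (by linarith) ht.1.le; linarith
    have : 6.3 / Real.log t ^4 ≤ 0.1 / Real.log t^3 := by
      rw [div_le_div_iff₀ (by positivity) (by positivity)]
      have h3 : 0 < Real.log t ^ 3 := by positivity
      nlinarith
    linarith
  have h := intervalIntegral.integral_le_sub_of_hasDeriv_right_of_le hx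
    (fun t ht => (hder t ht.1).continuousAt.continuousWithinAt)
    (fun t ht => (hder t ht.1.le).hasDerivWithinAt) h3 h4
  refine h.trans ?_
  have : 0 ≤ X / Real.log X ^ 2 * (1 + 2.1 / Real.log X) := by positivity
  linarith

end PC

namespace PC

lemma final_num (L e v η : ℝ) (hL : 230.257 ≤ L) (he : 0.6931471803 < e) (he' : e < 0.6931471808)
    (hv : v = 1 / L) (hη : η = 0.00066201) :
    (4.015 + 2 * (v + 2.1 * v^2) + 0.0000052) * (1 + e * v)^2 ≤
     2.015 * (1 - η) * (2 * (1 + e * v) + v) := by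
  have hL0 : 0 < L := by linarith
  have hv0 : 0 < v := by rw [hv]; positivity
  have hv1 : v ≤ 0.0043430 := by
    rw [hv, div_le_iff₀ hL0]; norm_num; norm_num at hL; linarith
  have hev : e * v ≤ 0.6931471808 * v := by gcongr
  have hev0 : 0 < e * v := mul_pos (by linarith) hv0
  have hv2 : v^2 ≤ 0.0043430 * v := by nlinarith
  have hsq : (1 + e * v)^2 ≤ 1 + 1.3862943616 * v + 0.0020867 * v := by
    have : (e * v)^2 ≤ 0.0020867 * v := by
      calc (e * v)^2 ≤ (0.6931471808 * v)^2 := by gcongr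
        _ = 0.6931471808^2 * v^2 := by ring
        _ ≤ 0.6931471808^2 * (0.0043430 * v) := by gcongr
        _ ≤ _ := by nlinarith
    nlinarith
  have hfac : 4.015 + 2 * (v + 2.1 * v^2) + 0.0000052 ≤ 4.01500523 + 2.0182405 * v := by
    nlinarith
  have hfac0 : 0 ≤ 4.015 + 2 * (v + 2.1 * v^2) + 0.0000052 := by
    nlinarith
  have h1 : (4.015 + 2 * (v + 2.1 * v^2) + 0.0000052) * (1 + e * v)^2 ≤
     (4.01500523 + 2.0182405 * v) * (1 + 1.3862943616 * v + 0.0020867 * v) := by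
    apply mul_le_mul hfac hsq (by positivity) (by nlinarith)
  have h2 : (4.01500523 + 2.0182405 * v) * (1 + 1.3862943616 * v + 0.0020867 * v) ≤
      4.01500523 + (2.0182405 + 4.01500523 * 1.3883810616 + 0.01217) * v := by nlinarith
  have h3 : 2.015 * (1 - η) * (2 + 2 * 0.6931471803 * v + v) ≤ 2.015 * (1 - η) * (2 * (1 + e * v) + v) := by
    apply mul_le_mul_of_nonneg_left _ (by rw [hη]; norm_num)
    nlinarith
  have h4 : 4.01500523 + (2.0182405 + 4.01500523 * 1.3883810616 + 0.01217) * v ≤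
      2.015 * (1 - η) * (2 + 2 * 0.6931471803 * v + v) := by
    rw [hη]; norm_num at hv1 ⊢; linarith
  linarith

lemma theta_lower (u : ℝ) (hu : (2:ℝ)^143 ≤ u) : ψ u - 0.000000000000001 * u ≤ θ u := by
  have hu0 : 0 < u := lt_of_lt_of_le (by positivity) hu
  have h1 := Chebyshev.psi_sub_theta_le (le_trans (by norm_num) hu : 1 ≤ u)
  have h2 := log_sq_le u hu
  have h3 : 2 * √u * Real.log u ≤ 0.000000000000001 * u := by
    apply abs_le_of_sq_le_sq' _ (by positivity) |>.2
    rw [mul_pow, mul_pow, Real.sq_sqrt hu0.le]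
    calc 2^2 * u * Real.log u^2 ≤ 2^2 * u * (9841 * (u / 2^143)) := by gcongr
      _ = (4 * 9841 / 2^143) * u^2 := by ring
      _ ≤ (0.000000000000001)^2 * u^2 := by gcongr; norm_num
      _ = _ := by ring
  linarith

set_option exponentiation.threshold 1000 in
set_option maxHeartbeats 1000000 in
lemma final (β : ℝ) (hβ : ∀ u, (2:ℝ)^303 ≤ u → |ψ u - β * u| ≤ 0.000331 * u) (x : ℝ) (hx : (10 : ℝ) ^ 100 ≤ x) :
    (Nat.primeCounting ⌊2 * x⌋₊ : ℝ) + (Nat.primeCounting ⌊x⌋₊ : ℝ) ≤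
      3.015 * ((Nat.primeCounting ⌊2 * x⌋₊ : ℝ) - (Nat.primeCounting ⌊x⌋₊ : ℝ)) := by
  obtain ⟨X, hXdef⟩ : ∃ X : ℝ, X = 2^303 := ⟨_, rfl⟩
  rw [← hXdef] at hβ
  have hX1 : 1 < X := by rw [hXdef]; norm_num
  have hX2 : 2 ≤ X := by rw [hXdef]; norm_num
  set hi := β + 0.000331 with hhi
  have hup : ∀ u, X ≤ u → ψ u ≤ hi * u := by
    intro u hu
    have := (abs_le.1 (hβ u hu)).2
    rw [hhi]; linarith
  have hlow : ∀ u, X ≤ u → (hi - 0.000662) * u ≤ ψ u := by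
    intro u hu
    have := (abs_le.1 (hβ u hu)).1
    rw [hhi]; linarith
  have hi1 : 1 ≤ hi := hi_ge_one X hi hX1.le hup
  have hXx : X ≤ x := by refine le_trans ?_ hx; rw [hXdef]; norm_num
  have hx0 : 0 < x := by linarith
  have hx2 : 2 ≤ x := by linarith
  set L := Real.log x with hL
  set e := Real.log 2 with he
  have he1 : 0.6931471803 < e := Real.log_two_gt_d9
  have he2 : e < 0.6931471808 := Real.log_two_lt_d9
  have hL1 : 230.257 ≤ L := by
    have h1 := Real.log_le_log (by positivity) hx
    rw [Real.log_pow] at h1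
    have h2 : (2:ℝ)^485 ≤ 10^146 := by norm_num
    have h3 := Real.log_le_log (by positivity) h2
    rw [Real.log_pow, Real.log_pow, ← he] at h3
    push_cast at h1 h3
    norm_num at he1 ⊢
    linarith
  have hL0 : 0 < L := by linarith
  have hlog2x : Real.log (2 * x) = e + L := by rw [Real.log_mul (by norm_num) hx0.ne']
  -- integrals
  set f : ℝ → ℝ := fun t => θ t / (t * Real.log t ^ 2) with hf
  have hfint : ∀ a b : ℝ, 2 ≤ a → a ≤ b → IntervalIntegrable f MeasureTheory.volume a b := by
    intro a b ha hab
    rw [intervalIntegrable_iff_integrableOn_Icc_of_le hab]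
    exact (Chebyshev.integrableOn_theta_div_id_mul_log_sq b).mono_set (Set.Icc_subset_Icc_left ha)
  have hp1 := Chebyshev.primeCounting_eq_theta_div_log_add_integral hx2
  have hp2 := Chebyshev.primeCounting_eq_theta_div_log_add_integral (by linarith : 2 ≤ 2 * x)
  rw [← intervalIntegral.integral_add_adjacent_intervals (hfint 2 x le_rfl hx2) (hfint x (2*x) hx2 (by linarith))] at hp2
  have hI : ∫ t in (2:ℝ)..x, f t ≤ 2.9 * X + hi * (x / L^2 * (1 + 2.1 / L)) := by
    rw [← intervalIntegral.integral_add_adjacent_intervals (hfint 2 X le_rfl hX2) (hfint X x hX2 hXx)]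
    apply add_le_add
    · have h1 : ∫ t in (2:ℝ)..X, f t ≤ ∫ t in (2:ℝ)..X, (2.9:ℝ) := by
        apply intervalIntegral.integral_mono_on hX2 (hfint 2 X le_rfl hX2) (by simp)
        intro t ht
        have ht2 : 2 ≤ t := ht.1
        have ht0 : 0 < t := by linarith
        have h2 := Chebyshev.theta_le_log4_mul_x ht0.le
        have h4 : Real.log 4 = 2 * e := by
          rw [show (4:ℝ) = 2^2 by norm_num, Real.log_pow, he]; norm_num
        have h5 : e ≤ Real.log t := Real.log_le_log (by norm_num) ht2
        have h6 : 0 < Real.log t := by linarith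
        simp only [hf]
        rw [div_le_iff₀ (by positivity)]
        refine h2.trans ?_
        rw [h4]
        have h7 : e * e ≤ Real.log t ^ 2 := by nlinarith
        have h8 : 2 * e ≤ 2.9 * Real.log t ^ 2 := by nlinarith
        nlinarith
      refine h1.trans ?_
      rw [intervalIntegral.integral_const, smul_eq_mul]; linarith
    · have hXlog : 64 ≤ Real.log X := by
        rw [hXdef, Real.log_pow]; push_cast; rw [← he]; norm_num at he1; linarith
      have h1 : ∫ t in X..x, f t ≤ ∫ t in X..x, hi * (1 / Real.log t ^ 2) := by
        apply intervalIntegral.integral_mono_on hXx (hfint X x hX2 hXx)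
          ((Chebyshev.intervalIntegrable_one_div_log_sq hX1 (by linarith)).const_mul _)
        intro t ht
        have ht0 : 0 < t := by linarith [ht.1]
        have h6 : 0 < Real.log t := Real.log_pos (by linarith [ht.1])
        have h2 := (Chebyshev.theta_le_psi t).trans (hup t ht.1)
        simp only [hf]
        rw [div_le_iff₀ (by positivity)]
        have : hi * (1 / Real.log t ^ 2) * (t * Real.log t ^ 2) = hi * t := by field_simp
        rw [this]; exact h2
      refine h1.trans ?_
      rw [intervalIntegral.integral_const_mul]
      apply mul_le_mul_of_nonneg_left (int_log_sq X x hXlog hX1 hXx) (by linarith)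
  set lo := hi * (1 - 0.00066201) with hlo
  have hlo0 : 0 < lo := by rw [hlo]; apply mul_pos (by linarith); norm_num
  have hth : ∀ t, x ≤ t → lo * t ≤ θ t := by
    intro t ht
    have ht0 : 0 < t := by linarith
    have h1 := hlow t (by linarith)
    have h2 := theta_lower t (le_trans (by norm_num) (hx.trans ht))
    have h3 : lo ≤ hi - 0.000662 - 0.000000000000001 := by rw [hlo]; norm_num; linarith
    have h4 := mul_le_mul_of_nonneg_right h3 ht0.le
    linarith
  have hJ : lo * x / (e + L)^2 ≤ ∫ t in x..(2*x), f t := by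
    have h1 : ∫ t in x..(2*x), lo / (e + L)^2 ≤ ∫ t in x..(2*x), f t := by
      apply intervalIntegral.integral_mono_on (by linarith) (by simp) (hfint x (2*x) hx2 (by linarith))
      intro t ht
      have ht0 : 0 < t := by linarith [ht.1]
      have h6 : 0 < Real.log t := Real.log_pos (by linarith [ht.1])
      have h7 : Real.log t ≤ e + L := by rw [← hlog2x]; exact Real.log_le_log ht0 ht.2
      simp only [hf]
      rw [div_le_div_iff₀ (by positivity) (by positivity)]
      calc lo * (t * Real.log t ^ 2) = lo * t * Real.log t^2 := by ring
        _ ≤ θ t * (e + L)^2 := by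
          apply mul_le_mul (hth t ht.1) _ (by positivity) (Chebyshev.theta_nonneg t)
          gcongr
    refine le_trans (le_of_eq ?_) h1
    rw [intervalIntegral.integral_const, smul_eq_mul]; ring
  have hT1 : θ x ≤ hi * x := (Chebyshev.theta_le_psi x).trans (hup x hXx)
  have hT2 : lo * (2 * x) ≤ θ (2 * x) := hth _ (by linarith)
  rw [hlog2x] at hp2
  have hT1' : θ x / L ≤ hi * x / L := by gcongr
  have hT2' : lo * (2 * x) / (e + L) ≤ θ (2 * x) / (e + L) := by
    apply div_le_div_of_nonneg_right hT2 (by linarith)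
  -- small term
  obtain ⟨v, hv⟩ : ∃ v : ℝ, v = 1 / L := ⟨_, rfl⟩
  have hv0 : 0 < v := by rw [hv]; positivity
  have hXs : 5.8 * X ≤ 0.0000052 * (x * v) := by
    have hy : L ≤ 230.27 + (x / 10^100 - 1) := by
      have h1 : L = 100 * Real.log 10 + Real.log (x / 10^100) := by
        rw [Real.log_div hx0.ne' (by positivity), Real.log_pow]; push_cast; ring
      have h2 := Real.log_le_sub_one_of_pos (by positivity : 0 < x / 10^100)
      have h3 : (10:ℝ)^59 ≤ 2^196 := by norm_num
      have h4 := Real.log_le_log (by positivity) h3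
      rw [Real.log_pow, Real.log_pow, ← he] at h4
      push_cast at h4
      norm_num at he2 ⊢ h2
      norm_num at h1
      linarith
    set y := x / 10^100 with hydef
    have hy1 : 1 ≤ y := by rw [hydef, le_div_iff₀ (by positivity)]; linarith
    have hxy : x = y * 10^100 := by rw [hydef]; field_simp
    have h5 : L ≤ 231 * y := by norm_num at hy ⊢; linarith
    have h6 : 5.8 * X * L ≤ 0.0000052 * x := by
      calc 5.8 * X * L ≤ 5.8 * X * (231 * y) := by gcongr
        _ = (5.8 * 231 * X) * y := by ring
        _ ≤ (0.0000052 * 10^100) * y := by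
          apply mul_le_mul_of_nonneg_right _ (by linarith)
          rw [hXdef]; norm_num
        _ = 0.0000052 * x := by rw [hxy]; ring
    have h7 : 5.8 * X = 5.8 * X * L * v := by rw [hv]; field_simp
    rw [h7]
    have := mul_le_mul_of_nonneg_right h6 hv0.le
    linarith
  have hnum := final_num L e v 0.00066201 hL1 he1 he2 hv rfl
  have hev0 : 0 < 1 + e * v := by positivity
  have hLv : L = 1 / v := by rw [hv]; simp
  have heL : e + L = (1 + e * v) / v := by rw [hLv]; field_simp; ring
  have hmain : 4.015 * (hi * x * v) + 2 * (hi * (x * v^2 * (1 + 2.1 * v))) + 0.0000052 * (x * v) ≤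
      2.015 * (lo * (2 * x) / (e + L) + lo * x / (e + L)^2) := by
    have h1 : lo * (2 * x) / (e + L) + lo * x / (e + L)^2 = hi * x * v * ((1 - 0.00066201) * (2 * (1 + e * v) + v)) / (1 + e * v)^2 := by
      rw [heL, hlo]; field_simp
    rw [h1, ← mul_div_assoc, le_div_iff₀ (by positivity)]
    have h2 := mul_le_mul_of_nonneg_left hnum (by positivity : 0 ≤ hi * x * v)
    have h3 : 0 ≤ (hi - 1) * (0.0000052 * (x * v)) * (1 + e * v)^2 := by
      apply mul_nonneg (mul_nonneg (by linarith) (by positivity)) (by positivity)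
    linarith
  have q1 : hi * x / L = hi * x * v := by rw [hv]; ring
  have q2 : x / L^2 * (1 + 2.1 / L) = x * v^2 * (1 + 2.1 * v) := by rw [hv]; ring
  rw [q1] at hT1'
  rw [q2] at hI
  have e1 : (Nat.primeCounting ⌊x⌋₊ : ℝ) = θ x / L + ∫ t in (2:ℝ)..x, f t := hp1
  have e2 : (Nat.primeCounting ⌊2 * x⌋₊ : ℝ) = θ (2 * x) / (e + L) + ((∫ t in (2:ℝ)..x, f t) + ∫ t in x..(2*x), f t) := hp2
  norm_num at *
  linarith

end PC

namespace PC

def rep (s j : ℕ) : ℕ :=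
  Nat.rec (motive := fun _ => ℕ) 1 (fun j ih => Nat.add ih (Nat.shiftLeft ih (Nat.shiftLeft s j))) j

def bt (m a : ℕ) : ℕ := Nat.mod (Nat.shiftRight m a) 2

/-- the multiples of `d` among `n + 1 + i`, in lanes of 14 bits -/
def leaf (n d : ℕ) : ℕ :=
  Nat.shiftLeft (rep (Nat.mul 14 d) (Nat.log2 (Nat.div 8192 d)))
    (Nat.mul 14 (Nat.sub (Nat.sub d 1) (Nat.mod n d)))

def tree (m n j a : ℕ) : ℕ :=
  Nat.rec (motive := fun _ => ℕ → ℕ)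
    (fun a => Nat.rec (motive := fun _ => ℕ) 0 (fun _ _ => leaf n a) (bt m a))
    (fun j ih a => Nat.add (ih a) (ih (Nat.add a (Nat.pow 2 j)))) j a

def ptree (m n : ℕ) : ℕ := Nat.add (tree m n 12 0) (Nat.add (tree m n 10 4096) (tree m n 8 5120))

/-- decode a list of in-chunk positions into 14 bit lanes -/
def jsum (c l : ℕ) : ℕ :=
  Nat.rec (motive := fun _ => ℕ → ℕ) (fun _ => 0)
    (fun _ ih l => Nat.add (Nat.shiftLeft 1 (Nat.mul 14 (Nat.mod l 4096))) (ih (Nat.div l 4096))) c l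

def jwt (n c l : ℕ) : ℕ :=
  Nat.rec (motive := fun _ => ℕ → ℕ) (fun _ => 0)
    (fun _ ih l => Nat.add (Nat.add (Nat.div (Nat.pow 2 60) (Nat.add n (Nat.add (Nat.mod l 4096) 1))) 1)
      (ih (Nat.div l 4096))) c l

/-- sum of the distances of `2 ^ j` lanes from 8192 -/
def asum (j D : ℕ) : ℕ :=
  Nat.rec (motive := fun _ => ℕ → ℕ) (fun D => Nat.add (Nat.sub D 8192) (Nat.sub 8192 D))
    (fun j ih D => Nat.add (ih (Nat.mod D (Nat.pow 2 (Nat.mul 14 (Nat.pow 2 j)))))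
      (ih (Nat.div D (Nat.pow 2 (Nat.mul 14 (Nat.pow 2 j)))))) j D

def bsum (j k D : ℕ) : ℕ :=
  Nat.rec (motive := fun _ => ℕ → ℕ → ℕ)
    (fun k D => Nat.mul (asum 3 D) (Nat.add (Nat.div (Nat.pow 2 60) (Nat.mul k (Nat.add k 1))) 1))
    (fun j ih k D => Nat.add (ih k (Nat.mod D (Nat.pow 2 (Nat.mul 112 (Nat.pow 2 j)))))
      (ih (Nat.add k (Nat.mul 8 (Nat.pow 2 j))) (Nat.div D (Nat.pow 2 (Nat.mul 112 (Nat.pow 2 j)))))) j k D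

def BL : ℕ := Nat.pow 2 57344

def dig (P M n X jp cp jn cn : ℕ) : ℕ :=
  Nat.mod (Nat.mul (Nat.sub (Nat.add (Nat.add X (ptree M n)) (Nat.add (jsum cn jn) BL))
    (Nat.mod (Nat.add (ptree P n) (jsum cp jp)) BL)) (rep 14 12)) BL

def chunkD (D n s r i X' s' r' i' jp cp jn cn : ℕ) : Bool :=
  (Nat.beq (Nat.div D (Nat.pow 2 57330)) X').and
  ((Nat.beq (Nat.add s cp) (Nat.add s' cn)).and
  ((Nat.ble (Nat.add s (Nat.add cp cn)) 9700).and
  ((Nat.ble (Nat.add 6700 (Nat.add cp cn)) s).and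
  ((Nat.ble (Nat.add r (Nat.add (jwt n cp jp) (jwt n cn jn))) r').and
   (Nat.ble (Nat.add i (bsum 9 (Nat.add n 1) D)) i')))))

def chunk (P M n X s r i X' s' r' i' jp cp jn cn : ℕ) : Bool :=
  chunkD (dig P M n X jp cp jn cn) n s r i X' s' r' i' jp cp jn cn

end PC

namespace PC

lemma rep_eq (s j : ℕ) : rep s j = ∑ m ∈ range (2^j), 2^(s*m) := by
  induction j with
  | zero => simp [rep]
  | succ j ih =>
    have h : rep s (j+1) = rep s j + (rep s j) <<< (s <<< j) := rfl
    rw [h, Nat.shiftLeft_eq, Nat.shiftLeft_eq, ih, pow_succ, mul_two, Finset.sum_range_add, Finset.sum_mul]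
    congr 1
    apply Finset.sum_congr rfl
    intro m _
    rw [← pow_add]; congr 1; ring

lemma bt_cases (m a : ℕ) : bt m a = 0 ∨ bt m a = 1 := by
  have : bt m a = (m >>> a) % 2 := rfl
  omega

lemma tree_eq (m n j a : ℕ) : tree m n j a = ∑ t ∈ range (2^j), bt m (a+t) * leaf n (a+t) := by
  induction j generalizing a with
  | zero =>
    have h : tree m n 0 a = Nat.rec (motive := fun _ => ℕ) 0 (fun _ _ => leaf n a) (bt m a) := rfl
    rw [h]
    rcases bt_cases m a with h | h <;> simp [h]
  | succ j ih =>
    have h : tree m n (j+1) a = tree m n j a + tree m n j (a + 2^j) := rfl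
    rw [h, ih, ih, pow_succ, mul_two, Finset.sum_range_add]
    simp [add_assoc]

lemma ptree_eq (m n : ℕ) : ptree m n = ∑ d ∈ range 5376, bt m d * leaf n d := by
  have h : ptree m n = tree m n 12 0 + (tree m n 10 4096 + tree m n 8 5120) := rfl
  rw [h, tree_eq, tree_eq, tree_eq]
  rw [show 5376 = 4096 + (1024 + 256) from rfl, Finset.sum_range_add, Finset.sum_range_add]
  norm_num
  simp only [← add_assoc]

lemma bt_zero (m : ℕ) (hm : m % 2 = 0) : bt m 0 = 0 := by
  have : bt m 0 = (m >>> 0) % 2 := rfl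
  simpa using this.trans hm

set_option exponentiation.threshold 10000 in
lemma bt_big (m d : ℕ) (hm : m < 2^5307) (hd : 5307 ≤ d) : bt m d = 0 := by
  have : bt m d = (m >>> d) % 2 := rfl
  rw [this, Nat.shiftRight_eq_div_pow, Nat.div_eq_of_lt]
  exact lt_of_lt_of_le hm (Nat.pow_le_pow_right (by norm_num) hd)

lemma ptree_eq' (m n : ℕ) (hm0 : m % 2 = 0) (hm : m < 2^5307) :
    ptree m n = ∑ d ∈ Icc 1 5306, bt m d * leaf n d := by
  rw [ptree_eq]
  symm
  apply Finset.sum_subset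
  · intro d; simp; omega
  · intro d hd hd2
    have : d = 0 ∨ 5307 ≤ d := by simp at hd2; omega
    rcases this with h | h
    · subst h; rw [bt_zero m hm0]; simp
    · rw [bt_big m d hm h]; simp

lemma leaf_mod (n d : ℕ) (hd : 1 ≤ d) (hd2 : d ≤ 5306) :
    leaf n d ≡ ∑ i ∈ range 4096, (if d ∣ n + 1 + i then 1 else 0) * 2^(14*i) [MOD 2^57344] := by
  have h : leaf n d = (rep (14*d) (Nat.log2 (8192 / d))) <<< (14 * (d - 1 - n % d)) := rfl
  set j := Nat.log2 (8192 / d) with hj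
  set o := d - 1 - n % d with ho
  have hnd : n % d < d := Nat.mod_lt _ hd
  have hdiv : ∀ i, d ∣ n + 1 + i ↔ ∃ m, i = o + d * m := by
    intro i
    have e1 : n + 1 + o = d * (n / d + 1) := by
      have := Nat.div_add_mod n d
      rw [mul_add]; omega
    constructor
    · rintro ⟨c, hc⟩
      have hlt : d * (n/d) < d * c := by
        have := Nat.div_add_mod n d
        omega
      have hc1 : n/d + 1 ≤ c := Nat.lt_of_mul_lt_mul_left hlt
      obtain ⟨e, rfl⟩ := Nat.exists_eq_add_of_le hc1
      refine ⟨e, ?_⟩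
      rw [mul_add, ← e1] at hc; omega
    · rintro ⟨m, rfl⟩
      rw [← add_assoc, e1]
      exact Dvd.dvd.add (dvd_mul_right _ _) (dvd_mul_right _ _)
  have hbig : 4096 < d * 2^j := by
    have h1 : 8192 / d < 2^(j+1) := Nat.lt_log2_self
    have h2 := Nat.lt_mul_of_div_lt h1 (by omega)
    rw [pow_succ] at h2
    have : d * 2^j * 2 = 2^j * 2 * d := by ring
    omega
  rw [h, rep_eq, Nat.shiftLeft_eq, Finset.sum_mul]
  have e2 : ∀ m, 2 ^ (14 * d * m) * 2 ^ (14 * o) = 2^(14 * (o + d * m)) := by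
    intro m; rw [← pow_add]; congr 1; ring
  simp only [e2]
  have e3 : ∑ i ∈ range 4096, (if d ∣ n + 1 + i then 1 else 0) * 2^(14*i) =
      ∑ m ∈ range (2^j), if o + d * m < 4096 then 2^(14*(o + d*m)) else 0 := by
    simp only [ite_mul, one_mul, zero_mul]
    rw [← Finset.sum_filter, ← Finset.sum_filter]
    symm
    apply Finset.sum_bij (fun m _ => o + d * m)
    · intro m hm; simp only [mem_filter, mem_range] at *
      exact ⟨hm.2, (hdiv _).2 ⟨m, rfl⟩⟩
    · intro a _ b _ hab
      have : d * a = d * b := by simpa using hab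
      exact Nat.eq_of_mul_eq_mul_left hd this
    · intro i hi; simp only [mem_filter, mem_range] at hi
      obtain ⟨m, hm⟩ := (hdiv i).1 hi.2
      refine ⟨m, ?_, hm.symm⟩
      simp only [mem_filter, mem_range]
      refine ⟨?_, by omega⟩
      have : d * m < d * 2^j := by omega
      exact Nat.lt_of_mul_lt_mul_left this
    · intro m _; rfl
  rw [e3]
  apply Nat.ModEq.sum
  intro m _
  split_ifs with hc
  · rfl
  · rw [Nat.modEq_zero_iff_dvd]
    apply pow_dvd_pow; omega

lemma ptree_mod (m n : ℕ) (hm0 : m % 2 = 0) (hm : m < 2^5307) :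
    ptree m n ≡ ∑ i ∈ range 4096, (∑ d ∈ Icc 1 5306, if d ∣ n + 1 + i then bt m d else 0) * 2^(14*i)
      [MOD 2^57344] := by
  rw [ptree_eq' m n hm0 hm]
  have e : ∑ i ∈ range 4096, (∑ d ∈ Icc 1 5306, if d ∣ n + 1 + i then bt m d else 0) * 2^(14*i)
    = ∑ d ∈ Icc 1 5306, bt m d * ∑ i ∈ range 4096, (if d ∣ n + 1 + i then 1 else 0) * 2^(14*i) := by
    simp only [Finset.sum_mul, Finset.mul_sum]
    rw [Finset.sum_comm]
    apply Finset.sum_congr rfl; intro d _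
    apply Finset.sum_congr rfl; intro i _
    split_ifs <;> simp
  rw [e]
  apply Nat.ModEq.sum
  intro d hd
  simp only [mem_Icc] at hd
  exact (leaf_mod n d hd.1 hd.2).mul_left _

def cnt : ℕ → ℕ → ℕ → ℕ
  | 0, _, _ => 0
  | c+1, l, i => (if l % 4096 = i then 1 else 0) + cnt c (l/4096) i

lemma jsum_eq (c l : ℕ) : jsum c l = ∑ i ∈ range 4096, cnt c l i * 2^(14*i) := by
  induction c generalizing l with
  | zero => simp [cnt, jsum]
  | succ c ih =>
    have h : jsum (c+1) l = 1 <<< (14 * (l % 4096)) + jsum c (l/4096) := rfl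
    rw [h, ih, Nat.shiftLeft_eq]
    simp only [cnt, add_mul, Finset.sum_add_distrib, ite_mul, one_mul, zero_mul]
    rw [Finset.sum_ite_eq]
    simp [Nat.mod_lt]

lemma jwt_eq (n c l : ℕ) : jwt n c l = ∑ i ∈ range 4096, cnt c l i * (2^60 / (n + (i + 1)) + 1) := by
  induction c generalizing l with
  | zero => simp [cnt, jwt]
  | succ c ih =>
    have h : jwt n (c+1) l = (2^60 / (n + (l % 4096 + 1)) + 1) + jwt n c (l/4096) := rfl
    rw [h, ih]
    simp only [cnt, add_mul, Finset.sum_add_distrib, ite_mul, one_mul, zero_mul]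
    rw [Finset.sum_ite_eq]
    simp [Nat.mod_lt]

lemma cnt_sum (c l : ℕ) : ∑ i ∈ range 4096, cnt c l i = c := by
  induction c generalizing l with
  | zero => simp [cnt]
  | succ c ih =>
    simp only [cnt, Finset.sum_add_distrib, ih]
    rw [Finset.sum_ite_eq]
    simp [Nat.mod_lt, add_comm]

lemma dig_lt (x : ℕ → ℕ) (w : ℕ) (hx : ∀ i, x i < 2^w) (L : ℕ) : ∑ i ∈ range L, x i * 2^(w*i) < 2^(w*L) := by
  induction L with
  | zero => simp
  | succ L ih =>
    rw [Finset.sum_range_succ, mul_add, pow_add, mul_one]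
    have := Nat.mul_le_mul_right (2^(w*L)) (Nat.succ_le_of_lt (hx L))
    rw [Nat.succ_mul] at this
    calc _ < x L * 2^(w*L) + 2^(w*L) := by omega
      _ ≤ _ := by rw [mul_comm (2^(w*L))]; exact this

lemma dig_split (x : ℕ → ℕ) (w : ℕ) (a b : ℕ) :
    ∑ i ∈ range (a+b), x i * 2^(w*i) = ∑ i ∈ range a, x i * 2^(w*i) + 2^(w*a) * ∑ i ∈ range b, x (a+i) * 2^(w*i) := by
  rw [Finset.sum_range_add, Finset.mul_sum]
  congr 1
  apply Finset.sum_congr rfl; intro i _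
  rw [mul_add, pow_add]; ring

lemma dig_mod (x : ℕ → ℕ) (w : ℕ) (hx : ∀ i, x i < 2^w) (a b : ℕ) :
    (∑ i ∈ range (a+b), x i * 2^(w*i)) % 2^(w*a) = ∑ i ∈ range a, x i * 2^(w*i) := by
  rw [dig_split, Nat.add_mul_mod_self_left, Nat.mod_eq_of_lt (dig_lt x w hx a)]

lemma dig_div (x : ℕ → ℕ) (w : ℕ) (hx : ∀ i, x i < 2^w) (a b : ℕ) :
    (∑ i ∈ range (a+b), x i * 2^(w*i)) / 2^(w*a) = ∑ i ∈ range b, x (a+i) * 2^(w*i) := by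
  rw [dig_split, Nat.add_mul_div_left _ _ (by positivity), Nat.div_eq_of_lt (dig_lt x w hx a), zero_add]

lemma asum_eq (j : ℕ) (x : ℕ → ℕ) (hx : ∀ i, x i < 2^14) :
    asum j (∑ i ∈ range (2^j), x i * 2^(14*i)) = ∑ i ∈ range (2^j), ((x i - 8192) + (8192 - x i)) := by
  induction j generalizing x with
  | zero => simp [asum]
  | succ j ih =>
    have h : ∀ D, asum (j+1) D = asum j (D % 2^(14 * 2^j)) + asum j (D / 2^(14*2^j)) := fun _ => rfl
    rw [h, pow_succ, mul_two, dig_mod x 14 hx, dig_div x 14 hx, ih x hx, ih _ (fun i => hx _), Finset.sum_range_add]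

lemma bsum_le (j k : ℕ) (hk : 1 ≤ k) (x : ℕ → ℕ) (hx : ∀ i, x i < 2^14) :
    2^60 * ∑ i ∈ range (8 * 2^j), |(x i : ℝ) - 8192| * mk (k + i) ≤
      (bsum j k (∑ i ∈ range (8 * 2^j), x i * 2^(14*i)) : ℕ) := by
  induction j generalizing x k with
  | zero =>
    have h : ∀ D, bsum 0 k D = asum 3 D * (2^60 / (k * (k+1)) + 1) := fun _ => rfl
    rw [h, show 8 * 2^0 = 2^3 by norm_num, asum_eq 3 x hx]
    push_cast
    rw [Finset.mul_sum, Finset.sum_mul]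
    apply Finset.sum_le_sum
    intro i _
    have e1 : (((x i - 8192 : ℕ):ℝ) + ((8192 - x i : ℕ):ℝ)) = |(x i : ℝ) - 8192| := by
      rcases le_total (x i) 8192 with h | h
      · rw [Nat.sub_eq_zero_of_le h, Nat.cast_sub h, abs_sub_comm, abs_of_nonneg]
        · simp
        · have : (x i : ℝ) ≤ 8192 := by exact_mod_cast h
          linarith
      · rw [Nat.sub_eq_zero_of_le h, Nat.cast_sub h, abs_of_nonneg]
        · simp
        · have : (8192 : ℝ) ≤ x i := by exact_mod_cast h
          linarith
    rw [e1]
    have e2 : 2^60 * mk (k+i) ≤ (((2^60 / (k*(k+1)) : ℕ) : ℝ) + 1) := by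
      have hk' : (1:ℝ) ≤ k := by exact_mod_cast hk
      have h1 : (2:ℝ)^60 / ((k:ℝ) * (k+1)) < (((2^60 / (k*(k+1)) : ℕ) : ℝ) + 1) := by
        have := Nat.lt_floor_add_one ((2:ℝ)^60 / ((k:ℝ) * (k+1)))
        have h2 : ⌊(2:ℝ)^60 / ((k:ℝ) * (k+1))⌋₊ = 2^60 / (k*(k+1)) := by
          have := Nat.floor_div_eq_div (K := ℝ) (2^60) (k*(k+1))
          norm_num at this ⊢; exact this
        rw [h2] at this; exact this
      refine le_trans ?_ h1.le
      rw [mk, mul_one_div]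
      apply div_le_div_of_nonneg_left (by positivity) (by positivity)
      push_cast
      have : (0:ℝ) ≤ i := Nat.cast_nonneg i
      apply mul_le_mul <;> first | positivity | linarith
    calc _ = |(x i : ℝ) - 8192| * (2^60 * mk (k+i)) := by ring
      _ ≤ |(x i : ℝ) - 8192| * (((2^60 / (k*(k+1)) : ℕ) : ℝ) + 1) := mul_le_mul_of_nonneg_left e2 (abs_nonneg _)
      _ = _ := by push_cast; rfl
  | succ j ih =>
    have h : ∀ D, bsum (j+1) k D = bsum j k (D % 2^(112 * 2^j)) + bsum j (k + 8 * 2^j) (D / 2^(112*2^j)) := fun _ => rfl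
    have e : 112 * 2^j = 14 * (8 * 2^j) := by ring
    rw [h, e, show 8 * 2^(j+1) = 8 * 2^j + 8 * 2^j by ring, dig_mod x 14 hx, dig_div x 14 hx, Finset.sum_range_add, mul_add]
    push_cast
    have h1 := ih k hk x hx
    have h2 := ih (k + 8 * 2^j) (by omega) (fun i => x (8 * 2^j + i)) (fun i => hx _)
    simp only [add_assoc] at h2 ⊢
    exact add_le_add h1 h2

end PC

namespace PC

lemma digs (X0 : ℤ) (e : ℕ → ℤ) (b : ℤ) (L : ℕ) :
    (X0 + ∑ i ∈ range L, e i * b^i) * (∑ i ∈ range L, b^i) ≡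
      ∑ i ∈ range L, (X0 + ∑ j ∈ range (i+1), e j) * b^i [ZMOD b^L] := by
  have h1 : ∀ L, X0 + ∑ i ∈ range L, e i * b^i =
      (1 - b) * (∑ i ∈ range L, (X0 + ∑ j ∈ range (i+1), e j) * b^i) + (X0 + ∑ j ∈ range L, e j) * b^L := by
    intro L
    induction L with
    | zero => simp
    | succ L ih =>
      rw [Finset.sum_range_succ, ← add_assoc, ih, Finset.sum_range_succ (fun i => (X0 + ∑ j ∈ range (i+1), e j) * b^i),
        Finset.sum_range_succ e]
      ring
  rw [h1 L]
  set T := ∑ i ∈ range L, (X0 + ∑ j ∈ range (i+1), e j) * b^i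
  have h2 : (∑ i ∈ range L, b^i) * (b - 1) = b^L - 1 := geom_sum_mul b L
  set G := ∑ i ∈ range L, b^i
  apply Int.ModEq.symm
  rw [Int.modEq_iff_dvd]
  refine ⟨(X0 + ∑ j ∈ range L, e j) * G - T, ?_⟩
  linear_combination (-T) * h2

def nuOf (P M d : ℕ) : ℤ := (bt P d : ℤ) - bt M d

lemma A_succ (ν : ℕ → ℤ) (N k : ℕ) : A ν N (k+1) = A ν N k + ∑ d ∈ Icc 1 N, if d ∣ k + 1 then ν d else 0 := by
  rw [A, A, ← Finset.sum_add_distrib]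
  apply Finset.sum_congr rfl
  intro d _
  rw [Nat.succ_div]
  split_ifs <;> push_cast <;> ring

def Good (P M n X s r i : ℕ) : Prop := ∃ σ : ℕ → ℤ, σ 0 = 0 ∧
  (X : ℤ) = 8193 - A (nuOf P M) 5306 n - σ n ∧ (s : ℤ) = 8192 + σ n ∧
  2^60 * ∑ k ∈ Ico 1 (n+1), |(σ k : ℝ) - σ (k-1)| / k ≤ r ∧
  2^60 * ∑ k ∈ Ico 1 (n+1), |1 - (A (nuOf P M) 5306 k : ℝ) - σ k| * mk k ≤ i

lemma sum_ico_ext (f : ℕ → ℝ) (n L : ℕ) :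
    ∑ k ∈ Ico 1 (n + L + 1), f k = ∑ k ∈ Ico 1 (n+1), f k + ∑ i ∈ range L, f (n + 1 + i) := by
  rw [← Finset.sum_Ico_consecutive f (show 1 ≤ n+1 by omega) (show n + 1 ≤ n + L + 1 by omega)]
  congr 1
  rw [Finset.sum_Ico_eq_sum_range]
  congr 2; omega

lemma dig_def (P M n X jp cp jn cn : ℕ) : dig P M n X jp cp jn cn =
    ((X + ptree M n + (jsum cn jn + BL) - (ptree P n + jsum cp jp) % BL) * rep 14 12) % BL := by
  unfold dig
  generalize BL = b
  generalize rep 14 12 = o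
  rfl

lemma chunk_spec {P M n X s r i X' s' r' i' jp cp jn cn : ℕ}
    (hc : chunk P M n X s r i X' s' r' i' jp cp jn cn = true) :
    dig P M n X jp cp jn cn / 2^57330 = X' ∧ s + cp = s' + cn ∧ s + (cp + cn) ≤ 9700 ∧ 6700 + (cp + cn) ≤ s ∧
    r + (jwt n cp jp + jwt n cn jn) ≤ r' ∧ i + bsum 9 (n+1) (dig P M n X jp cp jn cn) ≤ i' := by
  unfold chunk at hc
  generalize dig P M n X jp cp jn cn = D at *
  unfold chunkD at hc
  simp only [Bool.and_eq_true] at hc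
  obtain ⟨c1, c2, c3, c4, c5, c6⟩ := hc
  generalize jwt n cp jp = j1 at *
  generalize jwt n cn jn = j2 at *
  have c6 := Nat.le_of_ble_eq_true c6
  have e : bsum 9 (Nat.add n 1) D = bsum 9 (n+1) D := rfl
  rw [e] at c6
  generalize bsum 9 (n+1) D = j3 at *
  have c1 := Nat.eq_of_beq_eq_true c1
  have c2 := Nat.eq_of_beq_eq_true c2
  exact ⟨c1, c2, Nat.le_of_ble_eq_true c3, Nat.le_of_ble_eq_true c4, Nat.le_of_ble_eq_true c5, c6⟩

lemma dig_abs (w L : ℕ) (X p1 p2 j1 j2 o : ℕ) (f1 f2 g1 g2 x : ℕ → ℕ)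
    (h1 : p1 ≡ ∑ i ∈ range L, f1 i * 2^(w*i) [MOD 2^(w*L)])
    (h2 : p2 ≡ ∑ i ∈ range L, f2 i * 2^(w*i) [MOD 2^(w*L)])
    (k1 : j1 = ∑ i ∈ range L, g1 i * 2^(w*i)) (k2 : j2 = ∑ i ∈ range L, g2 i * 2^(w*i))
    (ho : o = ∑ i ∈ range L, 2^(w*i)) (hx : ∀ i, x i < 2^w)
    (hxz : ∀ i < L, (x i : ℤ) = X + ∑ j ∈ range (i+1), ((f1 j : ℤ) - f2 j + g1 j - g2 j)) :
    ((X + p1 + (j1 + 2^(w*L)) - (p2 + j2) % 2^(w*L)) * o) % 2^(w*L) = ∑ i ∈ range L, x i * 2^(w*i) := by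
  have hlt := dig_lt x w hx L
  set q := 2^(w*L) with hq
  have hql : (p2 + j2) % q < q := Nat.mod_lt _ (by positivity)
  rw [← Nat.mod_eq_of_lt hlt]
  change _ ≡ _ [MOD q]
  rw [← Int.natCast_modEq_iff] at *
  push_cast
  rw [Nat.cast_sub (by omega)]
  have hd := digs (X:ℤ) (fun j => (f1 j : ℤ) - f2 j + g1 j - g2 j) (2^w) L
  have e1 : ∑ i ∈ range L, (x i : ℤ) * 2^(w*i) = ∑ i ∈ range L, ((X:ℤ) + ∑ j ∈ range (i+1), ((f1 j : ℤ) - f2 j + g1 j - g2 j)) * (2^w)^i := by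
    apply Finset.sum_congr rfl
    intro i hi
    rw [hxz i (mem_range.1 hi), pow_mul]
  have hq' : ((q:ℕ):ℤ) = (2^w)^L := by rw [hq, ← pow_mul]; push_cast; rfl
  have ho' : (o:ℤ) = ∑ i ∈ range L, ((2:ℤ)^w)^i := by rw [ho]; push_cast; simp only [pow_mul]
  rw [e1, ho', hq']
  refine Int.ModEq.trans ?_ hd
  apply Int.ModEq.mul_right
  rw [← hq']
  have e2 : (X:ℤ) + ∑ i ∈ range L, ((f1 i : ℤ) - f2 i + g1 i - g2 i) * (2^w)^i =
      (X + ∑ i ∈ range L, (f1 i : ℤ) * 2^(w*i) + (j1 + 0)) - (∑ i ∈ range L, (f2 i : ℤ) * 2^(w*i) + j2) := by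
    rw [k1, k2]; push_cast
    simp only [sub_mul, add_mul, Finset.sum_sub_distrib, Finset.sum_add_distrib, pow_mul]
    ring
  rw [e2]
  push_cast at h1 h2 ⊢
  apply Int.ModEq.sub
  · apply Int.ModEq.add
    · exact h1.add_left _
    · apply Int.ModEq.add_left
      exact Int.modEq_zero_iff_dvd.2 dvd_rfl
  · exact (Int.mod_modEq _ _).trans (h2.add_right _)

lemma cstep (P M : ℕ) (hP0 : P % 2 = 0) (hP : P < 2^5307) (hM0 : M % 2 = 0) (hM : M < 2^5307)
    (hA : ∀ k ≤ 1048576, |1 - A (nuOf P M) 5306 k| ≤ 5308)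
    {n X s r i X' s' r' i' jp cp jn cn : ℕ} (hn : n + 4096 ≤ 1048576) (hg : Good P M n X s r i)
    (hc : chunk P M n X s r i X' s' r' i' jp cp jn cn = true) : Good P M (n + 4096) X' s' r' i' := by
  obtain ⟨σ, h0, hX, hs, hr, hi⟩ := hg
  obtain ⟨c1, c2', c3', c4', c5', c6'⟩ := chunk_spec hc
  set ν := nuOf P M with hν
  set D := dig P M n X jp cp jn cn with hD
  set δ : ℕ → ℤ := fun j => (cnt cp jp j : ℤ) - cnt cn jn j with hδ
  set a : ℕ → ℤ := fun j => ∑ d ∈ Icc 1 5306, if d ∣ n + 1 + j then ν d else 0 with ha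
  set e : ℕ → ℤ := fun j => - a j - δ j with he
  set σ' : ℕ → ℤ := fun k => if k ≤ n then σ k else σ n + ∑ j ∈ range (k - n), δ j with hσ'
  have s1 : ∀ k ≤ n, σ' k = σ k := fun k hk => if_pos hk
  have s2 : ∀ i, σ' (n + 1 + i) = σ n + ∑ j ∈ range (i+1), δ j := by
    intro i
    simp only [hσ']
    rw [if_neg (by omega), show n + 1 + i - n = i + 1 by omega]
  have hAr : ∀ i, A ν 5306 (n+i) = A ν 5306 n + ∑ j ∈ range i, a j := by
    intro i
    induction i with
    | zero => simp
    | succ i ih =>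
      rw [← add_assoc, A_succ, ih, Finset.sum_range_succ, ← add_assoc]
      simp only [ha]; congr 3; ext d
      rw [show n + i + 1 = n + 1 + i by ring]
  have hf : ∀ i, (X : ℤ) + ∑ j ∈ range (i+1), e j = 8193 - A ν 5306 (n+1+i) - σ' (n+1+i) := by
    intro i
    rw [s2, show n + 1 + i = n + (i+1) by ring, hAr, hX]
    simp only [he, Finset.sum_sub_distrib, Finset.sum_neg_distrib]
    ring
  have hδs : ∀ i ≤ 4096, |∑ j ∈ range i, δ j| ≤ cp + cn := by
    intro i hi
    calc |∑ j ∈ range i, δ j| ≤ ∑ j ∈ range i, |δ j| := Finset.abs_sum_le_sum_abs _ _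
      _ ≤ ∑ j ∈ range i, ((cnt cp jp j : ℤ) + cnt cn jn j) := by
        apply Finset.sum_le_sum; intro j _
        simp only [hδ]; rw [abs_le]; constructor <;> omega
      _ ≤ ∑ j ∈ range 4096, ((cnt cp jp j : ℤ) + cnt cn jn j) := by
        apply Finset.sum_le_sum_of_subset_of_nonneg
        · intro j; simp; omega
        · intro j _ _; exact add_nonneg (Int.natCast_nonneg _) (Int.natCast_nonneg _)
      _ = cp + cn := by
        rw [Finset.sum_add_distrib, ← Nat.cast_sum, ← Nat.cast_sum, cnt_sum, cnt_sum]
  have hrange : ∀ i < 4096, 0 ≤ (X : ℤ) + ∑ j ∈ range (i+1), e j ∧ (X : ℤ) + ∑ j ∈ range (i+1), e j < 2^14 := by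
    intro i hi
    rw [hf, s2]
    have h1 := hA (n+1+i) (by omega)
    have h2 := hδs (i+1) (by omega)
    rw [abs_le] at h1 h2
    constructor <;> omega
  set x : ℕ → ℕ := fun i => if i < 4096 then ((X : ℤ) + ∑ j ∈ range (i+1), e j).toNat else 0 with hx
  have hxz : ∀ i < 4096, (x i : ℤ) = (X : ℤ) + ∑ j ∈ range (i+1), e j := by
    intro i hi
    simp only [hx]; rw [if_pos hi, Int.toNat_of_nonneg (hrange i hi).1]
  have hxlt : ∀ i, x i < 2^14 := by
    intro i
    by_cases hi : i < 4096
    · have := hxz i hi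
      have := (hrange i hi).2
      omega
    · simp only [hx]; rw [if_neg hi]; norm_num
  have hBL : (BL : ℕ) = 2^57344 := rfl
  -- the digits
  have hDx : D = ∑ i ∈ range 4096, x i * 2^(14*i) := by
    rw [hD, dig_def, hBL]
    refine dig_abs 14 4096 X (ptree M n) (ptree P n) (jsum cn jn) (jsum cp jp) (rep 14 12) _ _ _ _ x
      (ptree_mod M n hM0 hM) (ptree_mod P n hP0 hP) (jsum_eq _ _) (jsum_eq _ _) (rep_eq _ _) hxlt ?_
    intro i hi
    rw [hxz i hi]
    refine congrArg (fun z => (X:ℤ) + z) ?_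
    apply Finset.sum_congr rfl
    intro j _
    have : a j = ((∑ d ∈ Icc 1 5306, if d ∣ n + 1 + j then bt P d else 0 : ℕ) : ℤ) -
        ((∑ d ∈ Icc 1 5306, if d ∣ n + 1 + j then bt M d else 0 : ℕ) : ℤ) := by
      push_cast
      rw [← Finset.sum_sub_distrib]
      apply Finset.sum_congr rfl
      intro d _
      rw [hν, nuOf]
      split_ifs <;> simp
    simp only [he, hδ]
    rw [this]; ring
  have hlast : X' = x 4095 := by
    have h1 := dig_div x 14 hxlt 4095 1
    rw [← c1, hDx]
    rw [Finset.sum_range_one] at h1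
    simpa using h1
  refine ⟨σ', ?_, ?_, ?_, ?_, ?_⟩
  · rw [s1 0 (by omega), h0]
  · rw [hlast, hxz 4095 (by norm_num), hf, show n + 1 + 4095 = n + 4096 by ring]
  · have h1 : σ' (n + 4096) = σ n + ((cp : ℤ) - cn) := by
      have := s2 4095
      rw [show n + 1 + 4095 = n + 4096 by ring] at this
      rw [this]; refine congrArg (fun z => σ n + z) ?_
      simp only [hδ, Finset.sum_sub_distrib]
      rw [show 4095 + 1 = 4096 from rfl, ← Nat.cast_sum, ← Nat.cast_sum, cnt_sum, cnt_sum]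
    rw [h1]; omega
  · rw [sum_ico_ext, mul_add]
    have h1 : ∑ k ∈ Ico 1 (n+1), |(σ' k : ℝ) - σ' (k-1)| / k = ∑ k ∈ Ico 1 (n+1), |(σ k : ℝ) - σ (k-1)| / k := by
      apply Finset.sum_congr rfl
      intro k hk
      simp only [mem_Ico] at hk
      rw [s1 k (by omega), s1 (k-1) (by omega)]
    rw [h1]
    have h2 : 2^60 * ∑ i ∈ range 4096, |(σ' (n+1+i) : ℝ) - σ' (n+1+i-1)| / ((n+1+i : ℕ):ℝ) ≤ (jwt n cp jp + jwt n cn jn : ℕ) := by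
      rw [jwt_eq, jwt_eq, ← Finset.sum_add_distrib, Finset.mul_sum]
      push_cast
      apply Finset.sum_le_sum
      intro i _
      have e1 : (σ' (n+1+i) : ℝ) - σ' (n+1+i-1) = δ i := by
        have : σ' (n+1+i-1) = σ n + ∑ j ∈ range i, δ j := by
          rcases i with _ | i
          · rw [show n+1+0-1 = n by omega, s1 n le_rfl]; simp
          · rw [show n+1+(i+1)-1 = n+1+i by omega, s2]
        rw [this, s2, Finset.sum_range_succ]; push_cast; ring
      rw [e1]
      have e2 : |((δ i : ℤ) : ℝ)| ≤ (cnt cp jp i : ℝ) + cnt cn jn i := by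
        simp only [hδ]; push_cast; rw [abs_le]
        have u1 : (0:ℝ) ≤ cnt cp jp i := Nat.cast_nonneg _
        have u2 : (0:ℝ) ≤ cnt cn jn i := Nat.cast_nonneg _
        constructor <;> linarith
      have e3 : (2:ℝ)^60 / (n+1+i) ≤ ((2^60 / (n + (i+1)) : ℕ) : ℝ) + 1 := by
        have h2 : ⌊(2:ℝ)^60 / ((n:ℝ)+1+i)⌋₊ = 2^60 / (n+(i+1)) := by
          have := Nat.floor_div_eq_div (K := ℝ) (2^60) (n+(i+1))
          rw [show (n:ℝ)+1+i = n+(i+1) by ring]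
          norm_num at this ⊢; exact this
        have := Nat.lt_floor_add_one ((2:ℝ)^60 / ((n:ℝ)+1+i))
        rw [h2] at this; exact this.le
      calc (2:ℝ)^60 * (|((δ i : ℤ) : ℝ)| / ((n:ℝ)+1+i)) = |((δ i : ℤ) : ℝ)| * ((2:ℝ)^60 / (n+1+i)) := by ring
        _ ≤ ((cnt cp jp i : ℝ) + cnt cn jn i) * (((2^60 / (n + (i+1)) : ℕ) : ℝ) + 1) := by
          exact mul_le_mul e2 e3 (div_nonneg (pow_nonneg (by norm_num) _) (by exact_mod_cast Nat.zero_le (n+1+i))) (add_nonneg (Nat.cast_nonneg _) (Nat.cast_nonneg _))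
        _ = _ := by push_cast; ring
    have c5'' : (r:ℝ) + ((jwt n cp jp + jwt n cn jn : ℕ):ℝ) ≤ r' := by exact_mod_cast c5'
    linarith
  · rw [sum_ico_ext, mul_add]
    have h1 : ∑ k ∈ Ico 1 (n+1), |1 - (A ν 5306 k : ℝ) - σ' k| * mk k = ∑ k ∈ Ico 1 (n+1), |1 - (A ν 5306 k : ℝ) - σ k| * mk k := by
      apply Finset.sum_congr rfl
      intro k hk
      simp only [mem_Ico] at hk
      rw [s1 k (by omega)]
    rw [h1]
    have h2 := bsum_le 9 (n+1) (by omega) x hxlt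
    rw [show 8 * 2^9 = 4096 by norm_num, ← hDx] at h2
    have h3 : ∑ i ∈ range 4096, |1 - (A ν 5306 (n+1+i) : ℝ) - σ' (n+1+i)| * mk (n+1+i) =
        ∑ i ∈ range 4096, |(x i : ℝ) - 8192| * mk (n+1+i) := by
      apply Finset.sum_congr rfl
      intro i hi
      simp only [mem_range] at hi
      have := hxz i hi
      rw [hf] at this
      have h4 : (x i : ℝ) = 8193 - A ν 5306 (n+1+i) - σ' (n+1+i) := by exact_mod_cast this
      rw [h4, show (8193:ℝ) - A ν 5306 (n+1+i) - σ' (n+1+i) - 8192 = 1 - A ν 5306 (n+1+i) - σ' (n+1+i) by ring]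
    rw [h3]
    have c6'' : (i:ℝ) + ((bsum 9 (n+1) D : ℕ):ℝ) ≤ i' := by exact_mod_cast c6'
    linarith

end PC

namespace PC

def gsum (f : ℕ → ℕ) (j a : ℕ) : ℕ :=
  Nat.rec (motive := fun _ => ℕ → ℕ) (fun a => f a)
    (fun j ih a => Nat.add (ih a) (ih (Nat.add a (Nat.pow 2 j)))) j a

def gtot (f : ℕ → ℕ) (a : ℕ) : ℕ :=
  Nat.add (gsum f 12 a) (Nat.add (gsum f 10 (Nat.add a 4096)) (gsum f 8 (Nat.add a 5120)))

def kpart (m : ℕ) : ℕ := gtot (fun d => Nat.mul (bt m d) (Nat.div (Nat.pow 2 60) d)) 0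

def tq (m q : ℕ) : ℕ := gsum (fun a => Nat.mul (bt m (Nat.mul q a)) (Nat.div (Nat.pow 2 40) a))
  (Nat.add (Nat.log2 (Nat.div 5306 q)) 1) 1

def sqd (x y : ℕ) : ℕ := Nat.pow (Nat.add (Nat.add (Nat.sub x y) (Nat.sub y x)) 5306) 2

def qtot (P M : ℕ) : ℕ := gtot (fun q => sqd (tq P q) (tq M q)) 2

lemma gsum_eq (f : ℕ → ℕ) (j a : ℕ) : gsum f j a = ∑ t ∈ range (2^j), f (a + t) := by
  induction j generalizing a with
  | zero => simp [gsum]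
  | succ j ih =>
    have h : gsum f (j+1) a = gsum f j a + gsum f j (a + 2^j) := rfl
    rw [h, ih, ih, pow_succ, mul_two, Finset.sum_range_add]
    simp [add_assoc]

lemma gtot_eq (f : ℕ → ℕ) (a : ℕ) : gtot f a = ∑ t ∈ range 5376, f (a + t) := by
  have h : gtot f a = gsum f 12 a + (gsum f 10 (a + 4096) + gsum f 8 (a + 5120)) := rfl
  rw [h, gsum_eq, gsum_eq, gsum_eq]
  rw [show 5376 = 4096 + (1024 + 256) from rfl, Finset.sum_range_add, Finset.sum_range_add]
  norm_num
  simp only [← add_assoc]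

lemma approx (ν : ℕ → ℤ) (hν : ∀ d, |(ν d : ℝ)| ≤ 1) (s : Finset ℕ) (c : ℕ) :
    |∑ m ∈ s, (ν m : ℝ) * ((c:ℝ) / m) - ∑ m ∈ s, (ν m : ℝ) * ((c / m : ℕ) : ℝ)| ≤ s.card := by
  rw [← Finset.sum_sub_distrib]
  refine (Finset.abs_sum_le_sum_abs _ _).trans ?_
  rw [Finset.card_eq_sum_ones]; push_cast
  apply Finset.sum_le_sum
  intro m _
  rw [← mul_sub, abs_mul]
  have h1 : |(c:ℝ) / m - ((c / m : ℕ) : ℝ)| ≤ 1 := by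
    rw [← Nat.floor_div_eq_div (K := ℝ) c m]
    have a1 := Nat.lt_floor_add_one ((c:ℝ) / m)
    have a2 := Nat.floor_le (show 0 ≤ (c:ℝ) / m by positivity)
    rw [abs_le]; constructor <;> linarith
  calc _ ≤ 1 * 1 := mul_le_mul (hν m) h1 (abs_nonneg _) zero_le_one
    _ = 1 := by norm_num

lemma nuOf_abs (P M d : ℕ) : |((nuOf P M d : ℤ) : ℝ)| ≤ 1 := by
  rw [nuOf]
  rcases bt_cases P d with h | h <;> rcases bt_cases M d with h' | h' <;> simp [h, h']

lemma sum5376 (f : ℕ → ℕ) (h0 : f 0 = 0) (h1 : ∀ d, 5307 ≤ d → f d = 0) :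
    gtot f 0 = ∑ d ∈ Icc 1 5306, f d := by
  rw [gtot_eq]
  simp only [zero_add]
  symm
  apply Finset.sum_subset
  · intro d; simp; omega
  · intro d hd hd2
    have : d = 0 ∨ 5307 ≤ d := by simp at hd2; omega
    rcases this with h | h
    · subst h; exact h0
    · exact h1 d h

lemma kpart_eq (m : ℕ) (hm0 : m % 2 = 0) (hm : m < 2^5307) :
    kpart m = ∑ d ∈ Icc 1 5306, bt m d * (2^60 / d) := by
  have h : kpart m = gtot (fun d => bt m d * (2^60 / d)) 0 := rfl
  rw [h, sum5376]
  · simp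
  · intro d hd; rw [bt_big m d hm hd]; simp

lemma kap_bound (P M : ℕ) (hP0 : P % 2 = 0) (hP : P < 2^5307) (hM0 : M % 2 = 0) (hM : M < 2^5307) :
    2^60 * |kap (nuOf P M) 5306| ≤ |(kpart P : ℝ) - kpart M| + 5306 := by
  have h := approx (nuOf P M) (nuOf_abs P M) (Icc 1 5306) (2^60)
  have e1 : ∑ m ∈ Icc 1 5306, ((nuOf P M m : ℤ) : ℝ) * (((2^60 : ℕ):ℝ) / m) = 2^60 * kap (nuOf P M) 5306 := by
    rw [kap, Finset.mul_sum]
    apply Finset.sum_congr rfl; intro d _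
    push_cast; ring
  have e2 : ∑ m ∈ Icc 1 5306, ((nuOf P M m : ℤ) : ℝ) * ((2^60 / m : ℕ) : ℝ) = (kpart P : ℝ) - kpart M := by
    rw [kpart_eq P hP0 hP, kpart_eq M hM0 hM, Nat.cast_sum, Nat.cast_sum, ← Finset.sum_sub_distrib]
    apply Finset.sum_congr rfl; intro d _
    rw [nuOf, Nat.cast_mul, Nat.cast_mul]; push_cast; ring
  rw [e1, e2, Nat.card_Icc] at h
  have h3 : |(2:ℝ)^60 * kap (nuOf P M) 5306| = 2^60 * |kap (nuOf P M) 5306| := by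
    rw [abs_mul]; norm_num
  have h4 := abs_sub_abs_le_abs_sub ((2:ℝ)^60 * kap (nuOf P M) 5306) ((kpart P : ℝ) - kpart M)
  rw [← h3]
  norm_num at h h4 ⊢
  linarith

lemma c00_eq (P M : ℕ) (hP0 : P % 2 = 0) (hP : P < 2^5307) (hM0 : M % 2 = 0) (hM : M < 2^5307)
    (h : gtot (bt P) 0 + 2 = gtot (bt M) 0) : c00 (nuOf P M) 5306 = - kap (nuOf P M) 5306 / 2 := by
  rw [sum5376 _ (bt_zero P hP0) (fun d hd => bt_big P d hP hd),
    sum5376 _ (bt_zero M hM0) (fun d hd => bt_big M d hM hd)] at h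
  have h' : (∑ d ∈ Icc 1 5306, (bt P d : ℝ)) + 2 = ∑ d ∈ Icc 1 5306, (bt M d : ℝ) := by
    rw [← Nat.cast_sum, ← Nat.cast_sum, ← h, Nat.cast_add, Nat.cast_two]
  rw [c00, kap]
  have e : ∀ d ∈ Icc 1 5306, ((nuOf P M d : ℤ) : ℝ) / d * (((d:ℝ) - 1)/2) =
      ((bt P d : ℝ) - bt M d) / 2 - ((nuOf P M d : ℤ) : ℝ) / d / 2 := by
    intro d hd
    have : (d:ℝ) ≠ 0 := by
      simp only [mem_Icc] at hd
      have : d ≠ 0 := by omega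
      exact_mod_cast this
    rw [nuOf]; push_cast; field_simp
  rw [Finset.sum_congr rfl e, Finset.sum_sub_distrib, ← Finset.sum_div, ← Finset.sum_div, Finset.sum_sub_distrib]
  linarith

lemma vq_bound (P M : ℕ) (hP : P < 2^5307) (hM : M < 2^5307) (q : ℕ) (hq : 2 ≤ q) (hq2 : q ≤ 5306) :
    2^80 * (vq (nuOf P M) 5306 q * q)^2 ≤ (sqd (tq P q) (tq M q) : ℕ) := by
  set J := 2^(Nat.log2 (5306 / q) + 1) with hJ
  have hq1 : 1 ≤ 5306 / q := (Nat.one_le_div_iff (by omega)).2 hq2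
  have hJ1 : 5306 / q < J := Nat.lt_log2_self
  have hJ2 : J ≤ 5306 := by
    rw [hJ, pow_succ]
    have h1 := Nat.log2_self_le (n := 5306 / q) (by omega)
    have h2 : 5306 / q ≤ 5306 / 2 := Nat.div_le_div_left hq (by norm_num)
    omega
  have ht : ∀ m, tq m q = ∑ a ∈ Icc 1 J, bt m (q * a) * (2^40 / a) := by
    intro m
    have h : tq m q = gsum (fun a => bt m (q * a) * (2^40 / a)) (Nat.log2 (5306/q) + 1) 1 := rfl
    rw [h, gsum_eq, ← hJ]
    rw [show Icc 1 J = Ico 1 (J+1) from rfl, Finset.sum_Ico_eq_sum_range]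
    rfl
  have hv : vq (nuOf P M) 5306 q * q = ∑ a ∈ Icc 1 J, ((nuOf P M (q * a) : ℤ) : ℝ) / a := by
    rw [vq, ← Finset.sum_filter, Finset.sum_mul]
    have e : ∑ a ∈ Icc 1 J, ((nuOf P M (q * a) : ℤ) : ℝ) / a = ∑ a ∈ Icc 1 (5306/q), ((nuOf P M (q * a) : ℤ) : ℝ) / a := by
      symm
      apply Finset.sum_subset
      · intro a; simp only [mem_Icc]; omega
      · intro a ha ha2
        simp only [mem_Icc] at ha ha2
        have : 5306 / q < a := by omega
        have h1 := Nat.lt_mul_of_div_lt this (by omega)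
        have h2 : 5307 ≤ q * a := by rw [mul_comm]; exact h1
        rw [nuOf, bt_big P _ hP h2, bt_big M _ hM h2]; simp
    rw [e]
    symm
    apply Finset.sum_bij (fun a _ => q * a)
    · intro a ha
      simp only [mem_Icc, mem_filter] at *
      refine ⟨⟨Nat.mul_pos (by omega) (by omega), ?_⟩, dvd_mul_right _ _⟩
      rw [mul_comm]; exact (Nat.le_div_iff_mul_le (by omega)).1 ha.2
    · intro a _ b _ hab
      exact Nat.eq_of_mul_eq_mul_left (by omega) hab
    · intro d hd
      simp only [mem_Icc, mem_filter] at hd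
      obtain ⟨⟨h1, h2⟩, ⟨a, rfl⟩⟩ := hd
      refine ⟨a, ?_, rfl⟩
      simp only [mem_Icc]
      refine ⟨Nat.pos_of_mul_pos_left h1, ?_⟩
      rw [Nat.le_div_iff_mul_le (by omega), mul_comm]; exact h2
    · intro a ha
      simp only [mem_Icc] at ha
      have h1 : (a:ℝ) ≠ 0 := by exact_mod_cast (show a ≠ 0 by omega)
      have h2 : (q:ℝ) ≠ 0 := by exact_mod_cast (show q ≠ 0 by omega)
      push_cast; field_simp
  have h := approx (fun a => nuOf P M (q * a)) (fun a => nuOf_abs P M _) (Icc 1 J) (2^40)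
  have e1 : ∑ m ∈ Icc 1 J, ((nuOf P M (q * m) : ℤ) : ℝ) * (((2^40 : ℕ):ℝ) / m) = 2^40 * (vq (nuOf P M) 5306 q * q) := by
    rw [hv, Finset.mul_sum]
    apply Finset.sum_congr rfl; intro d _
    push_cast; ring
  have e2 : ∑ m ∈ Icc 1 J, ((nuOf P M (q * m) : ℤ) : ℝ) * ((2^40 / m : ℕ) : ℝ) = (tq P q : ℝ) - tq M q := by
    rw [ht, ht, Nat.cast_sum, Nat.cast_sum, ← Finset.sum_sub_distrib]
    apply Finset.sum_congr rfl; intro d _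
    rw [nuOf, Nat.cast_mul, Nat.cast_mul]; push_cast; ring
  rw [e1, e2, Nat.card_Icc, Nat.add_sub_cancel] at h
  have hJ2' : (J:ℝ) ≤ 5306 := by exact_mod_cast hJ2
  generalize tq P q = x at *
  generalize tq M q = y at *
  have hs : sqd x y = ((x - y) + (y - x) + 5306)^2 := rfl
  have e3 : (((x - y : ℕ):ℝ) + ((y - x : ℕ):ℝ)) = |(x : ℝ) - y| := by
    rcases le_total x y with h | h
    · have : (x : ℝ) ≤ y := by exact_mod_cast h
      rw [Nat.sub_eq_zero_of_le h, Nat.cast_sub h, abs_sub_comm, abs_of_nonneg (by linarith)]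
      simp
    · have : (y : ℝ) ≤ x := by exact_mod_cast h
      rw [Nat.sub_eq_zero_of_le h, Nat.cast_sub h, abs_of_nonneg (by linarith)]
      simp
  rw [hs]; push_cast; rw [e3]
  set v := vq (nuOf P M) 5306 q * q with hvd
  have h4 : |(2:ℝ)^40 * v| ≤ |(x : ℝ) - y| + 5306 := by
    have := abs_sub_abs_le_abs_sub ((2:ℝ)^40 * v) ((x:ℝ) - y)
    linarith
  have h5 := pow_le_pow_left₀ (abs_nonneg _) h4 2
  rw [sq_abs] at h5
  calc (2:ℝ)^80 * v^2 = (2^40*v)^2 := by ring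
    _ ≤ _ := h5

lemma QQ_bound (P M : ℕ) (hP : P < 2^5307) (hM : M < 2^5307) (q : ℝ) (hc : |c00 (nuOf P M) 5306| ≤ 0.001)
    (h : ((qtot P M : ℕ) : ℝ) ≤ 2^80 * (12 * (q - 0.000001))) : QQ (nuOf P M) 5306 ≤ q := by
  rw [QQ]
  have h1 : ∑ q ∈ Icc 2 5306, vq (nuOf P M) 5306 q ^ 2 * (((q:ℝ)^2-1)/12) ≤
      1 / (12 * 2^80) * ((qtot P M : ℕ) : ℝ) := by
    have e : qtot P M = ∑ t ∈ range 5376, sqd (tq P (2+t)) (tq M (2+t)) := gtot_eq _ _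
    have e2 : ∑ q ∈ Icc 2 5306, sqd (tq P q) (tq M q) ≤ qtot P M := by
      rw [e, show Icc 2 5306 = Ico 2 5307 from rfl, Finset.sum_Ico_eq_sum_range]
      refine Finset.sum_le_sum_of_subset (fun d hd => ?_)
      have hd' := mem_range.1 hd
      exact mem_range.2 (by omega)
    have e3 : ((∑ q ∈ Icc 2 5306, sqd (tq P q) (tq M q) : ℕ):ℝ) ≤ qtot P M := Nat.cast_le.2 e2
    rw [Nat.cast_sum] at e3
    refine le_trans ?_ (mul_le_mul_of_nonneg_left e3 (by norm_num))
    rw [Finset.mul_sum]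
    apply Finset.sum_le_sum
    intro q hq
    simp only [mem_Icc] at hq
    have := vq_bound P M hP hM q hq.1 hq.2
    have h2 : vq (nuOf P M) 5306 q ^ 2 * (((q:ℝ)^2-1)/12) ≤ (vq (nuOf P M) 5306 q * q)^2 / 12 := by
      generalize vq (nuOf P M) 5306 q = v
      rw [mul_pow, mul_div_assoc]
      exact mul_le_mul_of_nonneg_left (by linarith) (sq_nonneg v)
    refine h2.trans ?_
    rw [one_div, inv_mul_eq_div, div_le_div_iff₀ (by norm_num) (by norm_num)]
    linarith
  have h2 : c00 (nuOf P M) 5306 ^ 2 ≤ 0.000001 := by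
    rw [← sq_abs]
    have := pow_le_pow_left₀ (abs_nonneg _) hc 2
    norm_num at this ⊢; exact this
  have h3 : 1 / (12 * 2^80) * ((qtot P M : ℕ) : ℝ) ≤ q - 0.000001 := by
    rw [one_div, inv_mul_le_iff₀ (by norm_num)]; linarith
  linarith

end PC

namespace PC

def posM : ℕ :=
  5211242600535624299764025202574014838266662780388224163812776037132742875275778398709984376016601923774912678444875856029319643874627222714543310085837521151354628364922538800513410948585997414865843323333182544009511721001491347093669198131891752625061319255623323799497797555665669268993331137353858787989259788039754780593538070884375693947865180529703346465838380092761573400433754343708477584878935726862301532092061171562150447594260499190071546836521789427499474964373154468543138376648810639936259118946268480228013983063366375234170451184045238811340797268319411156887065015214360798226187417402652089444170239250161581600196897749980462238627640603856812528797701487855590511617353318037462908148576589183941355328701487291872720207274668700681399543707392070002530646124055358293274895434729554655946665331562656546027377519344908536551480162033979447626835135637520433932419839434482694255783986788162599880135652906758207253538211816870423854940573358865502937786481312479742404020075648105255097487537507158284704014861478822765222457427362687066896670885501886303561735333516469902715914527815602062392986789480342449018802664475419688448336512706185101162149770681972883830707991933019163167419758156095344646919921701968590533260373378779197082866609318871076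122298004019568697286605012955439289583469951109397035666309461794030261574242704022500877426545563102679352585653664918822011342524454954404136028912514087277957779487237569758224299244612525210534650414571649487567557223788015685025116393866052674

def negM : ℕ :=
  1848630657706458203072755807024181189246490754800933249591113291664310209631847419383801269290178793908741241656735424146706655675096847234876896711857950973194542843856937223591672147528831189202682377668870479991602909127852377204827086800325694281951937763417279713608905841446028995282497909423823614146695999473580407930424118694556039318139250311955715813425084206231510914166015628362842349920898851566873471812188799506682105022245184353512899760371694236988580909909582105990998065258641545276826198007485572849538096876616725114451924689162098468554233882026741615365931556276962988180430524053492475195907340856153096990054223525705235867591371091112906929466358402980343987805387779569607769737312823269460919051410255373149502550904760157167979558354664804255883245980116557158614244773602115508022036268570987282952913972907885438772554517473080569377787701234474060074173397985964726195410211996400370559391456858169908105882561337941368217723237513088401273008016557339539983671019686437235323326422542706059942484382560370498975865398170339559688259608980168073215929852558792583656709676098916811914794343090971279780246485498979755904457890821946480522541575151849300675232373354605383609646499441313661691102904180692057330863592174026149636035029366925947520459325669058361876629829612533981548397020595800439148898537666031309749708395988736827152215494434142597918968746618910783497025827279583537658045034870744536167933892660415629836672055904573105217119211243201162129169115322904599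6654995234978554576197536164303626229827649927719497780683643646246706053867177350146220

lemma posM0 : posM % 2 = 0 := by decide +kernel
lemma negM0 : negM % 2 = 0 := by decide +kernel
set_option exponentiation.threshold 10000 in
lemma posM1 : posM < 2^5307 := by decide +kernel
set_option exponentiation.threshold 10000 in
lemma negM1 : negM < 2^5307 := by decide +kernel
lemma kchk1 : Nat.ble (Nat.sub (kpart posM) (kpart negM)) 0 = true := by decide +kernel
lemma kchk2 : Nat.ble (Nat.sub (kpart negM) (kpart posM)) 222000 = true := by decide +kernel
lemma cchk : Nat.beq (Nat.add (gtot (bt posM) 0) 2) (gtot (bt negM) 0) = true := by decide +kernel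
lemma qchk : Nat.ble (qtot posM negM) 2347000000000000000000000000 = true := by decide +kernel

lemma kap_small : |kap (nuOf posM negM) 5306| ≤ 0.0000000000002 := by
  have h := kap_bound posM negM posM0 posM1 negM0 negM1
  have h1 := Nat.le_of_ble_eq_true kchk1
  have h2 := Nat.le_of_ble_eq_true kchk2
  generalize kpart posM = x at *
  generalize kpart negM = y at *
  have h1' : x - y ≤ 0 := h1
  have h2' : y - x ≤ 222000 := h2
  have h3 : x ≤ y := by omega
  have h4 : y ≤ x + 222000 := by omega
  have h3' : (x:ℝ) ≤ y := by exact_mod_cast h3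
  have h4' : (y:ℝ) ≤ x + 222000 := by exact_mod_cast h4
  have h5 : |(x:ℝ) - y| ≤ 222000 := by rw [abs_le]; constructor <;> linarith
  norm_num at h ⊢
  linarith

lemma c00_small : |c00 (nuOf posM negM) 5306| ≤ 0.001 := by
  rw [c00_eq posM negM posM0 posM1 negM0 negM1 (Nat.eq_of_beq_eq_true cchk), abs_div, abs_neg]
  have := kap_small
  norm_num at this ⊢
  linarith

lemma QQ_small : QQ (nuOf posM negM) 5306 ≤ 12.72^2 := by
  apply QQ_bound posM negM posM1 negM1 _ c00_small
  have h := Nat.le_of_ble_eq_true qchk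
  generalize qtot posM negM = x at *
  have h' : (x:ℝ) ≤ (2347000000000000000000000000 : ℕ) := by exact_mod_cast h
  refine h'.trans ?_
  norm_num

lemma tail_small : ∑ k ∈ Ico (1048575+1) 12135265692, |S (nuOf posM negM) 5306 k| * mk k ≤ 0.0000586 := by
  have h := tail (nuOf posM negM) 5306 14076818 1048576 (by norm_num) (by norm_num) (by norm_num) 12.72 (by norm_num)
    QQ_small 0.0000028532 (by norm_num) (by norm_num) 430
  norm_num only at h ⊢
  refine h.trans ?_
  have := Real.pi_lt_d4
  norm_num at this ⊢
  linarith

lemma A_small (k : ℕ) (hk : k ≤ 1048576) : |1 - A (nuOf posM negM) 5306 k| ≤ 5308 := by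
  have h := S_abs_le (nuOf posM negM) 5306 (nuOf_abs _ _) k
  rw [S] at h
  have hk' : (k:ℝ) ≤ 1048576 := by exact_mod_cast hk
  have h2 : |kap (nuOf posM negM) 5306 * k| ≤ 1 := by
    rw [abs_mul, Nat.abs_cast]
    calc _ ≤ 0.0000000000002 * (1048576:ℝ) := mul_le_mul kap_small hk' (Nat.cast_nonneg _) (by norm_num)
      _ ≤ 1 := by norm_num
  generalize kap (nuOf posM negM) 5306 * k = z at *
  generalize A (nuOf posM negM) 5306 k = w at *
  have h3 : |1 - (w:ℝ)| ≤ 5308 := by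
    rw [abs_le] at *
    norm_num at h
    constructor <;> linarith
  exact_mod_cast h3

lemma cs {n X s r i X' s' r' i' : ℕ} (jp cp jn cn : ℕ) (hg : Good posM negM n X s r i)
    (hn : n + 4096 ≤ 1048576)
    (hc : chunk posM negM n X s r i X' s' r' i' jp cp jn cn = true) : Good posM negM (n + 4096) X' s' r' i' :=
  cstep posM negM posM0 posM1 negM0 negM1 A_small hn hg hc

lemma g0 : Good posM negM 0 8193 8192 0 0 := by
  refine ⟨fun _ => 0, rfl, ?_, ?_, ?_, ?_⟩
  · simp [A]
  · simp
  · simp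
  · simp

end PC

namespace PC

lemma g1 : Good posM negM 4096 8192 8192 0 0 :=
  cs 0 0
    0 0 g0 (by norm_num) (by decide +kernel)

lemma g2 : Good posM negM 8192 8192 8216 96170891616076459 33169439153214 :=
  cs 198305450383090750985663788680360319686318329059239479470333559080426098637880390358006869361788402118995576463364306714192862902267778641674764484636156503318324114414126661100451315204018781147783084271016567152308096192157140644472973148926917988734833249570645101221458973060582789060985192279526627867778859007664331823015396134146481384221537349836964683005155557507752069361896517206426546777432131110810009214133986826257677748726258825673848564519454745690038787228326841891738167738603977786026384249735544804878681304322924345216209467860665394282485145267718740549370375290139300831077461269156382807798963208658175508670016369818147177023550076314659880263666027880516208443715917156684491176914874354406598407490077674256264228894264856434823268512540412679865112463565796823264028455096911841367413374107965376850073493523569807253752161738114946427458003275371193169535764114325763314674645601686220410884613858220188311223897792345180552599476322642127080032586224550686834388204770198052313886619183498164 283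
    397185639681506828969439631554295679854577886243954568141262251661074446220689443613519163041824494232572137654722895002140762107850394254017672383689534464147172958113334676116892725688492034680449374549235652246889818250921051283284974409298643854517533632616143144188256927257197792350953475506031277856673682423495044857285914475206100641483817075182689545281905096066880396948069180531806825932324364258547249119167101247681977906690207824633079361189320764904942930899261451363497662992600068938824657834737507665695040712036030494975849137552438737441260827586443752716395577702716049001462622750073957176715934019900288737989287566258542847975047589257982196523701838486667360262881320887022923622195455773640824248138308737414660933739815420981411853751349151612365865628421123426013941995768985637024824931027339980533020391272648249745627288296802877088504723646374560847101538730877074482328152634834295267076421751035052970 259 g1 (by norm_num) (by decide +kernel)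

lemma g3 : Good posM negM 12288 8193 8210 156678278486026965 55335144409748 :=
  cs 394163433766501549855089983629231709629874018624932622662514909282897933535611915969948058628614880429062508724103707257180378356482434864637786943683263138104643998166945653481130470676528233854762841744345014157316516988516764744817231662610486095804483322335640239452058284156273795586469777098726208527039260792334357249281601000412239854360891613736640743689293797832818277934401464937788702203569729892964225817994803310243656485632995048090985128136649124057961401501214822245292703905486552225251848662598024090066724685171220275091028469709509059946025835529901750825287202189577701565634324124614667328251975314788975562821299545962454968740515676914779375982441863632636880169930036908236283003327901374076206897122621320725585182721177885898719569022849295223931160644410805366044801251077449960253474840951240464910501007695846525038559534974221682587126133440605634399305008045442194266974701484194391714135623043358367749 259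
    1873814789874459284875055198115867968983439519273605666128742410189646568892857610906386965011430724465380055091706788874685297722219116698761090771422392897456096850227898131327399931345235450272320142893034434691999388924694363034750068766655417987743979867320004709657750296991201841046267136703613016737615646282560981557623196406495003163882561983303745491588257689108162152475022577201895834009572394179703719162974691806191362992741734826042248270964703001652399716477828436191840047666636536723800197415618014062256903138679150594911784654391751220429804271189606393260286015481425221082080197813526134268921116839890431958561782282020781660183466037279159797026926333350896008057704787278699479518367515203237127383737373576124099565720927987190806808669791516467529529893204278582441444236095000041974169294453720097957274666848605152702153222285026563746487582524936038051832442826248731027299524998248978507407699928323414350056651616787596677136 265 g2 (by norm_num) (by decide +kernel)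

lemma g4 : Good posM negM 16384 8192 8197 189662905354715907 68016800384152 :=
  cs 4303758347921884582773868554649488966855632509009193927238433590890058976495182101547265704167212395152891897414062006748796987222291431397236139711487638820572872831828687164699880674186258595607395759931291451193740895974282863920839991622118444861963453806424393219737767333912418689211811640555743825778446175660138243678320209236875175602343260592107239942159044862325376991118267690280086402039146433129389823742627194152778328453773773856364313135151274791479968785730806977157599712119976872231073830121114279785620956770884411324979024403463626025406258015492316247800909584306612666616737877249014836149012422898971989452870437884900021213169789886958614212018000876737359627196846520548926002519367708 197
    389654899978974096027140144779479027079459305028167850175026686464710841151543507375326743851170732783235207413829055813579925978534502391029707857837893074603665255882440986883015735601178555939609691899613822493176589021809336400208175251767348101222168425178308804924319488762971586502618227405643463071262953429228613266138202845189124211249271754609759953829782942620098003991901674374053853041280100185769087693047280094726687620688517765721073171074357145289460997587467383264960661538017215513290647257620146594720059263692486297720965795639802457400586622779135197767623862440322110818840392502508780972570143141515422683462536413773825213739767276799674017801694908275089427467979319174683668455712782537825442842527689379987077646641517482683359284 210 g3 (by norm_num) (by decide +kernel)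

lemma g5 : Good posM negM 20480 8193 8191 210308515439042832 76975649910510 :=
  cs 387576710061633619340897381973913287403427375535611018156009179309567314032299102471471479405886117912577807445777337183863813667855456678679092764370191138712699396421414259615651470387107218008530455407488856292721217172647810675474994469241593111086130321182031993778884687608875230079016929284804981584231690090660049628646915691242611548489184937345424398614297296375653883985135924214989278130532120782094260811896986262576521502546597856608757567046153076100246445070158456065938729607917455495155238781461794631411133625838140930599021642999583590934031112725932191626240006 161
    1793492470716603055320296266265657786400854672212279719988625307426592856311417359335772126701004702025052787050966926367616011755245439472738413916282517025299580674980302984810226638148908968489974880006025869449941459423489850473448786231305651600604279535498240204857423177951442428829493081672552800547923897898846338397368154690942697484977166164865886188725162664018735054266389560897779608928752078359258449412050140097970571774973046167740232057187587899677872746157474947499201069746761586149809048294592507854509458771220169435404344344489061487264836035130468966747252751570865021448215461915 167 g4 (by norm_num) (by decide +kernel)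

lemma g6 : Good posM negM 24576 8191 8185 226842393712762940 83213885947585 :=
  cs 5639985454232819085085328125266140374105775311638233025990620524687276484764386004009394073515013756639586366496968914938260977525241676261349574501190486183385769814296411393620306538279667304307346864238026732221098434321799178601633002879529484531952641396187128448286089137809267369713716184986680257050409460669245113594408707242959779042404764789541336618748904329844119851975098421219578803100986176441096493534257669105511992480897788654137013161409470833201793899552525186851718849385043300766510589897974276013458917873802455350022705258266522783627362932715648 158
    26366197537611309317705217777278902942245823659334435569096009061513469614008365231626570282916161591081186961850771580616399312663785996011750216427341846232964534549232504021988083502116427975163640552844529876080844979277407434485171464677703858052095583778990439539379532576049785400724033497801295254826267987281261781312245840179459514931400295821389603711246048576702154840354741291810827063608887530529519956829470290737425559019898618117690917518429816472370191449424937583258476920699153364201113935360001757575065515297628685797011718187729838911031748532965657734592702784469049348 164 g5 (by norm_num) (by decide +kernel)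

lemma g7 : Good posM negM 28672 8192 8184 238122968773506224 88492591732046 :=
  cs 38937300411685526190204839271173959039662534296245072744065232399592733101378668690764398178040758664017254721395893710338085861334249990560313903671336465756542892816461238392836953032252947641826440802830377136452473604665209297912048482833059542786052226442527984750766926805111931617464188854858862007181551651715826196982732237411643697477854749916725209913584806863541502573357395136518739691828464915034149416232784321229261656269079450741091240850312327157850124 130
    165554433330929145811987604204608351398590204343169729977651218558707133317011393588379283193720806041338112896849589213814562044033676470613244785601410378448664078242573678357760962612504205408431531187148240020438610202435928429501557606511179504957815147879968805162753556839645821413343625271041976599924165313886029792043700676614462590344940837960157552321799763115875045115521541543366285555506070177329711110526531642757951269187457516924454422099096944310974603378 131 g6 (by norm_num) (by decide +kernel)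

lemma g8 : Good posM negM 32768 8192 8208 247920973215197799 92571686001046 :=
  cs 894977877264732131131913679438331651998079972777180046127494906900830562680373602922560388815084459480922937211903298062356507984334309071162894831463589873479245992254565066414015205856039953181974986958972185234831328551466379825483759795197985178389470181948310094626711206131363778988693511497827998428652760800198757194062064856209622351017273573011418773595508436901575624831662595192441210112944279622980134974367701329145220103874211522586452576721684549957035697444053921615550653709659215202598317883495 142
    1748201377198070158337199743879100401740957696521286396042783307751917350350845393974221081731093435670735500264246757155035691329704698954031282696937962443219443723495725882325221335589239595548615009375432721005242544114259975106364345839847273944599585876006167438975297434700221012725435087807681768637660391040498258455412613900210467390772571905582133917202299523847597363437385537596618742257085303940050829591718289421 118 g7 (by norm_num) (by decide +kernel)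

lemma g9 : Good posM negM 36864 8192 8198 256550119895463476 95607164381859 :=
  cs 33712167718936678186697073746961712205804044574731856075936946745589027175695637176294548313654510089141758467760115076648025364616526555923039724633519029480298136779376641934976839156345807051548289164378046998517372120674496339761193118236825352719524087384799859347073685723021515244328928271716205449733637231786829164660272089174047445896901802789024466358173760292086526568577003335650612177739050992096116207807717319557277484192894983338926201 125
    45791103489831384906782460472777225620938689552851024567272438877814044539848444622456325063374379957320131742835744725610125166436989618760015256073587013306387321187061174803391668528483038465775953471913939325941811179607140864789642085526902336657601761012484413996655709743133978329912139618130067566847808288264484159264207507468145245602196917280595852832051891136707195178887086128654132276714890745358790385669809619053127988149806822866083615397860380779411169222038229503500288 135 g8 (by norm_num) (by decide +kernel)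

lemma g10 : Good posM negM 40960 8193 8218 263360216965207363 98270782331562 :=
  cs 34663526346940851566958897733794516080853508154820649483093650713040224541136992311725953250287897546517794365412674886203488004094185219859266473585087326417274215160019242977350817255637270761671734787122737107277237365375967477413855536074816525715814513542748441704265717161218400028183158652661571943870121534421029977631266052802249531568423276496820257401514464988658203363485460971599974674171397019712893883662299754664423541830882190271352935 125
    19294061088590936813978441783843106389454392251749673436146912146086879672186891546189936880936492269909032688316643075941692855268940848291648776351939226346309412689436198181674269634275710884166718190262555311646212277388445069512913592350536856416289245933200172196437856788902705296551788513909545666999809590629697502866855964428878507946109560203782572955337974710483836933 105 g9 (by norm_num) (by decide +kernel)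

lemma g11 : Good posM negM 45056 8193 8190 270073603484404534 100547638252251 :=
  cs 93540232937914675622565666669846422322336627387082110491831311528790353099735566282399606937453762034822238389143947715654105849213452421991017001432548317260514961636785691594203490983665492168045452244680438160297716306550586126301602085741760271404395994691612896007362843872434571788237886413988474581041426603478034674698395869827518911599202986471794225035391616120644572341955573244977462272024 111
    12857002581294404973484155239181813395109053186657216614346620027801730990918839034354919910651005521695047538161663324727123195709765859443047914184893713164275687613887006538692811448726638758314428124786872144399967820489411900900943586194250434568290741182575838254170338088232633670347623055824448224039599596898320046190302234472098403206054763513506035106902848095689842418498862209563666149556141651236760531374087785874893141971465486753489451427866734357402890429640764219187482491462594322492 139 g10 (by norm_num) (by decide +kernel)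

lemma g12 : Good posM negM 49152 8192 8181 275426820662002884 102684392738772 :=
  cs 19560687555818888120877240427993321586479452868218600684399191487454903271961002087054431450957564471690668387762269653515485117603067888101379725413045537744543801007738324140595070867108600623237965823802881911067378426872190413910062296342516352828523369948738786319964817819961291514662104979867286338994218810716290294844821534972579767022513659888713241567600195888000159778 105
    6269146731128598373233450032505239620388482315820249310867344328729381019246532872036018819626448150585103939186133412814514295369489120483941717868059546463393955297731949192785056214296819835908502811237291462229492836281242968729696905060711112651011588915921647810085402776275811197892455938225474542285388385504008313891579946461071689410115843546270461596539927972714904125761353821352905789678908563427560 114 g11 (by norm_num) (by decide +kernel)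

lemma g13 : Good posM negM 53248 8193 8175 279578418827571506 104437795160998 :=
  cs 3132415050594661773029902417755526395184723605270449571770764885169547984373487446126720687952335329296937088107474634326775852447675058152113383513606755788602485147104400010739762922644281576245428586435991811415682302806689031110570809174857244271927104235712094375082325115261470235060937650681997437290301328737210460 89
    14482411308119474682501020579004775880836822230814757947224141926820233228969458101851637099506862425098282172443426678028476536612004320482401275266080518960549829477970970108682166953133233581810245740617687516353890815891939601170367657772350205534720124052179807836084086145533485711757535898475259510219805390637811175695771309638642888706 95 g12 (by norm_num) (by decide +kernel)

lemma g14 : Good posM negM 57344 8192 8187 284000759187685349 105896984220077 :=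
  cs 381072216915821379994055681458472598846945226187276709384000609772792256172989719606851034331254964367507091771179208830514185392469529209703159851413417509320808391609839811389359726195115690262011318035369131875128881934443589118752386325325087346682512513065001531501819085217239640921065405897188510550256061023450269159641013801706009668253868753061576638082761515890941753881891478908798180083851312 112
    16865274744281417975791688589281312383946555776047218183466124463805803708866283988941119886783331006899493162557479656005016540217378188865230639928602162235954402538768085298812630062626080027360295306499106057743056220431473705122839299808884600214553551350454824305325936346006210808561397465721173962190034450612196198914879490792660078269606368616983732584 100 g13 (by norm_num) (by decide +kernel)

lemma g15 : Good posM negM 61440 8194 8209 287727624274017624 107301498042930 :=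
  cs 314754169217950423759500292944514038257880917266797544786448853919354307619359305377040944912593512780123399663991151691853265028833936003550103247442504678067381149398676743866327849214510080684406884261447343010028282268465195208353620409875507372124991024620533596768445156465871469387168934684881146534379549356425820749006450769070043614798327996348576977260703372302003966992474244 107
    9836271459498767312720889736584108006581994280547606069533803518358570211365779457963042402843914956755413511961179514309072993263251455584688630634894384302470421607395061095661586946302384592090276368432881154392816221955022681437298138585073180347705016252825192009839571537716958436408811862033010147576 85 g14 (by norm_num) (by decide +kernel)

lemma g16 : Good posM negM 65536 8192 8213 291114444572565514 108373950828100 :=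
  cs 14682966748412028639312387429689779828964102235541021304399361121878928848046295693579383472822436974282408263223635646095328759011592323063844858051501627824135663775404686959934251179684837309235133514685147373802831774495541097027969855318887538392329695210763036415469161177729332533385812259077381357271265757329718447414337914908593488225 95
    43664322822531304744618904287027732736018629453900532014487416395487417630799521865167198665558905251734551026881058967207744037688755149278241585246929533802277449524878062160424943586607711834542115436103299524650222503065013441879164068544704593029280312236120725870343478428003908325758306231110350867324694336319783180496910 91 g15 (by norm_num) (by decide +kernel)

lemma g17 : Good posM negM 69632 8192 8188 294166220610661570 109573869693877 :=
  cs 141778200412426744900534908506163609735904826975590710480179270104831331897139536588216079157503122805272646591255588890082839403063058287286690923103096066343501808304148138621994752582726597839228791141424574109763356202147846344658077949531911998843535674632793794831632441821 77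
    277661600349275829046713444263363321381558196724326149374436662419213719420092150797753435849303843279942587779718458049393197334932756167797052416572986431966024388084925193540532451931431108593347859348264470881552838096446590650370904708377297118916786562148276561601585198382994654412700258925751189991033611071162839242385961161921697998873666686748274302830776320 102 g16 (by norm_num) (by decide +kernel)

lemma g18 : Good posM negM 73728 8188 8186 296933273999837664 110525235237636 :=
  cs 10316431239443449174715466084911975734212041997211522046578499582494659195766625003313490090477707653190866045659457596720229451207068427738318938252914485786516212302095066867992876805175427310041158075826356965989013462656567082233953459791721845700988177501883645598731478026365196306010015956090644086784 85
    183023924191640628651541446208170180693427612669068508329030234889464377135938277125160469154820425519592863314145583698518174289706647766220141070379136605315056083286608864047992784987655600689020851972032603215348702739722415398689962988619676884671193971467352030830214788366472641341372644539306279353930424751 87 g17 (by norm_num) (by decide +kernel)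

lemma g19 : Good posM negM 77824 8190 8164 299208952121829076 111556364819537 :=
  cs 1286750703468106729855275517965098243450997241133701789046484466903192513465784127164315001732889751925990371500753608416021668141762922394950632664934405801831946923276216091286753764058088477787565511007502903447985745017446842424 64
    45121793130134228605941329665835150117454168556665817408705589922661242263266460103870330127846863239851838876883421099470158160815214972505265071309169513442986457252433533738859733088955310632373253878063363788203250762153582166664705169497700276247590153160104772419265504461822571440089711855056037038465391 86 g18 (by norm_num) (by decide +kernel)

lemma g20 : Good posM negM 81920 8197 8207 301474681380489722 112601454000488 :=
  cs 16966157079966096741705163047301592037634328851193714184732364952692837428839321846563472536650566784688722100147245637363523534114628356942345042581929617647695091179849994563677521700648359453694245028584875132649968209396596113762968020900244416841262121249519959716656549988076144037613108897795483046611228988403473222591582057901567964462839200315219431486 100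
    75400161762708826407967857575593628790996242400836598644313037843028407948354234781083056734628567091633521954543625262859971213180040054646651580763430691997095812726727260230242855485474680686464013410654 57 g19 (by norm_num) (by decide +kernel)

lemma g21 : Good posM negM 86016 8191 8200 303140547397501564 113567494769477 :=
  cs 79106871014817163197402331090384563724460978939583581194944304086109975827606759717655584081339803974216413850165358510004997750646251912184597528203456482149972088366544684912624396185236528414298988438549 57
    1485412724683913490486246263798745998526182639727726957951972734861245423582644376172377880268303563862126894093511863818517351920830655120967445197928828294646479661502880823039141413724451178312846978542168432652348048965839691794 64 g20 (by norm_num) (by decide +kernel)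

lemma g22 : Good posM negM 90112 8189 8194 305605955808783839 114296122563779 :=
  cs 47940538651863329427806821210098592631620243124083293429593821760266471487415946233193154301725491987376370992360900494605506144127778813876220628946532711125311892121739998179336399884099419066109336203693950913263963228667681434746916223061936426733652236048168305728018857826735472407317899225562840500099909799019434802827296 91
    244504284206268997370079852079735035773184950987303350852844596411673183443282338318236760788578839336357285526852059431848525190494103541157033019585212113419710082197329133407923275467838257268205642766372783758649285008710033396096807986739989305726623298549147289602224395296755765409913957378557918738050433203563097098975518020592787804685561974 97 g21 (by norm_num) (by decide +kernel)

lemma g23 : Good posM negM 94208 8192 8213 307962443310074312 114994129765495 :=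
  cs 4824083382845090360161457808394558626693785380303314494632865129390746301994551215025713459515894675019075492304361059542364883735977250473044926421861595070568399500623830450394022078938177505023192694261353612007154855065996686607677048499769668853547559942703060586725005984611826924657269162157190569999384844846098322303667403938513158868624795097943996251595645408608304 104
    10371305207569674590499743946724180063390600150973840471709488609062060687209730608001163791509804112808113226872068819276579930323834039994004217362807727160606137698818622056406869788101435785758147306591423000542483409739207139708520917290801201664797079246373159681685555134712129244640009411441939055003 85 g22 (by norm_num) (by decide +kernel)

lemma g24 : Good posM negM 98304 8194 8211 309469864621272175 115650460715984 :=
  cs 90096679297375666091402827644238357345159701227187033970102266657171073377936661467105953451404976072828076894997227369122781327114503196627621862422645937239812838463776768861085518872721469298305226813338584780493271278253 62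
    1265520149191306524950480007129655724180425167605061984462798127179017082901386310194521267142319989239546688042780458516965360483943774897539386371740811692166246235492862753766847089963606483512175806455415844543751903583845351546 64 g23 (by norm_num) (by decide +kernel)

lemma g25 : Good posM negM 102400 8195 8191 310531745025668639 116368701020835 :=
  cs 9273370249833835101086301983371692530089773525850299504688487275323103861713614915753680720265046987268825470565503127229608374623 36
    18642937540217323264965358410820953269712798891136448855222998839798886739444042667496587764275370224147385776200615934345444171645152289856071499396602282452695796473262744822840180208757801179983118352 56 g24 (by norm_num) (by decide +kernel)

lemma g26 : Good posM negM 106496 8193 8202 311648794636256389 117000460276154 :=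
  cs 17552233649661587384447527035635638389610160217843604593700068611419129685922320330714770258889658811995227407973374681766514070387699276924461926041222575919514691940462323867415101781349154668722491681 56
    3403133113018837667645597512936729451385468373743783373664632630997565478452475752710505307148843841913560300652759557230448021378112215885737983299817229206986884 45 g25 (by norm_num) (by decide +kernel)

lemma g27 : Good posM negM 110592 8192 8210 313326668311618630 117557894669362 :=
  cs 637148465924520151512138059248275112852199913438999698064927806030720655637538715562251146703787451992899257472159059489085924071525276539615261150074344167199668286188421679981080233854194501934945134370485080811451329624679572454803554738559783541824701673292138040105022196450764123243962012131846 83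
    8411086222225820327589068805437256867623868962079847888501943058663411056364574630064276822762639631188680353604642016009686998437455731016226045943664964669438251828876162211273891825599097472390326941443402866805173213621412303815980242742840806823263490442956267577468 75 g26 (by norm_num) (by decide +kernel)

lemma g28 : Good posM negM 114688 8191 8208 314983526436690495 118100079694810 :=
  cs 9452595295531983845249953774225968776343706756158867890358244685666092653405166438816290367078070895323128614139298276487412490416617694031880924516655055758465611529267314983873278291911186454556773076136087450310251109920455834187067150826570808884616162942517045856722733701295944503463 80
    103090342629666361338395858345221633767767438864977086077130680980558830822057895645913050282430180053806080082275579922781770801734059154046528475815864783353266269793518970886170890593794703842751579573356220431725268287499840923818613094514305355673607774907205118771482300701981823521626615808 82 g27 (by norm_num) (by decide +kernel)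

lemma g29 : Good posM negM 118784 8193 8195 316260411633362575 118628216365278 :=
  cs 326429760259900372306460572543044078619133003033860490459851652363979527523618968623007068651373931901836903021058809783300176139393636112406564069060158755214231685937791798006116361062802933169916376945561864 58
    25564050103848401883826697764756261931752699874155674569220879895303967554618163977340003104177221485200671095819422772218878838937827925642751911322672089870932467690924247645784516767691909754830871054135740534236767715574377086489127001080708347350773828 71 g28 (by norm_num) (by decide +kernel)

lemma g30 : Good posM negM 122880 8194 8187 317462433077689648 119215028469934 :=
  cs 1292662903126532453980746307248670471850836228680184144306357126211282179066189731767585757579826173700370463502633428523072607753887832941076528769078068577461675328997650451966942799695174640728417578205179568311 59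
    97699832442854820573308645116476644916335197658747182684091700733074222390352170678812500527591468647068864196894650960142397407987937399184712731981019227762169523131250513235841322539136207441059697582779330031410505408312993703504238563632 67 g29 (by norm_num) (by decide +kernel)

lemma g31 : Good posM negM 126976 8192 8197 318292082991907102 119768628687307 :=
  cs 4059329500210804589376466338664130795047004658667883123949604244079056570763923939142872381509005049755165360652598967647556862780815422334552330194888069402036648832807464593657952 50
    2617846509785629902957680208557782843118768709907226225853209410324481704295766782277748908378947691344414514428257057206027032975865246474637862 40 g30 (by norm_num) (by decide +kernel)

lemma g32 : Good posM negM 131072 8192 8205 318972314395570796 120285859357528 :=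
  cs 52144030033082770622379304008801334131069546807573346426526102126880917348657747069966895985845178570561662876320329038863529985371218274744988644483076 42
    592125291462053501943690266696931194436042016138892594558385693003505639458671091836120018204315565241879722160791617601807 34 g31 (by norm_num) (by decide +kernel)

lemma g33 : Good posM negM 135168 8194 8209 319856738317989753 120834064597687 :=
  cs 260293069513468460461196478353006467557875762880377870509906907254505292989043882190396442750793883372940263847930286410730001243839732016826295473236349328098651812917746917119617211736059918 53
    581862798016655106944565289765005510494093193389375910578344239245433666309010177324324470738231976616955123014907163366047796518063090699113080635552157592796655107053154336991 49 g32 (by norm_num) (by decide +kernel)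

lemma g34 : Good posM negM 139264 8195 8204 320738803038006766 121310807111503 :=
  cs 4047170737191009630053992742734834773171272764873878460572959636713461974829765003719607220872405290962674481010259486141913020452948050753255621010967903348687634405406071694320124 50
    3664858204576067480351290602623022115541670485323732472676708623785187477108378542534419556114218216385822780725151994109386615785217374098297619107340452671991429848103658498536297843631398802513931 55 g33 (by norm_num) (by decide +kernel)

lemma g35 : Good posM negM 143360 8192 8192 321425999895089597 121706220490704 :=
  cs 10660045737174889404374269773902246575478519725424923966019073434801754481037189179077191037683946799516347788079281327370205876525 36
    178174378592126666337902050164873053287532273989371319224324050257358395620376987840686289954813613324210109330646812665666781758426445357897068005746674189303827699068964896 48 g34 (by norm_num) (by decide +kernel)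

lemma g36 : Good posM negM 147456 8191 8170 322395122713276298 122046438247247 :=
  cs 3474649290551091935059877642785193940257045473011030547876496176700140134532534432881324928421248144474835529990352789412107468044907498409096925859691637198047311214293223562961316 50
    122972853838475543581390116550582186181768926029307838445264497859834600727704430086720753303753918098681068161358918272165758233625240163475451257007680549585797420411631457883748058901870659392572800754541941132378379847941151109041743328155952734050886164622 72 g35 (by norm_num) (by decide +kernel)

lemma g37 : Good posM negM 151552 8192 8172 323166020209535264 122363612185564 :=
  cs 13273380170640603352275025583627055837677830034251516711094886613725354621208873384957001845423098733948708348964394168592369680179657462774195580816675577524477274021799699565164208418 51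
    995253066050334967174349124203403398000699473868783871971761595847881082516659151456896352754966257645717978001106180438680748802246484807274260105767644624489876603562997888394 49 g36 (by norm_num) (by decide +kernel)

lemma g38 : Good posM negM 155648 8194 8179 323849623068877180 122695506281284 :=
  cs 725101580746469932988274843960156396870468160368861086308193684638217738570535894353498045561997936224811252618837630525716994686551741541549042909439867083053391818411778126059 49
    52028231803927423232746535509510245964009333141145769730838395238521102895219549350775555205477508537345992823028318218296342643365512478272009007226930 42 g37 (by norm_num) (by decide +kernel)

lemma g39 : Good posM negM 159744 8193 8201 324918869225816041 123027288598712 :=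
  cs 2645931872097047100156361241065966645301332986400644000582574116939125799872921221750796282423050319866844448026647522791270397849969391310992569438067960778214372878372275831770571690933603080973510535828717567009622607741107613401126363923192018871892928265742260122861908563471830073955425973385298233 84
    84582913072162268931823908783703797676258678203192699320878537670789560814076144368900029028686754671407871156934964100341078630426445300839503741780273876904813109146425177159665386636115681263053126591570403149121692155912 62 g38 (by norm_num) (by decide +kernel)

lemma g40 : Good posM negM 163840 8194 8204 325439595485281392 123331049548697 :=
  cs 172800970132782029552028405250414867416616866708175837788576379112834633850749833918849417996367300151154307185153706857667528832628499114 38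
    2677820690591205028341566131465355565155802023711612432561139529974285988816993786533764184297822583374072034758424413081853990 35 g39 (by norm_num) (by decide +kernel)

lemma g41 : Good posM negM 167936 8190 8170 326329636358951892 123627227053647 :=
  cs 38824325242726702881038025224937361301884262229798957385278257315526200269735585189208975822850703274342757505193484430896160067442813356281147038926177402900207556858872 47
    36845854261653446857987345214364932197730391764314688760914988858075070952151922959142783669461027496940871924905798879342324163679562733239336849468896895752131019080554970684919719770144397337665875813478250524198501223832853859912298945006027518877340776846446868552212776392483538917679109 81 g40 (by norm_num) (by decide +kernel)

lemma g42 : Good posM negM 172032 8189 8192 326832561202766514 123914628689945 :=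
  cs 244853900538061458871647177637262073307903375938730105806791864105293104416219838643988761574132828736658024790542038014900641665347207437809360657152318010261725644018925625 48
    7844502673352764049159079465075168690646080956262832490057310069071264696497290515665203151915 26 g41 (by norm_num) (by decide +kernel)

lemma g43 : Good posM negM 176128 8191 8192 327588966398531006 124161694088329 :=
  cs 71030865076272837105021458467991866898017568886043872819368049094827251864971700285253309236907343290887655436948699056493363304775069263470775259106164860289795858920237240132683303406193321672873768677382 57
    78754074853874339953187219500028939589510346568725417238830682374830260406326683827771021423128984932870843523075550819197574833807716458562472727326596479825567042620590450789547015552338124117864503541942 57 g42 (by norm_num) (by decide +kernel)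

lemma g44 : Good posM negM 180224 8192 8171 328190940946508450 124409727935345 :=
  cs 6464822351428151053239841405684867103122289373548399290150313073430375091480601689583856053453313899608427330095202141694096163867 36
    74932012746258214506257006407399632911687090514984086000350400061559047646292668263976311654417754790516797450831373029716476355457618108570598633972559763644216015975798022910952031067012104175541668794429 57 g43 (by norm_num) (by decide +kernel)

lemma g45 : Good posM negM 184320 8192 8196 329034223563960208 124646190559411 :=
  cs 2107896114397547807258640218735873999420839728850741862750453219431258415793929283685390456020849017377806793287340358815045621482864678057339669444166961726641782546900985090793840160014532008014946531433159921968672910271848554698046834707680927297427551413460132323151064451342090675 79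
    1156575423733499591510090289413416163410247796246009901637520816441257446567457600703618439759207797320882733500030327867086871473668759001134123657745105700363973923693977130647697992584550981642 54 g44 (by norm_num) (by decide +kernel)

lemma g46 : Good posM negM 188416 8192 8208 329751188078913776 124984545951837 :=
  cs 1471384166588838236606914983621964991892538721181576535325994179522664627724687805347000344098644521031557603205488311438617108319934226633830034642139328557147283671564281464059800306018634540986284407922810796392338481607792779734 64
    69600281056045098503605675005929843714730350119445247213592332999746648533954462045777090830181640369384920187134870636231727662384966831551037442023969277164084304381416628130198031773712 52 g45 (by norm_num) (by decide +kernel)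

lemma g47 : Good posM negM 192512 8192 8198 330479209490677186 125242216511841 :=
  cs 4136840433311388696272942670965197881796125459030072930769178730648341431253301935347314774096445636890152008797380675520425053970176387441312017829169654738111345942195360023596325813450781555254549 55
    6060957455974027110638671248222406609572978832243306712525856996344282661802061883210919661749531804736020113318359382927599963074486574261305151315597735717397714640678360695844753036236534422626790557286955246420600145394104029732864 65 g46 (by norm_num) (by decide +kernel)

lemma g48 : Good posM negM 196608 8192 8213 331065647655338754 125465943344803 :=
  cs 79734066846860013879076833997038413139555313616936420211977187618628859449720652243266138045762975264952631427983096758190896756945599462645084355652813586495188168983343625424834129477554696444326328402623 57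
    44365836761666850338666569016071284831585034642084858027166475363347228134463197169024130858673565432755848832890788640674902497670980861284552469266530 42 g47 (by norm_num) (by decide +kernel)

lemma g49 : Good posM negM 200704 8187 8195 331449613027323697 125712952941428 :=
  cs 471200710530218257653354701030081603151840443712484524720085438091553663279174726817352 24
    28725888580098899873316299421465535626284961080632536798405932793973424271647856409558541501327727264061856279083170297005769595947729556485802111828212 42 g48 (by norm_num) (by decide +kernel)

lemma g50 : Good posM negM 204800 8192 8196 331773751315142406 125950652040187 :=
  cs 569594025020109623011940901750099453423723027052042462628699133053769245705079271647251182365828914356352 29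
    107577441452173263503008607170597540404274891234069249632609891417188587506358057975656610273515701017 28 g49 (by norm_num) (by decide +kernel)

lemma g51 : Good posM negM 208896 8191 8202 332419966654743539 126223950047968 :=
  cs 22189331663645335470452209135290521340915336771725316129789206433048795674696339423152568621792838827785788446951935869547845061771315638269287529031440390293818843493216452314952051016633077280691468421570970737268858904 61
    4237314507904200210433258023719809648004803589230866309416614046423157748504158301966673287458486182802950238077348174460134051746641703149551125118939773073624307404745645912792459385914624414679704 55 g50 (by norm_num) (by decide +kernel)

lemma g52 : Good posM negM 212992 8199 8219 333102945245786763 126410692417470 :=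
  cs 29611924929930431535125708062860510123892079089641887122091462888228033339166872628939866404120452197352600429787706236116965459708667964144031270325812370725209610872740743580991141135564072342699253716371504532815910323662191129830522779380060932362694768 71
    677117368710005274451350983934468743875622073329545846820584658642094213914191942903227058039377628827899194157858003325885996947517265294277350271289451084866592032417354848382770010837274313326 54 g51 (by norm_num) (by decide +kernel)

lemma g53 : Good posM negM 217088 8195 8198 333719212343135978 126605556240238 :=
  cs 59601840224181603018215206544744282185570122020324135313497060460449765445601204345519605192613724101186020220325770417561461029521016176146932325194286443736220427118592 47
    401459032983607612837114789348511923127906226888364756877001073803282208023514328505640698867644577483019969713481565222901221681070664433182600608347842467870578940911329791696391270222310091289336814806926999932025535567818584505602008085766345 68 g52 (by norm_num) (by decide +kernel)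

lemma g54 : Good posM negM 221184 8193 8187 334050686639073299 126876627694361 :=
  cs 8284610392411862054602132467350192870536111062848900658950368041575335979917440751000179741416 26
    41821898825705434551219047454514709200478448923734157078933988880794366701061899296108838998480407265009296626464510906203121541882132 37 g53 (by norm_num) (by decide +kernel)

lemma g55 : Good posM negM 225280 8193 8201 334453589462429727 127085029425877 :=
  cs 14378383446172646924575168154311519074475438400404997823595611459233853203233400454126374509713882528654848287283017347639236891615245894469385438794697562608985137397 46
    20639143748021354341274770495373946906084540465356682105490620742594195544491450956847426428835299858837637580785291 32 g54 (by norm_num) (by decide +kernel)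

lemma g56 : Good posM negM 229376 8192 8210 334924874569210210 127309904374374 :=
  cs 16452696474772561553353711277518266580635723027130308005659148988355950512364959784929456761115380528749218187217292204706520310333114570767571826164289246717694969335172977140653564036 51
    39200719786337731340129017288289025146453776192047432452246584125086630574144910319444949381260132830980871493075899563228556365358389464549622009385428 42 g55 (by norm_num) (by decide +kernel)

lemma g57 : Good posM negM 233472 8191 8183 335448383253172905 127489712781315 :=
  cs 624047048472635335734710205103001927198838344141038926918919161338644728233632918017064399947903403939381852390988891902977889440317206156794 39
    25614325269661194465496058317791126724353167758342124860456665356464361702563035829232614648543010887408896738212974161026837240034406408163388606891849008993332914114640390689196346424458436365656087624759216430090272344714200385558905077 66 g56 (by norm_num) (by decide +kernel)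

lemma g58 : Good posM negM 237568 8195 8203 335810248955404364 127667859161906 :=
  cs 59321701839807907202688240415045568591319239438749537845692089592614609527714628848494908234297572970644828495241971892350173819569587198856461340362744408636364514013344 47
    30712271013680240773670362439630596093660421466173846124263464830387190349060726223388271371936458 27 g57 (by norm_num) (by decide +kernel)

lemma g59 : Good posM negM 241664 8191 8205 336175817043647088 127858044984252 :=
  cs 635586612836952726908745933982433417830269580350739547415622503496776282670329575474832311091043868335726433342375718628142081386316497745459 39
    45193619547521714771422963243101949812242971942206268497369326489187864662668241694241412028305983886174867192507664439959502999130278 37 g58 (by norm_num) (by decide +kernel)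

lemma g60 : Good posM negM 245760 8194 8199 336498124399484680 128056644545412 :=
  cs 8769248670941136403718831895860731382487916185729244963007307905464851726050765655519085276546602656648483332732 31
    29452923851681431313839338343419426559667350333874764876792688977349716614326342363296107828041401626795201263600391983384570030555158 37 g59 (by norm_num) (by decide +kernel)

lemma g61 : Good posM negM 249856 8194 8196 336847264677952735 128261402456109 :=
  cs 10865882704228926038008813660679839274019142129551741857147880795740229757737196873849717832653570588289585657819640162790573015332 36
    525219598979599611456411631140147039159692253714470032898889620581659877915842331871065682268691892609916418686788384380814756768789068603406 39 g60 (by norm_num) (by decide +kernel)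

lemma g62 : Good posM negM 253952 8191 8187 337363983896362602 128422873467103 :=
  cs 58396941076449975426501320542099085657006737927534724007665122401795163649802446078272922485094306933314204530457017828927340038973517007963549339281179514483023422573041573838957011857870 52
    22277642711089379018274334818404031518202186425109636665848564849624549038720968941942311858119080584684510308873168490463268333149182043860984588827901626256022215387725090664397218719438420179130232282030619053968753958 61 g61 (by norm_num) (by decide +kernel)

lemma g63 : Good posM negM 258048 8194 8209 337679345573367995 128627084796596 :=
  cs 14025614133383376250825972104075270338397282823287784865604868873383119778249808618788554774580355018486766345294906593929799779229210163580542634859424567214444826856 46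
    293407402526679143988914226130966461626219123499123439710995872796959166234859505181501 24 g62 (by norm_num) (by decide +kernel)

lemma g64 : Good posM negM 262144 8192 8204 337932672253212376 128798154577732 :=
  cs 5684690387370763844113200243170889956866837970419487771048323415385304207844983174678722824160 26
    4058942843053475926671192768310334890016636411500354316974030784112400549543211504933025881358101504610040778807 31 g63 (by norm_num) (by decide +kernel)

lemma g65 : Good posM negM 266240 8192 8211 338312319417041749 128959898401211 :=
  cs 60000008536347195105161537480471953636214461532438534776356850031567586735639882789483695351372583876693921232745865153429636915146426265345478896129238452279788131193823 47
    2530171288845810754555302422584905368477820137416573524491302274621997478152019314485907434179339694012934088235676855389140812807081823330893824 40 g64 (by norm_num) (by decide +kernel)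

lemma g66 : Good posM negM 270336 8183 8197 338897096463798810 129108800850681 :=
  cs 20721846251180496985458426813353110680764133195061535904296403824700335695636807854642560221912891318975662692349114730284084700527534196244795728350030970351077012102436839851952271989717512675192311556420827343523389506 61
    6669262386181783631145950169699206193334285866226120366164181661476993832042003402741000101081350082444173834632837228973029374281210819709166022833593854863247652502098930380807318393997605585519391648958274199978858096041082809939998943441736735725438913667256286953914 75 g65 (by norm_num) (by decide +kernel)

lemma g67 : Good posM negM 274432 8192 8197 339142524172456367 129288705080170 :=
  cs 497341165354678509533349863030321434859817196874639095105616903424916209522621104188815834714081541959813 29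
    540153237622585576662852497994433572125410675937212274110807933311734626840166546692407443093097196307652 29 g66 (by norm_num) (by decide +kernel)

lemma g68 : Good posM negM 278528 8194 8189 339426265750571865 129457080338601 :=
  cs 1885714556939365943072007512288675329674990898782557049219166783989712923590220314185588982855155510581444682 30
    184616625510340601267131367163749163905484217452016130571894933310730914955965864728578387141841454627191486847497181737617669698910404988 38 g67 (by norm_num) (by decide +kernel)

lemma g69 : Good posM negM 282624 8195 8186 339915483208839086 129598804306689 :=
  cs 322897802571216030689570280031676835741268130676996203815453547521434225019599787456879648699422377928424763692308059082369235452922629281730743749371410073649880378042580599749712221674190840110775931928478246 58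
    18024032302280878231222884590720193052590997730286147863820577231986814384331076434493943338773461985927142953251930836812042194933358635096478316335094795020214446672555561577821700572106096128763816906155920220162719764 61 g68 (by norm_num) (by decide +kernel)

lemma g70 : Good posM negM 286720 8191 8192 340158719907185764 129759445991014 :=
  cs 141369500640380624724117833854994193256078130752253721689853667902966525073191881012639959419715125186260601844986953890 33
    32047617100701929102192752294039881966429237285344941530475917563966584153702160606628609788724206 27 g69 (by norm_num) (by decide +kernel)

lemma g71 : Good posM negM 290816 8185 8197 340490554610939480 129946457864057 :=
  cs 662614640593793934222246142237166033714935048721853960219522001757128156373168840662186511311085013041781030450535121541910923582329521312994645327130153951352 44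
    725107482834217861919715969385842182800333007786374924276019463379141110490498887003636260312993065968615720942313842923292554547186477199780 39 g70 (by norm_num) (by decide +kernel)

lemma g72 : Good posM negM 294912 8192 8191 340836691302169122 130078691189963 :=
  cs 9439349586160871665335973442230186579674046368278393078043635158376300919637077716369704875109032197553529616480584288810134191565531040195075682378 41
    60368649556401311666863641838719451376055495693157883969289681497724622794262352612256983444723080383107213050444603120357823249972455209048133106635113344445889383944542 47 g71 (by norm_num) (by decide +kernel)

lemma g73 : Good posM negM 299008 8191 8210 341057787804188823 130204865844674 :=
  cs 184525769448340716387062194305078839549979543996463003012628452129718496911941775736581222940505933395525235373888983251049873805037232854 38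
    227740543900790931543755688287872918893295377623409817378191354912773 19 g72 (by norm_num) (by decide +kernel)

lemma g74 : Good posM negM 303104 8191 8207 341436353841711214 130312981943344 :=
  cs 220996633539690991884789744701850360110808942605139844865382995521081671253930614330040876669910611167854265300173232882796142647651783102732913261706382812708502468916622127 48
    16602106406322111289397901283030977310793658593906126180958908211817429342263166358975029490553580426313313193142409562963200480700523391859645918614748835061662042375434152921502314812 51 g73 (by norm_num) (by decide +kernel)

lemma g75 : Good posM negM 307200 8193 8191 341836450304981194 130463438794184 :=
  cs 2631447431457112268849184900230828359723292074223887912079241787467221298865131336829110430351738936624627573726665347435914482760143111529078374930498049080920083 45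
    21195746514093025226390691340552395791677755478493107417546317729216568024163852377170962237128578298355401555558044295694787326847285366208472574795733443134587534572538978530043884282128099298877895944965651341568713554 61 g74 (by norm_num) (by decide +kernel)

lemma g76 : Good posM negM 311296 8195 8181 342119947939897310 130571656571023 :=
  cs 153232391094657674032103000129403226931602502893532233566415437054163415714555187929786193094136679557980643928194728511 33
    176753820211804545449763290115293286619112217657421516976499661359738887962581640211980674520097258741995788159983524201712478631672956351870973292837036086 43 g75 (by norm_num) (by decide +kernel)

lemma g77 : Good posM negM 315392 8195 8185 342407506406300143 130696839738398 :=
  cs 7503391338060644943310251468362542361176510588199560113466663629901596429446535533728416930087317989422468031957700003975348508772275529301799374952 41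
    40656838591905933249765284426747584639856555645887667084545747130964802579577928603089828817189005508332829615058554270669230315504592 37 g76 (by norm_num) (by decide +kernel)

lemma g78 : Good posM negM 319488 8192 8186 342622144265130805 130842726913153 :=
  cs 1464182630748297666601748196034670230051960629684739005956965323024424507531244303540448594486944261131363045 30
    476341644193455710145113776823558837427456382838948869364821975543879414115779483049747631506169132298316 29 g77 (by norm_num) (by decide +kernel)

lemma g79 : Good posM negM 323584 8192 8187 342840831019105801 130950636127049 :=
  cs 9584390809865456660731090976735405130048631428967770843073465366530179421720102340085480851377058585479726121826 31
    2018770805928204191355428912228971374004292428530077616177699783718951870163653571769846312316068882440146944 30 g78 (by norm_num) (by decide +kernel)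

lemma g80 : Good posM negM 327680 8193 8191 343017719760221416 131093029517548 :=
  cs 27081881577057381644992845598563272765624890078389288781016734876393446093103774268260443788550240 27
    117799149402882088097826692351245261923220209362040292786504249653197344568781825210 23 g79 (by norm_num) (by decide +kernel)

lemma g81 : Good posM negM 331776 8194 8193 343206486774245025 131212696352478 :=
  cs 112260668486698222585461035464972643567630444119592963489971175300717859684302488294617940138038378811 28
    7783338857156505979972253259183393513866422588181761558740399124879218277724806499247103656634 26 g80 (by norm_num) (by decide +kernel)

lemma g82 : Good posM negM 335872 8192 8181 343392934675106436 131317421425266 :=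
  cs 6796921290117641622635296180201217141494707839173364857110221586066879779379 21
    131909651458060683511354253262214561686325791885902029348269669429067017690898419645190954019718868670623707576010342540 33 g81 (by norm_num) (by decide +kernel)

lemma g83 : Good posM negM 339968 8194 8192 343581079200300220 131445008322236 :=
  cs 159222967205701254900894235755416539663341152199891892461512229705526312818918370180968998084939346257311181405966974978 33
    20550869068211896559869402765499357170920520290332056293842617832766172669965185 22 g82 (by norm_num) (by decide +kernel)

lemma g84 : Good posM negM 344064 8192 8187 343732855447757272 131581642865324 :=
  cs 1766274868610854064122248292944696956553049757129544868372455285265875153 20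
    1768909039301527771916609895133814093911955635750321978607907826281567417119698877038477944 25 g83 (by norm_num) (by decide +kernel)

lemma g85 : Good posM negM 348160 8201 8203 343952502575736391 131713163157412 :=
  cs 11687557466289713376486313398941886322755397028715900910369802410901347639782088122564294658526879917370722817262152078889341299950897998639736603659 41
    1608735859062921143575004094031542509511739963296026275751007699184841962816501097144033856 25 g84 (by norm_num) (by decide +kernel)

lemma g86 : Good posM negM 352256 8189 8189 344064543523172997 131846359859741 :=
  cs 1143224558595857945440481641920480702 10
    489668788879787205696044293905901959112954273922601324035546025231717389261677945438304 24 g85 (by norm_num) (by decide +kernel)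

lemma g87 : Good posM negM 356352 8191 8185 344233675613041716 131971829610881 :=
  cs 487236835470080700060334335679784266980636505190604696106489678421570686539776028111308 24
    116977987770591510218620637314371402404958262654434216589535253836474830902489263945798177935541739644 28 g86 (by norm_num) (by decide +kernel)

lemma g88 : Good posM negM 360448 8192 8173 344452478769225557 132069427603258 :=
  cs 124532640600631963929929342019826998401970761359708647841702771642585036514015077963601030768067121218 28
    2290039762788297846233337844882874494074612841683798751889429225089052376240860376065402451717097841076239855487487555718350413615333088913327310 40 g87 (by norm_num) (by decide +kernel)

lemma g89 : Good posM negM 364544 8194 8189 344866244648023242 132170592591714 :=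
  cs 471462354973847008947470011503125666947079313062345585717299248633937897183355724680643820576653360727162203082405468654339342489972230831137594091654978516976159036223348402749741002773631158505935555682524745070325620758730825349270445721132191564674246457315364 73
    60447343897724781770474124358031218612039954828133648353382131198753746758348528185482684669928588694482019649140415412247400099735563391699589387891130428099483408760792483915410448464380264009715589076484 57 g88 (by norm_num) (by decide +kernel)

lemma g90 : Good posM negM 368640 8190 8182 345045521533989764 132287873843216 :=
  cs 1895263027045525865428310529183112197138904059147993158868575660976281290347604016688111998 25
    30097500288155277255809785787554116781114145332465400129473387171907984516385924107159844252998388512025495598601872 32 g89 (by norm_num) (by decide +kernel)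

lemma g91 : Good posM negM 372736 8193 8180 345269604920679349 132393174095508 :=
  cs 1448727159343426800847299833000206405986469764109633532508240219968276054393660122853516347979970122745687864033805753306468642 35
    41443648266821448945514435008901014797639872508532799570212714946582344402406196658247646789069741198556113755439968276493919357920611 37 g90 (by norm_num) (by decide +kernel)

lemma g92 : Good posM negM 376832 8191 8186 345706054907738971 132496094934513 :=
  cs 1833849728577117156774535258157970555018945001896905845371666138080389569283496141787066242545878874060314596052030625898621131448568685454787028066651317662252586561387336527940143750009330772422670256188291896988297553111445066836943614873162546076691250420708192619 74
    436888149303435143240766320617120185098711739791026437889201053333374085003075510536773244093882769542739435601873497285989375023956333240134486134975391245599128503586104118051139764701780255909609075455941461720818225706936214237801369101746196 68 g91 (by norm_num) (by decide +kernel)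

lemma g93 : Good posM negM 380928 8192 8194 345858334576730902 132573062998400 :=
  cs 553071463616536597657429625416971379250174426206866299017449641924721781620898255185780980174501903041079 29
    5441126560086473807275604711122441890622005498799777639045012538641205968899 21 g92 (by norm_num) (by decide +kernel)

lemma g94 : Good posM negM 385024 8194 8194 346020644765997019 132670905752195 :=
  cs 34008863571166083176310439205133479889063231860134110338849459828892231992434895178993851780621197 27
    29660744760243745494003950987571100350794839598834297639033726841276189468857746497681488328147425 27 g93 (by norm_num) (by decide +kernel)

lemma g95 : Good posM negM 389120 8190 8199 346225963444918951 132767287351151 :=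
  cs 33169189579443382588449737861259396177154568622697680606793352706925728604601655866903005442288041470036501682389538335099377120591906 37
    36909847719822184293015411455667120976338506771835393739123194688124326510470953077566491338502877225961537354822662 32 g94 (by norm_num) (by decide +kernel)

lemma g96 : Good posM negM 393216 8193 8205 346385276017003285 132847669121905 :=
  cs 2017050958242384130086552302001840700245173688395301336425786497701612666833585150073928899817662072795699072 30
    158851845527492157249898244119363795765819432971047492157965946605610532731083514737095 24 g95 (by norm_num) (by decide +kernel)

lemma g97 : Good posM negM 397312 8189 8202 346522491514324628 132956417633431 :=
  cs 25437044280077200741833125470911977246092460259266314975560638034740057157667128 22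
    2016381903898702991609825224887415408181146577959899187393042857516245525606374819363258734 25 g96 (by norm_num) (by decide +kernel)

lemma g98 : Good posM negM 401408 8179 8196 346655534362685443 133063556870874 :=
  cs 1158050254972332285458544929497247223422539468711733657673860936390763903 20
    2100695464490791693001612726377978550122879359661432330541558129599401289721316227191771103647 26 g97 (by norm_num) (by decide +kernel)

lemma g99 : Good posM negM 405504 8192 8203 346789671420436072 133161543031383 :=
  cs 29159796872945753376920043663771724411117996003918298491682575828735373467051856985868186626807797 27
    1764689425929428903393988878576182265707528542976671782600090556738991454 20 g98 (by norm_num) (by decide +kernel)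

lemma g100 : Good posM negM 409600 8202 8207 347033032218225667 133267792801678 :=
  cs 3492780510167755819710039130405903666425634124657698199872202667264490224170409476578689275262162214879473070811526177070707876753026960365408258138226421574853862 45
    8480739511790144609635669590016959720271471034081514908520344048149298253607958115605418828234734575671069182967796763401526112819876853587334144002 41 g99 (by norm_num) (by decide +kernel)

lemma g101 : Good posM negM 413696 8195 8204 347198210655538260 133379971394027 :=
  cs 129865533091983134318274179324424097039262984960141596242293573282156226160467970441424762761866732780 28
    6006689287374254664291453873756581072380469693354695815631622337972498124995650255978537391609438271295017943288 31 g100 (by norm_num) (by decide +kernel)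

lemma g102 : Good posM negM 417792 8192 8197 347322968169340128 133476030534907 :=
  cs 360676931018879227164002913743984741021220230402282940997274949867124 19
    8247935287185132386290725106885665939761727540162177265284542997767810023283836194465281081952 26 g101 (by norm_num) (by decide +kernel)

lemma g103 : Good posM negM 421888 8197 8195 347460415535775333 133578039764339 :=
  cs 443036611362625524702255179185624265173019694938639516110477571792533211239465421103680 24
    5745839272457733938318131178555314097121228181432769634372046687890668871930524228476020916336 26 g102 (by norm_num) (by decide +kernel)

lemma g104 : Good posM negM 425984 8199 8199 347612636564397977 133668907513975 :=
  cs 2213765514620073067465594666556582722232115071145359310025315445508610355270704098003346288939795137771054006 30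
    6548610527340324912402263931117705687584637414300987714969074100821966066445828954379314127260 26 g103 (by norm_num) (by decide +kernel)

lemma g105 : Good posM negM 430080 8185 8195 347806295429637530 133756371669523 :=
  cs 514638853608070448330146437531133421852955874150831918728910934848053456745050475996645587743017654128965458836346491238811 34
    177937208379226462042299377364653567589764551861458676823476919757693674722907102674150731176224129868716897602885397339504976449268039902 38 g104 (by norm_num) (by decide +kernel)

lemma g106 : Good posM negM 434176 8198 8203 348046481558328426 133839084121666 :=
  cs 982141353006867818487577725827811196931787100851992544440979204819693922485316657162691660884236485657750986625276955821849191731256694799843954084560797225780188364412946396388 49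
    9439337436125286079544999791366420080734986035015588432259192127689233266680797060149053113305391453268026180326676887820722748850329403061230850546 41 g105 (by norm_num) (by decide +kernel)

lemma g107 : Good posM negM 438272 8194 8203 348157454494886119 133925940041085 :=
  cs 6452146223077741111474407522755221525921439287630684754168399338961108220738 21
    2590830323899502605427620420390785057345423623962482846008122033349761938170 21 g106 (by norm_num) (by decide +kernel)

lemma g108 : Good posM negM 442368 8194 8202 348275237089256698 133990469278740 :=
  cs 27637632995104059874527135879076532708118761543999690100625139909809972178600848 22
    67661316583698889176956639411685992545576434714608808389382857468686981530582515716 23 g107 (by norm_num) (by decide +kernel)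

lemma g109 : Good posM negM 446464 8191 8195 348371220835152069 134051086935831 :=
  cs 1471473362669142520836141981260981338176349131896521918 15
    16446364678422564882755668533841500900650577917020533477574268073879425273799023 22 g108 (by norm_num) (by decide +kernel)

lemma g110 : Good posM negM 450560 8189 8188 348461124398217904 134143535312329 :=
  cs 298858682210217862290294197456240148840854462923066 14
    7083234223567213949649718036015278146002126126456940596438683649367801283798 21 g109 (by norm_num) (by decide +kernel)

lemma g111 : Good posM negM 454656 8188 8182 348517133289420462 134223231434458 :=
  cs 29988652467533924793330209352 8
    335313623279923493945270256629370737388238073034956 14 g110 (by norm_num) (by decide +kernel)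

lemma g112 : Good posM negM 458752 8189 8200 348678694889042200 134299703133707 :=
  cs 11968584210803400621892556927355593797830792456325425446309860556843169278430598605185366227294607444200441835784766238964882375686649450021915795468 41
    81122241487479629488963740320842186980863075785350619893374734407842205088981062676 23 g111 (by norm_num) (by decide +kernel)

lemma g113 : Good posM negM 462848 8193 8204 348903606787687796 134368252667848 :=
  cs 52288006029956336078390888622216880314647814209920383103274913799222743662423761671826153747734431541893609617392255322747231756704749898797030944271379392626731704721425 47
    209862071049613223130961714674746036842430930204502823512032905944288812347331388850721434070203494062800150458543838275574683373532896020762341420567881019 43 g112 (by norm_num) (by decide +kernel)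

lemma g114 : Good posM negM 466944 8191 8205 349064678031401548 134428219527322 :=
  cs 159656505712499196280943244869865039071965471254318453853605530296337032094014313747512363627911199898529953832264272372 33
    20119556849663854059920661324191154850335410294895397470787058376039326772775058440205756353854565769234423702909234 32 g113 (by norm_num) (by decide +kernel)

lemma g115 : Good posM negM 471040 8198 8199 349172890497060517 134494706229045 :=
  cs 425126330606183528582854037044172254926808223756241026145809774755868 19
    924250034223942627342719710051900455218285394924958249868935558421053800257130129511052006 25 g114 (by norm_num) (by decide +kernel)

lemma g116 : Good posM negM 475136 8196 8203 349275285890674226 134563660214832 :=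
  cs 110891013767465778358870538310350482346767574658336097132506571957181820042844538869 23
    142838288709522858785357954831524525296296325380350850066075233960548 19 g115 (by norm_num) (by decide +kernel)

lemma g117 : Good posM negM 479232 8198 8200 349442134851830080 134624418463103 :=
  cs 110667764589612562274433776649595228831195160918633820574631910489304907472830662070205661621183368341772120851934627571 33
    10180647912599352638125024290245583047149130569810875636886940944985814046991178641062447363488038388545793772928268580082264769056 36 g116 (by norm_num) (by decide +kernel)

lemma g118 : Good posM negM 483328 8195 8200 349542797738240726 134708706210631 :=
  cs 5201084747222747275076104893445381742157222519361128167705438455191910381607 21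
    6022881775907251440710718362669478800530947197297538243344989613268379369504 21 g117 (by norm_num) (by decide +kernel)

lemma g119 : Good posM negM 487424 8202 8197 349701999893140309 134777010203164 :=
  cs 38064541642824934759265240152961001905243212279988163441240592432011861440211690687787828782444909940053670697829648 32
    1992908916077465170462385866657661491387468664043530325220419996670997600945092047432532117100248586407470004585255816039981488 35 g118 (by norm_num) (by decide +kernel)

lemma g120 : Good posM negM 491520 8194 8189 349800874300755130 134856148476657 :=
  cs 21184111624576978190179533364709626611344339568801115964777873 17
    2027565460177518738411871527619944102340940970135755720048100260503443329320237309350834478 25 g119 (by norm_num) (by decide +kernel)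

lemma g121 : Good posM negM 495616 8193 8185 349959914535891947 134924230745040 :=
  cs 37135048084193327023695185256166230406778533250585078568594519512253272714844957641705492261781238245704141720027779 32
    9080995112089508924415924863711720550597340948199171383809970259204470146609035649434828627601449705587749198168617343153311105036 36 g120 (by norm_num) (by decide +kernel)

lemma g122 : Good posM negM 499712 8189 8189 350043307123334636 134998350819599 :=
  cs 786128080288482430905419013740110621683421435813765408902015447692538374 20
    6217059332833687499786575326884048835514765559759841092882 16 g121 (by norm_num) (by decide +kernel)

lemma g123 : Good posM negM 503808 8192 8188 350183414765225874 135051745958179 :=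
  cs 1227894773187782173707610620511656670024162741411116968940457178658013026756456323826900246649779784273262311 30
    8625953086761975411058876517428479849056670968815765449489417598882810806671643672236291394355742546924656443912 31 g122 (by norm_num) (by decide +kernel)

lemma g124 : Good posM negM 507904 8191 8185 350313285681838163 135104052572361 :=
  cs 21615454466525538711465161120610453786664510978126661361707905711282000416202736492879496675894016 27
    2284882453985541371716289019490607515491651725388493283638077992995596855605439485200539323866382079107317766 30 g123 (by norm_num) (by decide +kernel)

lemma g125 : Good posM negM 512000 8189 8189 350349494610441305 135199926196328 :=
  cs 962052250864294029567327552466076097 10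
    4221874253613656225414 6 g124 (by norm_num) (by decide +kernel)

lemma g126 : Good posM negM 516096 8191 8207 350569183100384463 135265589420529 :=
  cs 324262631571591715594578047653563408511636553897894103087639088040407206861287036433909049893738521315559902337115625629926794798274549952276388604629449604778961805933737162715102946360245178715459264526901420 58
    2104035466707706252298177821953158904421541591582752967886562911528431700992336577397016433617807001808976682094059951016739785162148450898051782 40 g125 (by norm_num) (by decide +kernel)

lemma g127 : Good posM negM 520192 8202 8204 350709336954203432 135313804662277 :=
  cs 2041136058079030097568067559409364622664055571261573560668301335908930854582934280212155414136292029522534402 30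
    91947318884178519246843520675592747261018920401072158442309889076607723003673047215751008526002623192619523698782073714 33 g126 (by norm_num) (by decide +kernel)

lemma g128 : Good posM negM 524288 8190 8190 350749143494109715 135384663240103 :=
  cs 16576438 2
    1402559752948707784520835533525977687953329660009022873830 16 g127 (by norm_num) (by decide +kernel)

lemma g129 : Good posM negM 528384 8194 8192 350832503633337160 135437815021760 :=
  cs 1635250186212296047144839746782142722513299782071400935288802762295689298 20
    75351586889917544245349609818738566818890802611287699428239508358 18 g128 (by norm_num) (by decide +kernel)

lemma g130 : Good posM negM 532480 8195 8211 351043140394326416 135498603603891 :=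
  cs 299294647990800186351775687571857416967266619115665826991122628034068470644330336972995447056354243723025330250589770018741152451322816727863256697538625761004644942661160179270162002569737635111978103074795790 58
    456915062119297491728086093891740112622037193709290893382816124526481092594888839014546425962849015867731092279417569993988483226718746719952 39 g129 (by norm_num) (by decide +kernel)

lemma g131 : Good posM negM 536576 8193 8189 351181283647455553 135540224601123 :=
  cs 4029393320229801835449496935732532984304014263565173819289230165627182655456 21
    200851896687396777340126722588780624076720865555270338233396181608709757136296889881000293873057040927387831260298380954911223651357473881134844647922512066 43 g130 (by norm_num) (by decide +kernel)

lemma g132 : Good posM negM 540672 8184 8193 351331139303673405 135601516454481 :=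
  cs 37750796377410547067760560279278012737218867506459355351316799659900937090607274495095624266381723240707946437673362691604250449535880 37
    103652562849339359726268562054007795481396842715401758541422393912584248809060564513401400423370832174552911953360376140 33 g131 (by norm_num) (by decide +kernel)

lemma g133 : Good posM negM 544768 8201 8199 351428753015578149 135699997647357 :=
  cs 7934148175148007651973665648777253300363470602558258378915111288455695936948474098576650150055 26
    1308199474727295483607137514264729218306722731541036493569937022395229327 20 g132 (by norm_num) (by decide +kernel)

lemma g134 : Good posM negM 548864 8196 8197 351470933976540345 135761135593226 :=
  cs 309370709180342465971056769992631 9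
    1510366877265339847315347035174988997449 11 g133 (by norm_num) (by decide +kernel)

lemma g135 : Good posM negM 552960 8199 8200 351535854736512116 135810825246019 :=
  cs 22351936127887863574590871214071410351646821172921770018411856 17
    80767572577158085095271653573656911160017167078020 14 g134 (by norm_num) (by decide +kernel)

lemma g136 : Good posM negM 557056 8192 8186 351730887257727754 135858100124605 :=
  cs 2318250690840795578432500930232041010236248299910027507636549492565612894930774207233024331331432611141334702934521196081140553884416595950242148 40
    1130335470724694001240353565847428831835698618506078409127815142199163857959837627141161744199260649890268792335385449172100211415688846710984411206746933605401645159680004799140759416878072762473 54 g135 (by norm_num) (by decide +kernel)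

lemma g137 : Good posM negM 561152 8193 8181 351864945207676424 135911614222680 :=
  cs 1221579810631075419685294597560010308189190818868359514912498025431401604024166870923114974674148972953232490 30
    2376409679610483402016181167029388492249320425975826853341780137746055024041816940815710846702412213130046584533370314293485881 35 g136 (by norm_num) (by decide +kernel)

lemma g138 : Good posM negM 565248 8192 8199 352073790154707205 135973971659098 :=
  cs 4126968409787956753226146683426229624305006992733550337199019213628863616911828670753517380977140633965299598791020596989029728055631909491179858190778397603099854355542892968544985738575426428291010603243567960498606 60
    52361453673693830126985771134179632934198404654054443906454016553861495428141798639680966164977239786063155346062488390106372984086942391875683859977442 42 g137 (by norm_num) (by decide +kernel)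

lemma g139 : Good posM negM 569344 8182 8187 352191802795519903 136038281295595 :=
  cs 61256899157679303801580858950795801333935519779517256810467251902019850230975820719 23
    2523865358344001173023782962533975091922121963004094317283208220708543860379909047108089145063381140697727959247643362033975301 35 g138 (by norm_num) (by decide +kernel)

lemma g140 : Good posM negM 573440 8202 8202 352254283500527883 136118191791777 :=
  cs 110713136365303308419548746722963648942499714364416701769483134014896042671140725362 23
    48291323887242441004567504248 8 g139 (by norm_num) (by decide +kernel)

lemma g141 : Good posM negM 577536 8186 8187 352388507700605758 136178274616736 :=
  cs 7710023977541638050033943003821974215018122109239449642814389433514877445318052108902766151086 26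
    10098197142928874941665300372745345573363216254446175026539750716067049439470914204329830838943797254177552997612040943121561052206534566161483862626 41 g140 (by norm_num) (by decide +kernel)

lemma g142 : Good posM negM 581632 8191 8190 352414420503053796 136230255315983 :=
  cs 3347123836444627590458237076 8
    562524200988575658 5 g141 (by norm_num) (by decide +kernel)

lemma g143 : Good posM negM 585728 8202 8186 352548754367727914 136288867754616 :=
  cs 24170391449076309671263664910056182747709416018575066445156176477081875711840172565289884295116540090806021510184998 32
    9419612475342472010746024692300369840978637052602808522533426490172969083105615218192946570593344074007575474956921195388253115325 36 g142 (by norm_num) (by decide +kernel)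

lemma g144 : Good posM negM 589824 8194 8204 352654618759090047 136335506277193 :=
  cs 10825221803443370854748326408370580795236328596736538769869371521025110306261891749627217910042096869247436472984011896092719411734 36
    59175459332097301889762195798992278264667367732163985661032933122 18 g143 (by norm_num) (by decide +kernel)

lemma g145 : Good posM negM 593920 8202 8194 352728628637627725 136391746846624 :=
  cs 361991983963235879720324728714013480343062358239280 14
    403202173737241197079175212542270018744923239536824650472459614927080558386497478365971 24 g144 (by norm_num) (by decide +kernel)

lemma g146 : Good posM negM 598016 8191 8197 352807866631266240 136444951932259 :=
  cs 29374933174362703255193842680886719063390562026011628354431483518218619028505534 22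
    282095033673891047313569702788509083311386702926946892437051418855418 19 g145 (by norm_num) (by decide +kernel)

lemma g147 : Good posM negM 602112 8184 8179 352865454591160509 136497357613910 :=
  cs 2382512993060578631682 6
    487728847622322518046648775893208124814264958642107233568172009256222477184109790348114 24 g146 (by norm_num) (by decide +kernel)

lemma g148 : Good posM negM 606208 8187 8185 352976187770009325 136548733267079 :=
  cs 30472651795859586719515726923481344320266741128408601073955960186293091123620570317965932806160564464810569079890597 32
    7648300544090155762837411167688284943914330511393000009804419788902632993183841180872334157576 26 g147 (by norm_num) (by decide +kernel)

lemma g149 : Good posM negM 610304 8187 8192 353068980217837098 136604300878709 :=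
  cs 135608459923511117600924585266522612867093477764613370247264861612754918373733572568274390061148905653 28
    5874431241956736006445852613392205702354977703292344341284434416350603495034 21 g148 (by norm_num) (by decide +kernel)

lemma g150 : Good posM negM 614400 8192 8202 353238295768696889 136652479358230 :=
  cs 4147488694006130532886118525287015483706935763084708866444291758573200905100899881204616689388013248821739174000430113852849216920483674876010499591460214029128756953871157439963185 50
    1927174685030127965853400148813362572079863516854750217706220389036252588677132990819101910511226112599108113136728593802044133527897457631778516 40 g149 (by norm_num) (by decide +kernel)

lemma g151 : Good posM negM 618496 8189 8191 353352369023147046 136705618528941 :=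
  cs 1820647052345755745102894119180378718271474687595074579122495471898757697041823707447697408 25
    7098571449003028508517562943588907097930005785986256475338701170285617685121645440783626870843178349427638190666815184021890618452 36 g150 (by norm_num) (by decide +kernel)

lemma g152 : Good posM negM 622592 8193 8188 353439765384454130 136743502065893 :=
  cs 24322269724852642655062403295666610709029286658453389985666573707760280342839316 22
    1989280868387709514179282506544820847273725834690381359059573287979919099850415080707916892 25 g151 (by norm_num) (by decide +kernel)

lemma g153 : Good posM negM 626688 8191 8186 353484077121808486 136813469117785 :=
  cs 1986350853665074963063516209975859847669 11
    65334833572267624472810257315343038977164126830 13 g152 (by norm_num) (by decide +kernel)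

lemma g154 : Good posM negM 630784 8192 8186 353583014884214886 136870942580828 :=
  cs 20730783952505483872550175108816830394263808779908184883939694089487176635061497092175555120620356 27
    26823194296391476215425185131493341427614282319209400194581927750530704988659765108522934754765798 27 g153 (by norm_num) (by decide +kernel)

lemma g155 : Good posM negM 634880 8196 8192 353633998503327587 136931348548438 :=
  cs 14089252953817179728463209405011252266680847363236069472921030 17
    4481813698978646628099898943888121948932 11 g154 (by norm_num) (by decide +kernel)

lemma g156 : Good posM negM 638976 8207 8205 353697287359513591 136977845518746 :=
  cs 461249754884772366439587347421658749531089726316375188345575519732350665440615249044481 24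
    3399665332603937952465558986956016660850 11 g155 (by norm_num) (by decide +kernel)

lemma g157 : Good posM negM 643072 8189 8191 353758462787826120 137033792219751 :=
  cs 1205231477069390594712373871257859503 10
    375755304099141373345260109792604732323320718228573275945048676701862858886754851676430 24 g156 (by norm_num) (by decide +kernel)

lemma g158 : Good posM negM 647168 8192 8206 353935259475161313 137065012364912 :=
  cs 80204369217490803937588621002722127227608859588264774558557666972097663855631413880639703637458765701462763949328121267926126075680617425682239548908055981603109268640017391694331616708051105136402158936252 57
    37218331304311744214913139902147126376230105038398181260408941958951687225431083969226738470108840280713535734056664892540113951084882107636863780497016 42 g157 (by norm_num) (by decide +kernel)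

lemma g159 : Good posM negM 651264 8186 8197 354068438871897400 137113895770510 :=
  cs 140857110988525089722158069389819718297387550231913950038615535294428652882899700814389449073812678806524429655997448194 33
    31578018121620996431176396066352780039887236849615001482795344343537982962444100956819209028431653100926725379801045527370618113099027369903032303584118 42 g158 (by norm_num) (by decide +kernel)

lemma g160 : Good posM negM 655360 8194 8180 354130164192184784 137169088416718 :=
  cs 321586357072570532768158271779162 9
    6768680552120719484146827829569552946085278293176454797096425007298533205870823968782522930211 26 g159 (by norm_num) (by decide +kernel)

lemma g161 : Good posM negM 659456 8195 8200 354253004250081510 137207169058116 :=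
  cs 3549909789169508854523288824338699848284567077143877614199671429545667623803355609646255169805189231122300523777301328716052458523370400475663713706471464411369538 45
    912313426928982027034200951336771718903271850537508248154314460731426951060537238938662322 25 g160 (by norm_num) (by decide +kernel)

lemma g162 : Good posM negM 663552 8202 8193 354275685643770234 137251739331321 :=
  cs 45745838749 3
    439505261384920428889643541703815838 10 g161 (by norm_num) (by decide +kernel)

lemma g163 : Good posM negM 667648 8182 8177 354379483229280643 137301703014703 :=
  cs 19624311443667566931835884360532916361475215231900053740042633238036676377716832 22
    178936822223446398175491226419885283197161290055087412973785452900986322116041514934071572694881815517940523947222528905296579825152791730 38 g162 (by norm_num) (by decide +kernel)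

lemma g164 : Good posM negM 671744 8188 8186 354470787714767126 137345370226255 :=
  cs 3676364971678998550165843106520584178459581340004411354610866525264949765692614600155129155112424869753656209862 31
    18762897473795712369154116447150563086713806913953344364713429623229670511921355 22 g163 (by norm_num) (by decide +kernel)

lemma g165 : Good posM negM 675840 8198 8192 354498188397064574 137390336322210 :=
  cs 3010105123941220377150066342648172793924 11
    854766024555932583 5 g164 (by norm_num) (by decide +kernel)

lemma g166 : Good posM negM 679936 8192 8191 354564498810250597 137452383862069 :=
  cs 216996221228216127812379829118298085460557980287094115997435207063413 19
    1755628882787160719110002338253786034084566565304745260026306747145846829 20 g165 (by norm_num) (by decide +kernel)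

lemma g167 : Good posM negM 684032 8194 8185 354726733762744593 137501481572235 :=
  cs 2670124132095637944224696575111611803517201505845272346103088629732453617439559761884130151050642814530506304926826108779262369978083241365233339642368954037433058 45
    16332330133789188431677875322023001876257679757834594286278251655155191156739613049428695870937415799526464933105060644576379556673248752099214978594875303502775685691258465623325327372 51 g166 (by norm_num) (by decide +kernel)

lemma g168 : Good posM negM 688128 8193 8193 354790622045744482 137551091149580 :=
  cs 66771787198871464452776379897285713757601788703423376014740738811350128312784016769 23
    1148529533409318086194735904803821666324660180387844148 15 g167 (by norm_num) (by decide +kernel)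

lemma g169 : Good posM negM 692224 8193 8200 354885848129333955 137585935416479 :=
  cs 30116779500021077116794109579854410177814784335568923260642434511211613466708094251213185216842512904651824718753869 32
    1921129907720916402429734177820590624339823953028517037304408276879359916040923933046408105 25 g168 (by norm_num) (by decide +kernel)

lemma g170 : Good posM negM 696320 8205 8213 354993766642712467 137623811576037 :=
  cs 693840832032168085902916614155338509746611645516956322341931269085542375393858492181721766786844831425279183296914563120622544561196625155153 39
    4380691880618941929490246311984590830766827335151793771386932189017063648037548797169512955952 26 g169 (by norm_num) (by decide +kernel)

lemma g171 : Good posM negM 700416 8195 8197 355083009564629140 137657804870604 :=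
  cs 347404599207717617273752002272160112240663466504032317609172477867812 19
    733289126670874342569629848835343400721727986385327908549985519634076067235738713841126154257512324754213048743733906598175017 35 g170 (by norm_num) (by decide +kernel)

lemma g172 : Good posM negM 704512 8191 8188 355101067485768125 137693162041779 :=
  cs 2647 1
    1212696751172891245139005121796793280 10 g171 (by norm_num) (by decide +kernel)

lemma g173 : Good posM negM 708608 8188 8167 355207071580379158 137742130118073 :=
  cs 19197222049847805512748640657300920176928442464423992459035443944316115655029622 22
    184088005749276742529384183439436190314901309938241405155035274518720278901574145713513260071155214537136470279183772688150557569032816692978221011933509354 43 g172 (by norm_num) (by decide +kernel)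

lemma g174 : Good posM negM 712704 8191 8192 355338581904434708 137773520665140 :=
  cs 247549819028186077281080787165409321090066037620243659520120169498556820310339771394060302625335768581964883807268093759480949686312662181842378613046258953437178173883319974739058231505182860 53
    92228796517418739292751460216862615482637467843538216181858973254501358538764592883285028902975219626 28 g173 (by norm_num) (by decide +kernel)

lemma g175 : Good posM negM 716800 8192 8188 355377299138981326 137811040889768 :=
  cs 481053861910036510924602858322257210 10
    342805601776601127295562621644680022429549593350588 14 g174 (by norm_num) (by decide +kernel)

lemma g176 : Good posM negM 720896 8191 8187 355407733898161388 137854875286977 :=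
  cs 160476149786839500956050922640632 9
    1328578245411313475415840911378099946 10 g175 (by norm_num) (by decide +kernel)

lemma g177 : Good posM negM 724992 8189 8191 355442820563624715 137879899919148 :=
  cs 41399658860326103279426300424196771615557608717 13
    317465484991165659343199078989826 9 g176 (by norm_num) (by decide +kernel)

lemma g178 : Good posM negM 729088 8196 8205 355474489055048960 137918194862031 :=
  cs 22590521141971925756340263495589248946592202882452907824098392 17
    33529054851 3 g177 (by norm_num) (by decide +kernel)

lemma g179 : Good posM negM 733184 8193 8193 355509236025158468 137961533678957 :=
  cs 696539077148273053 5
    10918540435630598369477712586216122416216713637361436758667444 17 g178 (by norm_num) (by decide +kernel)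

lemma g180 : Good posM negM 737280 8196 8197 355531162847662449 137997530635479 :=
  cs 266984861352022075667985980263695 9
    634313517360998508 5 g179 (by norm_num) (by decide +kernel)

lemma g181 : Good posM negM 741376 8193 8186 355598280545424304 138037554098750 :=
  cs 2169007365565242862110242789125736963064840637037066433540 16
    26998422165127076530959790417103451492851963698008826111420946568365133830028963484057571957760026 27 g180 (by norm_num) (by decide +kernel)

lemma g182 : Good posM negM 745472 8195 8195 355634011133844063 138084848753181 :=
  cs 3381504739294252506390271248464336338119107788019834908738 16
    6060272268140789711185008 7 g181 (by norm_num) (by decide +kernel)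

lemma g183 : Good posM negM 749568 8193 8207 355677131111760060 138120550725863 :=
  cs 1748292722464952712564621915329275864483182041046080957862626743952513897 20
    40996523210647743739116364036 8 g182 (by norm_num) (by decide +kernel)

lemma g184 : Good posM negM 753664 8199 8212 355767604217598641 138156842312653 :=
  cs 33811619642092204304841700109778388588137423125133108049492323822887824579381481481909153373745918012541010207386359 32
    13737066623769884708789455702436351467219757564660901359868608080981269749545245630773178491339359 27 g183 (by norm_num) (by decide +kernel)

lemma g185 : Good posM negM 757760 8190 8195 355869886083476606 138185496131087 :=
  cs 1335141164323021685724151864521813274600087261293045375613156406551148307650265482297808812 25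
    47514123978696933053726784601421801295327936863947919019805592163418957696907102069770324518163601279802283673989425080317454805698589136957816836891050 42 g184 (by norm_num) (by decide +kernel)

lemma g186 : Good posM negM 761856 8184 8193 355894202098285739 138227695750021 :=
  cs 7004975079432449280382379 7
    61568833879940025761429739168036 9 g185 (by norm_num) (by decide +kernel)

lemma g187 : Good posM negM 765952 8191 8195 355933442770339456 138262880105696 :=
  cs 264322274293504426826317164002580725008077459521847 14
    10396118703196777630261662385634539645208136 12 g186 (by norm_num) (by decide +kernel)

lemma g188 : Good posM negM 770048 8192 8200 355961930917541973 138298076652947 :=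
  cs 21217017572305694349813612075949518025051883 12
    11275028598962515501908287 7 g187 (by norm_num) (by decide +kernel)

lemma g189 : Good posM negM 774144 8192 8191 355984346348078180 138332344395687 :=
  cs 37002782873 3
    8375708011725960808296582072861804785067013 12 g188 (by norm_num) (by decide +kernel)

lemma g190 : Good posM negM 778240 8190 8177 356058609706121709 138363979055032 :=
  cs 41918826763609748634470000345805884852538034031937477957204296752 18
    31579332133800023110956755292224718351358223248277179919371505949320402052140761402732964753775651794520765567664134 32 g189 (by norm_num) (by decide +kernel)

lemma g191 : Good posM negM 782336 8189 8176 356131038876034525 138389935907613 :=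
  cs 119741728237500058587286506568260422070452823141176814226650459987143531413722548527132 24
    1674380099622376611326699390657007130549646822742657970665377329410103042404091449712142933 25 g190 (by norm_num) (by decide +kernel)

lemma g192 : Good posM negM 786432 8190 8201 356217814395184417 138422105555631 :=
  cs 50685992391045594159032226010275612121780680754146233831489812849319422099357737977501989022347473939374376575734751712394880668992106313101993526960317 42
    13568109452953735835146126736903308287623781550111849981076688 17 g191 (by norm_num) (by decide +kernel)

lemma g193 : Good posM negM 790528 8195 8206 356295286070930777 138456404069516 :=
  cs 481241290921864724703289243937069536927310418378334126449946174264792267372883418868960431005295644293898 29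
    234270124244919804426577176545590174820487994655261348812032069732622604234856201339936 24 g192 (by norm_num) (by decide +kernel)

lemma g194 : Good posM negM 794624 8191 8199 356375311708793629 138499542444553 :=
  cs 356566764506104242540200256075219253600072078592902145746134280944100665527472045967810 24
    4026380402064993424651562508397372542449179566325160272926292717798419540855368142232562863240535196412312051908 31 g193 (by norm_num) (by decide +kernel)

lemma g195 : Good posM negM 798720 8192 8198 356449102739060133 138527130761826 :=
  cs 1971870577593986963346948211888746953091859741772805884904393382586094540006295129411109051 25
    3855009251789581024708916263826708896759294483225202037515919480151416979224567000484681979158 26 g194 (by norm_num) (by decide +kernel)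

lemma g196 : Good posM negM 802816 8182 8195 356502359583521996 138564374702780 :=
  cs 20110449776524463355003789206761974874185825860622183697969270 17
    866379526500383400148911380459231002831527789567973141088759718259753972 20 g195 (by norm_num) (by decide +kernel)

lemma g197 : Good posM negM 806912 8192 8185 356556770920363866 138606856125603 :=
  cs 372225238996175722504490653926179652719872744515362 14
    390571742437691759998827563197048246458834255702588446706120133780159802769147989361188 24 g196 (by norm_num) (by decide +kernel)

lemma g198 : Good posM negM 811008 8182 8190 356578166809302090 138638557923081 :=
  cs 387894272524289972366191364011311192 10
    972451915840867708 5 g197 (by norm_num) (by decide +kernel)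

lemma g199 : Good posM negM 815104 8196 8201 356636284700825034 138677083526374 :=
  cs 5493189604039233930415858904082959798784062388309018502095634982239434609581944205723699019994 26
    1337518328820636856187564577709508707583934745148818523 15 g198 (by norm_num) (by decide +kernel)

lemma g200 : Good posM negM 819200 8217 8201 356706910388648277 138709383618624 :=
  cs 1761946854314762869816950316995022749819706087990807803375078682938243524797518736667133211 25
    213900970472380328719514235509084009453652875682843655779536418986019502690718847670390836 25 g199 (by norm_num) (by decide +kernel)

lemma g201 : Good posM negM 823296 8192 8192 356800978930711248 138743327069579 :=
  cs 349905558072182663108093738205883360826376595673618288257410112744198334957582047333852403827357302335586 29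
    185474976344367018483496635878320357892592478958391804265809675909249739485900875818853028020097736455709984411027906774118860155566080233 38 g200 (by norm_num) (by decide +kernel)

lemma g202 : Good posM negM 827392 8199 8194 356809356067769120 138769392412527 :=
  cs 220918098390132 4
    6480302 2 g201 (by norm_num) (by decide +kernel)

lemma g203 : Good posM negM 831488 8205 8193 356813528990512104 138811131407822 :=
  cs 3578 1
    1704348 2 g202 (by norm_num) (by decide +kernel)

lemma g204 : Good posM negM 835584 8193 8189 356821810914345984 138843141638847 :=
  cs 2847 1
    1117165178098003773 5 g203 (by norm_num) (by decide +kernel)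

lemma g205 : Good posM negM 839680 8176 8184 356864461694980037 138878097628699 :=
  cs 38768007548820604261025661949449833841433171562 13
    84069806041746160308255514278168602919950507096824991790112223286 18 g204 (by norm_num) (by decide +kernel)

lemma g206 : Good posM negM 843776 8189 8188 356886395908238574 138929035463176 :=
  cs 230139761471082206057198665057567082 10
    3100957646776518912564 6 g205 (by norm_num) (by decide +kernel)

lemma g207 : Good posM negM 847872 8190 8184 356930009348098203 138971757190235 :=
  cs 212700149353771256162645002037505622526670772736024 14
    88775881266429950203860543046105218663159742193669261423727719484 18 g206 (by norm_num) (by decide +kernel)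

lemma g208 : Good posM negM 851968 8198 8193 356942240887591229 139011558884005 :=
  cs 38197203092677886646422930477443 9
    0 0 g207 (by norm_num) (by decide +kernel)

lemma g209 : Good posM negM 856064 8191 8198 356957078301111889 139043849940511 :=
  cs 69109396130259651622568909741 8
    14733968232 3 g208 (by norm_num) (by decide +kernel)

lemma g210 : Good posM negM 860160 8186 8195 356996046655877352 139074895271282 :=
  cs 57282265917621242308805504842682311913928214975 13
    2700907190473422470228299094884365281998864315042291729588 16 g209 (by norm_num) (by decide +kernel)

lemma g211 : Good posM negM 864256 8194 8204 357090992104434477 139121977336572 :=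
  cs 2506546821261677023635724029172770655200068645416292574013751687946613589323855328267759993957187745060355689855474202190894977302020669370978578 40
    4392844222889207878509351266121686656777074816472521347920694311833634464849287618871814309688193568653666641204 31 g210 (by norm_num) (by decide +kernel)

lemma g212 : Good posM negM 868352 8192 8191 357108328027070352 139151062534333 :=
  cs 0 0
    16350432589504645864263721918506877451994677316 13 g211 (by norm_num) (by decide +kernel)

lemma g213 : Good posM negM 872448 8181 8190 357120249946868523 139186380567238 :=
  cs 201121793884491 4
    1048352829010708292 5 g212 (by norm_num) (by decide +kernel)

lemma g214 : Good posM negM 876544 8187 8183 357137377717725905 139217015406175 :=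
  cs 7350210996 3
    1078313895288145888886787346094902344 10 g213 (by norm_num) (by decide +kernel)

lemma g215 : Good posM negM 880640 8199 8197 357205608840935814 139244454888904 :=
  cs 151577102673680477185872476569166277673748310017333632876208610237905549767362586246344732748175441122166254685891842493 33
    272298727389510624550895221148086587154533891143774003465927371700272 19 g214 (by norm_num) (by decide +kernel)

lemma g216 : Good posM negM 884736 8190 8194 357230396784183320 139269394907855 :=
  cs 77757744988145320835694555028 8
    3499382101482914212570194233050760062358 11 g215 (by norm_num) (by decide +kernel)

lemma g217 : Good posM negM 888832 8192 8185 357247290390383145 139290103800220 :=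
  cs 438378 2
    4887418130259659243024109533964588418556 11 g216 (by norm_num) (by decide +kernel)

lemma g218 : Good posM negM 892928 8201 8196 357354667325697854 139322936676025 :=
  cs 56741221895924334166987819028196999490236222007599008490605385645050501714336210133017617140769679227648973241463798430991173387388283245057264077702930546125988734730948 47
    7285450668962914712231116504808718483571752915777382556244658046609580562001616242746792492554922000488607566076252697225171798134 36 g217 (by norm_num) (by decide +kernel)

lemma g219 : Good posM negM 897024 8193 8199 357379112944890371 139359821155980 :=
  cs 5382022405532716017584097876189919145365 11
    48387778050827796142224025530 8 g218 (by norm_num) (by decide +kernel)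

lemma g220 : Good posM negM 901120 8191 8197 357425280615638633 139387665429046 :=
  cs 18446622337367963437185214532825907228624321817012285622448313 17
    415663474665658517198283048646774968149786137652957269023307065398320 19 g219 (by norm_num) (by decide +kernel)

lemma g221 : Good posM negM 905216 8173 8189 357466134942971390 139416154551277 :=
  cs 14997857155759006541844510230272061536851218 12
    1649918714388383883171113741891549488828896374785750916269064915626786880 20 g220 (by norm_num) (by decide +kernel)

lemma g222 : Good posM negM 909312 8176 8182 357495336539587538 139450031664468 :=
  cs 35657486393362143294226491065 8
    1331530924062289943189630625711095747596160350062521634 15 g221 (by norm_num) (by decide +kernel)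

lemma g223 : Good posM negM 913408 8191 8182 357556086319231358 139482694052618 :=
  cs 141242020475966998762542040405190007620933536244819476796816414244095370029750073475339 24
    309444917006763618813599935140782124241123786963844734979446301134321784059541508192222 24 g222 (by norm_num) (by decide +kernel)

lemma g224 : Good posM negM 917504 8192 8184 357596410544920579 139518286295744 :=
  cs 3384110466948948641288051982330583147542932499059103520596263 17
    1063202678008219870325414450980599227574880340395297436 15 g223 (by norm_num) (by decide +kernel)

lemma g225 : Good posM negM 921600 8196 8188 357626531135001063 139539399971647 :=
  cs 44221131490068846124046198357860701341956813508644 14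
    834214604976641192194806153524922524 10 g224 (by norm_num) (by decide +kernel)

lemma g226 : Good posM negM 925696 8188 8188 357651481682560015 139572323612497 :=
  cs 714763961916074014893194477478175308 10
    1271124751633223488041138770127380187 10 g225 (by norm_num) (by decide +kernel)

lemma g227 : Good posM negM 929792 8183 8187 357714870054790706 139601708745915 :=
  cs 879482199246945383813715376932696309058699910989307160098827979216493641703897610243601740 25
    6992813205561340873805040216607322251550746525043835106434859002646783338234286796987564573016 26 g226 (by norm_num) (by decide +kernel)

lemma g228 : Good posM negM 933888 8192 8199 357742079786461817 139629289499537 :=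
  cs 18817032654545747791877898136664234972756636947915258619888222 17
    1142504283786987263 5 g227 (by norm_num) (by decide +kernel)

lemma g229 : Good posM negM 937984 8192 8194 357797535141409631 139651191934971 :=
  cs 1018671742066575546685362958934631589157457729257153119281317489223902829 20
    1990275933103700805722989844941286879139009146584696482435907086163333324889048384769605686 25 g228 (by norm_num) (by decide +kernel)

lemma g230 : Good posM negM 942080 8192 8187 357879687529331899 139676317091953 :=
  cs 1520960909586482443828321585552031781994898949363582242662123941174955282437262977608234438454565564061799925 30
    45416288948632261846503054455685476418069957627152950062770675398325794471542918197938999937278571531773377625915762058868871121674355 37 g229 (by norm_num) (by decide +kernel)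

lemma g231 : Good posM negM 946176 8190 8193 357913869287077402 139701220117756 :=
  cs 18490571240370403181609311624155031998185912419258756405626407 17
    5315547370496505989074838052238012747782 11 g230 (by norm_num) (by decide +kernel)

lemma g232 : Good posM negM 950272 8182 8196 357944269355029098 139725677864010 :=
  cs 289070658655218295240008995002459567356378156165516 14
    2098033992520229499096131462937296396518 11 g231 (by norm_num) (by decide +kernel)

lemma g233 : Good posM negM 954368 8199 8199 357979351851289640 139752203408779 :=
  cs 5769719204589174102581334954726185168189568354528940793151 16
    42158581264214829791659698278359050996113274573 13 g232 (by norm_num) (by decide +kernel)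

lemma g234 : Good posM negM 958464 8195 8189 357991411506036613 139778624296994 :=
  cs 0 0
    899134380665199024179917221081220182 10 g233 (by norm_num) (by decide +kernel)

lemma g235 : Good posM negM 962560 8187 8180 358028610236991239 139802656451874 :=
  cs 1600780018739114963276383614018281505647 11
    1381548858089719121158430369451591880497546391908412940646399766379842140 20 g234 (by norm_num) (by decide +kernel)

lemma g236 : Good posM negM 966656 8186 8182 358081220658643699 139830095404752 :=
  cs 35935802021653335789335028899839573345183585582381709963880256241798019035800363091 23
    5017303310163900228821815161022909789635194564037992150170138835016241805792 21 g235 (by norm_num) (by decide +kernel)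

lemma g237 : Good posM negM 970752 8206 8204 358128847473162639 139866020042789 :=
  cs 7780272514741354926875118547111075950954738964549131935850772280333695096713572979326689205720614564319319380108 31
    98821625624523779354082103002300 9 g236 (by norm_num) (by decide +kernel)

lemma g238 : Good posM negM 974848 8196 8200 358188131039596262 139888549631185 :=
  cs 81448261662791995742144510743298864731816979015785458633211704605181645693670320237 23
    33257584136243511578027753087480395081215973099083626630835848434710881268464918086273602414977150 27 g237 (by norm_num) (by decide +kernel)

lemma g239 : Good posM negM 978944 8197 8189 358236532737475745 139920481912290 :=
  cs 842404387235277547530531058112604723663217801289844805 15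
    7090602872312219887291506848685958440816449837657444817504934705362164627033719620420721737736 26 g238 (by norm_num) (by decide +kernel)

lemma g240 : Good posM negM 983040 8198 8192 358247112977773561 139944969556945 :=
  cs 1971969594656074253697 6
    56653295880 3 g239 (by norm_num) (by decide +kernel)

lemma g241 : Good posM negM 987136 8193 8192 358247112977773561 139969378801564 :=
  cs 0 0
    0 0 g240 (by norm_num) (by decide +kernel)

lemma g242 : Good posM negM 991232 8190 8192 358258768741607446 140007036605909 :=
  cs 470174288849454660 5
    790292858604995318 5 g241 (by norm_num) (by decide +kernel)

lemma g243 : Good posM negM 995328 8196 8200 358295857702063334 140036776608310 :=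
  cs 1750019844511994235945460804181047884499939421108024801719928480603639865 20
    16707825317964856342578781242366230682799002 12 g242 (by norm_num) (by decide +kernel)

lemma g244 : Good posM negM 999424 8190 8186 358312042399745481 140061978582421 :=
  cs 0 0
    212060741902750592991295771210250645915647171528380 14 g243 (by norm_num) (by decide +kernel)

lemma g245 : Good posM negM 1003520 8188 8182 358360430504485567 140083575417204 :=
  cs 44452588325974584570625285803860940221157236889030115643014679585052 19
    94198092402478462003674773336928359539337194441173768552042366789637232532977469008 23 g244 (by norm_num) (by decide +kernel)

lemma g246 : Good posM negM 1007616 8196 8190 358385684699076111 140116325255604 :=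
  cs 172147364471328704367260457813587379677223712132202631 15
    12829058708734940318238132 7 g245 (by norm_num) (by decide +kernel)

lemma g247 : Good posM negM 1011712 8194 8187 358416484634521042 140144747470510 :=
  cs 13598271708858606526775898188537156178268668 12
    1522391174483917076537076879458501086967973479274479094 15 g246 (by norm_num) (by decide +kernel)

lemma g248 : Good posM negM 1015808 8186 8182 358469920569211131 140170221361198 :=
  cs 2887732684613950409044403765413080819295321274891103800232460141167992325487 21
    8088998229986857641398122788253412048391065834987900172704158422199357327719185547002243784716 26 g247 (by norm_num) (by decide +kernel)

lemma g249 : Good posM negM 1019904 8190 8190 358485788932238175 140194920011397 :=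
  cs 1326874011579775214862129309532667839298 11
    51686427646 3 g248 (by norm_num) (by decide +kernel)

lemma g250 : Good posM negM 1024000 8192 8199 358518504009372993 140221978642939 :=
  cs 395543760711953453738882694339859254676024159288067825636371364651023 19
    396009238158628327352609900557857866 10 g249 (by norm_num) (by decide +kernel)

lemma g251 : Good posM negM 1028096 8183 8189 358534240960442309 140247400942167 :=
  cs 10230209 2
    8669774471886414248099976511078429709976958 12 g250 (by norm_num) (by decide +kernel)

lemma g252 : Good posM negM 1032192 8206 8196 358584601955768980 140268545546625 :=
  cs 7718129341447290160097319774466080416923937108555144902555821964895986429316586080178989609359 26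
    242066693139801661541613459611218409923230138521046503344454982231946 19 g251 (by norm_num) (by decide +kernel)

lemma g253 : Good posM negM 1036288 8197 8195 358596872039696112 140302235083962 :=
  cs 1036241156678551404 5
    789942397118355907208 6 g252 (by norm_num) (by decide +kernel)

lemma g254 : Good posM negM 1040384 8199 8203 358634608629286615 140321036256721 :=
  cs 5581063430505930544448468652558808709979217359514145435034167919176320174858 21
    39080424911835494794284999393550774472378697214 13 g253 (by norm_num) (by decide +kernel)

lemma g255 : Good posM negM 1044480 8191 8197 358683275929627160 140348829891590 :=
  cs 311800403564878848225512923656772027768018842347945386433387018578334 19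
    2028579416547389337373854657188898707553701551151176058191954351620513708353151419915666107 25 g254 (by norm_num) (by decide +kernel)

lemma g256 : Good posM negM 1048576 8211 8192 358708602795582955 140378066258062 :=
  cs 308430864063334602224400369446614 9
    255459466903487701356865207404675628346324737327113 14 g255 (by norm_num) (by decide +kernel)

end PC

namespace PC

lemma harm_bd (n : ℕ) : ∑ k ∈ Ico 1 (n+1), (1:ℝ) / ((k:ℝ)+1) ≤ 1 + n / 4 := by
  induction n with
  | zero => norm_num
  | succ n ih =>
    rcases Nat.lt_or_ge n 3 with h | h
    · interval_cases n <;> norm_num [Finset.sum_Ico_succ_top]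
    · rw [Finset.sum_Ico_succ_top (by omega)]
      have hn : (3:ℝ) ≤ n := by exact_mod_cast h
      have : (1:ℝ) / (((n+1 : ℕ) : ℝ) + 1) ≤ 1 / 4 := by
        apply one_div_le_one_div_of_le (by norm_num)
        push_cast; linarith
      push_cast at *
      linarith

lemma sig_exists : ∃ σ : ℕ → ℝ, σ 0 = 0 ∧
    ∑ k ∈ Ico 1 (1048575+1), |σ k - σ (k-1)| / k + |σ 1048575| / (1048575 + 1 : ℕ) ≤ 0.3113 ∧
    ∑ k ∈ Ico 1 (1048575+1), |S (nuOf posM negM) 5306 k - σ k| * mk k ≤ 0.00012185 := by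
  obtain ⟨σ, h0, -, hs, hr, hi⟩ := g256
  have hK : σ 1048576 = 0 := by norm_num at hs; linarith
  refine ⟨fun k => (σ k : ℝ), by simp [h0], ?_, ?_⟩
  · rw [show 1048576 + 1 = (1048575 + 1) + 1 from rfl, Finset.sum_Ico_succ_top (by norm_num)] at hr
    have e1 : |((σ (1048575+1) : ℤ) : ℝ) - σ (1048575 + 1 - 1)| = |((σ 1048575 : ℤ) : ℝ)| := by
      rw [show 1048575 + 1 = 1048576 from rfl, show 1048576 - 1 = 1048575 from rfl, hK]; simp
    rw [e1] at hr
    generalize (∑ k ∈ Ico 1 (1048575+1), |((σ k : ℤ) : ℝ) - σ (k-1)| / k) = x at *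
    generalize |((σ 1048575 : ℤ) : ℝ)| / ((1048575 + 1 : ℕ) : ℝ) = y at *
    norm_num at hr ⊢
    linarith
  · rw [show 1048576 + 1 = (1048575 + 1) + 1 from rfl, Finset.sum_Ico_succ_top (by norm_num)] at hi
    have hnn : 0 ≤ |1 - (A (nuOf posM negM) 5306 (1048575+1) : ℝ) - σ (1048575+1)| * mk (1048575+1) :=
      mul_nonneg (abs_nonneg _) (mk_nonneg _)
    have h1 : ∑ k ∈ Ico 1 (1048575+1), |S (nuOf posM negM) 5306 k - σ k| * mk k ≤
        ∑ k ∈ Ico 1 (1048575+1), |1 - (A (nuOf posM negM) 5306 k : ℝ) - σ k| * mk k +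
        ∑ k ∈ Ico (1:ℕ) (1048575+1), (0.0000000000002 : ℝ) * (1 / ((k:ℝ) + 1)) := by
      rw [← Finset.sum_add_distrib]
      apply Finset.sum_le_sum
      intro k hk
      have hk1 : 1 ≤ k := (mem_Ico.1 hk).1
      have hk1' : (1:ℝ) ≤ k := by exact_mod_cast hk1
      have e : S (nuOf posM negM) 5306 k - σ k = (1 - (A (nuOf posM negM) 5306 k : ℝ) - σ k) + kap (nuOf posM negM) 5306 * k := by
        rw [S]; ring
      rw [e]
      have h2 : |kap (nuOf posM negM) 5306 * k| * mk k ≤ 0.0000000000002 * (1 / ((k:ℝ) + 1)) := by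
        rw [abs_mul, Nat.abs_cast, mul_assoc]
        apply mul_le_mul kap_small _ (mul_nonneg (Nat.cast_nonneg _) (mk_nonneg _)) (by norm_num)
        rw [mk, mul_one_div, div_le_div_iff₀ (by positivity) (by positivity)]
        nlinarith
      have h3 := mul_le_mul_of_nonneg_right (abs_add_le (1 - (A (nuOf posM negM) 5306 k : ℝ) - σ k) (kap (nuOf posM negM) 5306 * k)) (mk_nonneg k)
      rw [add_mul] at h3
      linarith
    have hb := harm_bd 1048575
    rw [← Finset.mul_sum] at h1
    refine h1.trans ?_
    generalize (∑ k ∈ Ico (1:ℕ) (1048575+1), (1:ℝ) / ((k:ℝ) + 1)) = z at *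
    generalize (∑ k ∈ Ico 1 (1048575+1), |1 - (A (nuOf posM negM) 5306 k : ℝ) - σ k| * mk k) = x at *
    generalize |1 - (A (nuOf posM negM) 5306 (1048575+1) : ℝ) - σ (1048575+1)| * mk (1048575+1) = y at *
    norm_num at hi hb ⊢
    linarith

end PC

theorem stmt_15 (x : ℝ) (hx : (10 : ℝ) ^ 100 ≤ x) :
    (Nat.primeCounting ⌊2 * x⌋₊ : ℝ) + (Nat.primeCounting ⌊x⌋₊ : ℝ) ≤
      3.015 * ((Nat.primeCounting ⌊2 * x⌋₊ : ℝ) - (Nat.primeCounting ⌊x⌋₊ : ℝ)) := by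
  obtain ⟨σ, h0, hr, hi⟩ := PC.sig_exists
  have hk : |PC.kap (PC.nuOf PC.posM PC.negM) 5306| ≤ 1 := PC.kap_small.trans (by norm_num)
  obtain ⟨β, hβ⟩ := PC.iter (PC.nuOf PC.posM PC.negM) 5306 le_rfl (PC.nuOf_abs _ _) hk σ h0 hr hi PC.tail_small
  exact PC.final β hβ x hx
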